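/- Assume that the primes have level of distribution ϑ for some fixed ϑ > 1/2. Then there exist an integer k(ϑ) and a constant c₅(ϑ) > 0 such that for every sufficiently small fixed η > 0, as N → ∞, #{j : N < p_j ≤ 2N, p_{j+1} − p_j ≤ η log N} ≥ (1 − o(1))·c₅(ϑ)·η^{k(ϑ)−1}·N/log N. -/

import Mathlib

open Finset

/-- The `n`-th prime number (`nthPrime 0 = 2`). -/
noncomputable def nthPrime (n : ℕ) : ℕ := Nat.nth Nat.Prime n

/-- The prime counting function `π(x)` at a real argument: the number of primes `≤ x`. -/
noncomputable def primePi (x : ℝ) : ℕ := Nat.primeCounting ⌊x⌋₊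

/-- `P_H(n) = ∏_{h ∈ H} (n + h)`. -/
def tuplePoly (H : Finset ℕ) (n : ℕ) : ℕ := ∏ h ∈ H, (n + h)

/-- `ν_p(H)`: the number of distinct residue classes modulo `p` occupied by `H`. -/
def nuP (p : ℕ) (H : Finset ℕ) : ℕ := (H.image (· % p)).card

/-- `H` is admissible: for every prime `p`, the elements of `H` miss a residue class mod `p`. -/
def Admissible (H : Finset ℕ) : Prop := ∀ p : ℕ, p.Prime → nuP p H < p

/-- The singular series `𝔖(H) = ∏_p (1 - 1/p)^{-|H|} (1 - ν_p(H)/p)`. -/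
noncomputable def singularSeries (H : Finset ℕ) : ℝ :=
  ∏' p : Nat.Primes, ((1 - 1/((p : ℕ) : ℝ)) ^ (-(H.card : ℤ)) * (1 - (nuP p H : ℝ)/((p : ℕ) : ℝ)))

/-- `Λ_R(n; H, ℓ) = (1/(|H|+ℓ)!) ∑_{d ∣ P_H(n), d ≤ R} μ(d) (log (R/d))^{|H|+ℓ}`. -/
noncomputable def LambdaR (R : ℝ) (n : ℕ) (H : Finset ℕ) (ℓ : ℕ) : ℝ :=
  (1 / (H.card + ℓ).factorial : ℝ) *
    ∑ d ∈ (tuplePoly H n).divisors.filter (fun d : ℕ => (d : ℝ) ≤ R),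
      (ArithmeticFunction.moebius d : ℝ) * (Real.log (R / d)) ^ (H.card + ℓ)

/-- `𝒫(x)`: the product of all primes `≤ x`. -/
noncomputable def primorialReal (x : ℝ) : ℕ :=
  ∏ p ∈ (Finset.range (⌊x⌋₊ + 1)).filter Nat.Prime, p

/-- `θ(n) = log n` if `n` is prime, and `0` otherwise. -/
noncomputable def theta (n : ℕ) : ℝ := if n.Prime then Real.log n else 0

/-- `∑_{p ≤ N, p prime, p ≡ a (mod q)} log p`. -/
noncomputable def primeSumAP (N q a : ℕ) : ℝ :=
  ∑ p ∈ (Finset.range (N+1)).filter (fun p => p.Prime ∧ p % q = a % q), Real.log p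

/-- The primes have level of distribution `ϑ`: for every `A > 0` and `ε > 0`,
`∑_{q ≤ N^{ϑ-ε}} max_{(a,q)=1} |∑_{p ≤ N, p ≡ a (q)} log p - N/φ(q)| ≪_{A,ε} N (log N)^{-A}`
(the max over `a` is expressed via an arbitrary coprime choice function `a : ℕ → ℕ`). -/
def HasLevelOfDistribution (ϑ : ℝ) : Prop :=
  ∀ A : ℝ, 0 < A → ∀ ε : ℝ, 0 < ε → ∃ C : ℝ, 0 < C ∧
    ∀ N : ℕ, 2 ≤ N → ∀ a : ℕ → ℕ, (∀ q : ℕ, Nat.Coprime (a q) q) →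
      ∑ q ∈ Finset.Icc 1 ⌊(N : ℝ) ^ (ϑ - ε)⌋₊,
        |primeSumAP N q (a q) - (N : ℝ) / (Nat.totient q)| ≤ C * N / (Real.log N) ^ A

/-- The number of `j` with `N < p_j ≤ 2N` and `p_{j+1} - p_j ≤ h`. -/
noncomputable def gapCount (N : ℕ) (h : ℝ) : ℕ :=
  ((Finset.range (2*N+1)).filter (fun j =>
    N < nthPrime j ∧ nthPrime j ≤ 2*N ∧ ((nthPrime (j+1) : ℝ) - nthPrime j) ≤ h)).card

/-- The number of `j` with `N < p_j ≤ 2N` and `p_{j+2} - p_j ≤ h`. -/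
noncomputable def gapCount2 (N : ℕ) (h : ℝ) : ℕ :=
  ((Finset.range (2*N+1)).filter (fun j =>
    N < nthPrime j ∧ nthPrime j ≤ 2*N ∧ ((nthPrime (j+2) : ℝ) - nthPrime j) ≤ h)).card

namespace GPY

theorem abel_deriv (y E : ℝ) (j : ℕ) (t : ℝ) (ht : 0 < t) (hy : 0 < y) :
    HasDerivAt (fun t : ℝ => -((Real.log (y / t)) ^ (j+1) * (Real.log t + E)) - (Real.log (y/t))^(j+2) / ((j:ℝ)+2))
      (((j:ℝ)+1) * (Real.log (y/t))^j / t * (Real.log t + E)) t := by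
  have h1 : HasDerivAt (fun t : ℝ => Real.log (y / t)) (-(1/t)) t := by
    have h2 : HasDerivAt (fun t : ℝ => y / t) (-y / t^2) t := by
      have := (hasDerivAt_inv ht.ne').const_mul y
      have e : y * -(t^2)⁻¹ = -y / t^2 := by ring
      rw [e] at this
      simpa [div_eq_mul_inv] using this
    have := h2.log (by positivity)
    convert this using 1
    field_simp
  have h3 : HasDerivAt (fun t : ℝ => Real.log t + E) (1/t) t := by
    have := (Real.hasDerivAt_log ht.ne').add_const E
    simpa using this
  have h4 := ((h1.fun_pow (j+1)).fun_mul h3).fun_neg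
  have h5 := (h1.fun_pow (j+2)).div_const ((j:ℝ)+2)
  have h6 := h4.fun_sub h5
  refine h6.congr_deriv ?_
  rw [add_tsub_cancel_right, show j + 2 - 1 = j + 1 from rfl]
  have : (j:ℝ)+2 ≠ 0 := by positivity
  push_cast
  field_simp
  ring

theorem abel_int (y E : ℝ) (j : ℕ) (a : ℝ) (ha : 0 < a) (hay : a ≤ y) :
    ∫ t in a..y, (((j:ℝ)+1) * (Real.log (y/t))^j / t * (Real.log t + E)) =
      (Real.log (y / a)) ^ (j+1) * (Real.log a + E) + (Real.log (y/a))^(j+2) / ((j:ℝ)+2) := by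
  have hy : 0 < y := lt_of_lt_of_le ha hay
  rw [intervalIntegral.integral_eq_sub_of_hasDerivAt (f := (fun t : ℝ => -((Real.log (y / t)) ^ (j+1) * (Real.log t + E)) - (Real.log (y/t))^(j+2) / ((j:ℝ)+2)))]
  · simp [div_self hy.ne']
    ring
  · intro t ht
    rw [Set.uIcc_of_le hay] at ht
    exact abel_deriv y E j t (lt_of_lt_of_le ha ht.1) hy
  · apply ContinuousOn.intervalIntegrable
    rw [Set.uIcc_of_le hay]
    have h0 : ∀ t ∈ Set.Icc a y, t ≠ 0 := fun t ht => (lt_of_lt_of_le ha ht.1).ne'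
    have h1 : ContinuousOn (fun t : ℝ => Real.log (y / t)) (Set.Icc a y) := by
      apply ContinuousOn.log
      · exact continuousOn_const.div continuousOn_id h0
      · intro t ht
        exact div_ne_zero hy.ne' (h0 t ht)
    have h2 : ContinuousOn (fun t : ℝ => Real.log t + E) (Set.Icc a y) :=
      (ContinuousOn.log continuousOn_id h0).add continuousOn_const
    exact ((continuousOn_const.mul (h1.pow j)).div continuousOn_id h0).mul h2

theorem abel_int' (y : ℝ) (j : ℕ) (a : ℝ) (ha : 0 < a) (hay : a ≤ y) :
    ∫ t in a..y, (((j:ℝ)+1) * (Real.log (y/t))^j / t) = (Real.log (y / a)) ^ (j+1) := by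
  have h1 := abel_int y 1 j a ha hay
  have h0 := abel_int y 0 j a ha hay
  have hy : 0 < y := lt_of_lt_of_le ha hay
  have h0' : ∀ t ∈ Set.Icc a y, t ≠ 0 := fun t ht => (lt_of_lt_of_le ha ht.1).ne'
  have hc1 : ContinuousOn (fun t : ℝ => Real.log (y / t)) (Set.Icc a y) := by
    apply ContinuousOn.log
    · exact continuousOn_const.div continuousOn_id h0'
    · intro t ht
      exact div_ne_zero hy.ne' (h0' t ht)
  have hI : ∀ E : ℝ, IntervalIntegrable (fun t => (((j:ℝ)+1) * (Real.log (y/t))^j / t * (Real.log t + E))) MeasureTheory.volume a y := by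
    intro E
    apply ContinuousOn.intervalIntegrable
    rw [Set.uIcc_of_le hay]
    have h2 : ContinuousOn (fun t : ℝ => Real.log t + E) (Set.Icc a y) :=
      (ContinuousOn.log continuousOn_id h0').add continuousOn_const
    exact ((continuousOn_const.mul (hc1.pow j)).div continuousOn_id h0').mul h2
  have := intervalIntegral.integral_sub (hI 1) (hI 0)
  rw [h1, h0] at this
  have e : (fun t => (((j:ℝ)+1) * (Real.log (y/t))^j / t)) = fun t => (((j:ℝ)+1) * (Real.log (y/t))^j / t * (Real.log t + 1)) - (((j:ℝ)+1) * (Real.log (y/t))^j / t * (Real.log t + 0)) := by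
    funext t; ring
  rw [e, this]; ring

/-- Abel summation inequality. -/
theorem abel_le {ι : Type*} (s : Finset ι) (a n : ι → ℝ) (y c E : ℝ) (hy : 1 ≤ y)
    (hn : ∀ i ∈ s, 1 ≤ n i ∧ n i ≤ y)
    (hS : ∀ t, 1 ≤ t → t ≤ y → ∑ i ∈ s with n i ≤ t, a i ≤ c * (Real.log t + E)) (j : ℕ) :
    ∑ i ∈ s, a i * (Real.log (y / n i)) ^ j ≤
      c * ((Real.log y)^(j+1) / ((j:ℝ)+1) + E * (Real.log y)^j) := by
  rcases j with _ | j
  · have := hS y hy le_rfl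
    rw [Finset.filter_true_of_mem (fun i hi => (hn i hi).2)] at this
    simpa using this
  have hy0 : 0 < y := by linarith
  set w : ℝ → ℝ := fun t => (((j:ℝ)+1) * (Real.log (y/t))^j / t) with hw
  have h0' : ∀ t ∈ Set.Icc 1 y, t ≠ 0 := fun t ht => (lt_of_lt_of_le one_pos ht.1).ne'
  have hwc : ContinuousOn w (Set.Icc 1 y) := by
    have hc1 : ContinuousOn (fun t : ℝ => Real.log (y / t)) (Set.Icc 1 y) := by
      apply ContinuousOn.log
      · exact continuousOn_const.div continuousOn_id h0'
      · intro t ht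
        exact div_ne_zero hy0.ne' (h0' t ht)
    exact (continuousOn_const.mul (hc1.pow j)).div continuousOn_id h0'
  have hwI : MeasureTheory.IntegrableOn w (Set.Ioc 1 y) :=
    (hwc.integrableOn_Icc).mono_set Set.Ioc_subset_Icc_self
  have hInd : ∀ i ∈ s, MeasureTheory.IntegrableOn (fun t => a i * (Set.Ici (n i)).indicator w t) (Set.Ioc 1 y) := by
    intro i hi
    exact (hwI.indicator measurableSet_Ici).const_mul _
  have key : ∀ i ∈ s, a i * (Real.log (y / n i)) ^ (j+1) = ∫ t in Set.Ioc 1 y, a i * (Set.Ici (n i)).indicator w t := by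
    intro i hi
    rw [MeasureTheory.integral_const_mul, MeasureTheory.setIntegral_indicator measurableSet_Ici]
    have : ∫ t in Set.Ioc 1 y ∩ Set.Ici (n i), w t = ∫ t in Set.Ioc (n i) y, w t := by
      apply MeasureTheory.setIntegral_congr_set
      rcases eq_or_lt_of_le (hn i hi).1 with h | h
      · rw [← h]
        apply Filter.EventuallyEq.of_eq
        ext t
        change (t ∈ Set.Ioc 1 y ∧ 1 ≤ t) ↔ t ∈ Set.Ioc 1 y
        constructor
        · rintro ⟨h, _⟩; exact h
        · intro h; exact ⟨h, h.1.le⟩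
      · have e : Set.Ioc 1 y ∩ Set.Ici (n i) = Set.Icc (n i) y := by
          ext t
          simp only [Set.mem_inter_iff, Set.mem_Ioc, Set.mem_Ici, Set.mem_Icc]
          constructor
          · rintro ⟨⟨_, h2⟩, h3⟩; exact ⟨h3, h2⟩
          · rintro ⟨h1, h2⟩; exact ⟨⟨by linarith, h2⟩, h1⟩
        rw [e]
        exact MeasureTheory.Ioc_ae_eq_Icc.symm
    rw [this, ← intervalIntegral.integral_of_le (hn i hi).2, abel_int' y j (n i) (by linarith [(hn i hi).1]) (hn i hi).2]
  rw [Finset.sum_congr rfl key, ← MeasureTheory.integral_finsetSum _ hInd]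
  have hfin : c * ((Real.log y)^(j+1+1) / (((j+1:ℕ):ℝ)+1) + E * (Real.log y)^(j+1)) =
      ∫ t in Set.Ioc 1 y, c * (w t * (Real.log t + E)) := by
    rw [MeasureTheory.integral_const_mul, ← intervalIntegral.integral_of_le hy, abel_int y E j 1 one_pos hy]
    push_cast
    simp
    left
    ring
  rw [hfin]
  apply MeasureTheory.setIntegral_mono_on
  · exact MeasureTheory.integrable_finsetSum _ hInd
  · have : ContinuousOn (fun t => c * (w t * (Real.log t + E))) (Set.Icc 1 y) := by
      have h2 : ContinuousOn (fun t : ℝ => Real.log t + E) (Set.Icc 1 y) :=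
        (ContinuousOn.log continuousOn_id h0').add continuousOn_const
      exact continuousOn_const.mul (hwc.mul h2)
    exact (this.integrableOn_Icc).mono_set Set.Ioc_subset_Icc_self
  · exact measurableSet_Ioc
  · intro t ht
    have hw0 : 0 ≤ w t := by
      have ht0 : 0 < t := by linarith [ht.1]
      have : 0 ≤ Real.log (y/t) := Real.log_nonneg (by rw [le_div_iff₀ ht0]; linarith [ht.2])
      simp only [hw]; positivity
    have e : ∑ i ∈ s, a i * (Set.Ici (n i)).indicator w t = w t * ∑ i ∈ s with n i ≤ t, a i := by
      rw [Finset.mul_sum, Finset.sum_filter]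
      apply Finset.sum_congr rfl
      intro i hi
      by_cases h : n i ≤ t
      · rw [Set.indicator_of_mem (by exact h)]; simp [h, mul_comm]
      · rw [Set.indicator_of_notMem (by exact h)]; simp [h]
    rw [e, mul_left_comm]
    exact mul_le_mul_of_nonneg_left (hS t ht.1.le ht.2) hw0

theorem abel_ge {ι : Type*} (s : Finset ι) (a n : ι → ℝ) (y c : ℝ) (hy : 1 ≤ y)
    (hn : ∀ i ∈ s, 1 ≤ n i ∧ n i ≤ y)
    (hS : ∀ t, 1 ≤ t → t ≤ y → c * Real.log t ≤ ∑ i ∈ s with n i ≤ t, a i) (j : ℕ) :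
    c * ((Real.log y)^(j+1) / ((j:ℝ)+1)) ≤ ∑ i ∈ s, a i * (Real.log (y / n i)) ^ j := by
  have := abel_le s (fun i => - a i) n y (-c) 0 hy hn (by
    intro t h1 h2
    have := hS t h1 h2
    rw [Finset.sum_neg_distrib]
    linarith) j
  simp only [neg_mul, Finset.sum_neg_distrib, zero_mul, add_zero] at this
  linarith

end GPY

namespace GPY

theorem mertens_nat (n : ℕ) (hn : 1 ≤ n) :
    ∑ p ∈ (Icc 1 n).filter Nat.Prime, Real.log p / p ≤ Real.log n + Real.log 4 := by
  have hn0 : (0:ℝ) < n := by exact_mod_cast hn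
  have h1 : ∑ m ∈ Icc 1 n, Real.log m ≤ n * Real.log n := by
    calc ∑ m ∈ Icc 1 n, Real.log m ≤ ∑ m ∈ Icc 1 n, Real.log n := by
          apply Finset.sum_le_sum
          intro m hm
          rw [mem_Icc] at hm
          apply Real.log_le_log
          · exact_mod_cast hm.1
          · exact_mod_cast hm.2
      _ = n * Real.log n := by simp
  have h2 : ∑ p ∈ (Icc 1 n).filter Nat.Prime, Real.log p * ((n / p : ℕ) : ℝ) ≤ ∑ m ∈ Icc 1 n, Real.log m := by
    have : ∀ m ∈ Icc 1 n, ∑ p ∈ (Icc 1 n).filter Nat.Prime, (if p ∣ m then Real.log p else 0) ≤ Real.log m := by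
      intro m hm
      rw [mem_Icc] at hm
      have e : ∑ p ∈ (Icc 1 n).filter Nat.Prime, (if p ∣ m then Real.log p else 0) ≤ ∑ p ∈ m.primeFactors, Real.log p := by
        rw [← Finset.sum_filter]
        apply Finset.sum_le_sum_of_subset_of_nonneg
        · intro p hp
          simp only [mem_filter, mem_Icc] at hp
          rw [Nat.mem_primeFactors]
          exact ⟨hp.1.2, hp.2, by omega⟩
        · intro p hp _
          exact Real.log_natCast_nonneg p
      refine e.trans ?_
      rw [← Real.log_prod (fun p hp => by exact_mod_cast (Nat.prime_of_mem_primeFactors hp).ne_zero)]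
      apply Real.log_le_log
      · apply Finset.prod_pos
        intro p hp
        exact_mod_cast (Nat.prime_of_mem_primeFactors hp).pos
      · rw [← Nat.cast_prod]
        exact_mod_cast Nat.le_of_dvd (by omega) (Nat.prod_primeFactors_dvd m)
    refine le_trans (le_of_eq ?_) (Finset.sum_le_sum this)
    rw [Finset.sum_comm]
    apply Finset.sum_congr rfl
    intro p hp
    rw [← Finset.sum_filter, Finset.sum_const, nsmul_eq_mul, mul_comm]
    congr 2
    have := Nat.Ioc_filter_dvd_card_eq_div n p
    rw [← this]
    rfl
  have h3 : ∑ p ∈ (Icc 1 n).filter Nat.Prime, Real.log p ≤ Real.log 4 * n := by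
    have := Chebyshev.theta_le_log4_mul_x (x := (n:ℝ)) (by positivity)
    refine le_trans (le_of_eq ?_) this
    rw [Chebyshev.theta]
    simp only [Nat.floor_natCast]
    rfl
  have h4 : n * ∑ p ∈ (Icc 1 n).filter Nat.Prime, Real.log p / p ≤
      ∑ p ∈ (Icc 1 n).filter Nat.Prime, Real.log p * ((n / p : ℕ) : ℝ) + ∑ p ∈ (Icc 1 n).filter Nat.Prime, Real.log p := by
    rw [← Finset.sum_add_distrib, Finset.mul_sum]
    apply Finset.sum_le_sum
    intro p hp
    simp only [mem_filter, mem_Icc] at hp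
    have hp0 : (0:ℝ) < p := by exact_mod_cast hp.2.pos
    have : (n:ℝ)/p ≤ ((n/p : ℕ):ℝ) + 1 := by
      rw [div_le_iff₀ hp0]
      have := Nat.lt_div_mul_add (a := n) hp.2.pos
      have : n ≤ (n/p + 1) * p := by nlinarith
      exact_mod_cast this
    calc (n:ℝ) * (Real.log p / p) = Real.log p * (n / p) := by ring
      _ ≤ Real.log p * (((n/p : ℕ):ℝ) + 1) := mul_le_mul_of_nonneg_left this (Real.log_natCast_nonneg p)
      _ = _ := by ring
  have h5 : n * ∑ p ∈ (Icc 1 n).filter Nat.Prime, Real.log p / p ≤ n * (Real.log n + Real.log 4) := by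
    nlinarith
  exact le_of_mul_le_mul_left h5 hn0

theorem sum_log_div_unbounded (M : ℝ) : ∃ D : ℕ, M ≤ ∑ p ∈ (Icc 1 D).filter Nat.Prime, Real.log p / p := by
  have h := not_summable_one_div_on_primes
  rw [not_summable_iff_tendsto_nat_atTop_of_nonneg] at h
  · obtain ⟨D, hD⟩ := (h.eventually (Filter.eventually_ge_atTop (2*M))).exists
    refine ⟨D, ?_⟩
    have e : ∑ i ∈ range D, Set.indicator {p : ℕ | p.Prime} (fun n : ℕ => (1:ℝ)/n) i ≤ 2 * ∑ p ∈ (Icc 1 D).filter Nat.Prime, Real.log p / p := by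
      rw [Finset.mul_sum]
      simp only [Set.indicator_apply, Set.mem_ofPred_eq]
      rw [← Finset.sum_filter]
      calc ∑ a ∈ (range D).filter Nat.Prime, (1:ℝ)/a ≤ ∑ a ∈ (range D).filter Nat.Prime, 2 * (Real.log a / a) := by
            apply Finset.sum_le_sum
            intro p hp
            simp only [mem_filter] at hp
            have h2 : (2:ℝ) ≤ p := by exact_mod_cast hp.2.two_le
            have : Real.log 2 ≤ Real.log p := Real.log_le_log (by norm_num) h2
            have := Real.log_two_gt_d9
            rw [← mul_div_assoc]
            gcongr
            linarith
        _ ≤ _ := by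
            apply Finset.sum_le_sum_of_subset_of_nonneg
            · intro p hp
              simp only [mem_filter, mem_range, mem_Icc] at hp ⊢
              exact ⟨⟨hp.2.one_lt.le, hp.1.le⟩, hp.2⟩
            · intro p _ _
              have := Real.log_natCast_nonneg p
              positivity
    linarith
  · intro n
    simp only [Set.indicator_apply]
    split_ifs <;> positivity

theorem sum_inv_sq_le (D : ℕ) (hD : 1 ≤ D) (s : Finset ℕ) (hs : ∀ p ∈ s, D < p) :
    ∑ p ∈ s, (1:ℝ) / (p:ℝ)^2 ≤ 1 / D := by
  obtain ⟨M, hM⟩ : ∃ M, ∀ p ∈ s, p ≤ M := ⟨s.sup id, fun p hp => Finset.le_sup (f := id) hp⟩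
  rcases le_or_gt M D with h | h
  · have : s = ∅ := by
      apply Finset.eq_empty_of_forall_notMem
      intro p hp
      have := hs p hp; have := hM p hp; omega
    simp [this]
  have h1 := sum_Ioc_inv_sq_le_sub (α := ℝ) (k := D) (n := M) (by omega) h.le
  calc ∑ p ∈ s, (1:ℝ) / (p:ℝ)^2 ≤ ∑ p ∈ Ioc D M, (1:ℝ) / (p:ℝ)^2 := by
        apply Finset.sum_le_sum_of_subset_of_nonneg
        · intro p hp; rw [mem_Ioc]; exact ⟨hs p hp, hM p hp⟩
        · intros; positivity
    _ ≤ _ := by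
        simp only [one_div]
        refine h1.trans ?_
        have : (0:ℝ) ≤ (M:ℝ)⁻¹ := by positivity
        linarith

/-- sharp Mertens-type upper bound for primes beyond a large constant -/
theorem mertens_tail (K : ℕ) : ∃ D₀ : ℕ, 2 * K < D₀ ∧ ∀ y : ℝ, 1 ≤ y → ∀ s : Finset ℕ,
    (∀ p ∈ s, p.Prime ∧ D₀ < p ∧ (p:ℝ) ≤ y) → ∑ p ∈ s, Real.log p / ((p:ℝ) - K) ≤ Real.log y := by
  have hsum : Summable (fun n : ℕ => 4 * (K:ℝ) * ((n:ℝ) ^ ((3:ℝ)/2))⁻¹) :=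
    (Real.summable_nat_rpow_inv.mpr (by norm_num)).mul_left _
  set C' := ∑' n : ℕ, 4 * (K:ℝ) * ((n:ℝ) ^ ((3:ℝ)/2))⁻¹ with hC'
  obtain ⟨D, hD⟩ := sum_log_div_unbounded (Real.log 4 + C')
  refine ⟨max D (2*K+1), by omega, ?_⟩
  intro y hy s hs
  set D1 := max D (2*K+1)
  by_cases hDy : (D1:ℝ) ≤ y
  swap
  · have : s = ∅ := by
      apply Finset.eq_empty_of_forall_notMem
      intro p hp
      have h1 := (hs p hp).2.1
      have h2 := (hs p hp).2.2
      have h1' : (D1:ℝ) < p := by exact_mod_cast h1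
      linarith
    rw [this]; simpa using Real.log_nonneg hy
  have hfl : D1 ≤ ⌊y⌋₊ := Nat.le_floor hDy
  have hfl1 : 1 ≤ ⌊y⌋₊ := Nat.le_floor (by simpa using hy)
  have h1 : ∑ p ∈ s, Real.log p / p + ∑ p ∈ (Icc 1 D).filter Nat.Prime, Real.log p / p ≤
      ∑ p ∈ (Icc 1 ⌊y⌋₊).filter Nat.Prime, Real.log p / p := by
    rw [← Finset.sum_union]
    · apply Finset.sum_le_sum_of_subset_of_nonneg
      · intro p hp
        rw [mem_union] at hp
        simp only [mem_filter, mem_Icc] at hp ⊢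
        rcases hp with hp | hp
        · obtain ⟨h1, h2, h3⟩ := hs p hp
          exact ⟨⟨h1.one_lt.le, Nat.le_floor h3⟩, h1⟩
        · exact ⟨⟨hp.1.1, by omega⟩, hp.2⟩
      · intro p _ _
        have := Real.log_natCast_nonneg p
        positivity
    · rw [Finset.disjoint_left]
      intro p hp hp'
      simp only [mem_filter, mem_Icc] at hp'
      have := (hs p hp).2.1
      omega
  have h2 := mertens_nat ⌊y⌋₊ hfl1
  have h3 : Real.log (⌊y⌋₊:ℝ) ≤ Real.log y :=
    Real.log_le_log (by exact_mod_cast hfl1) (Nat.floor_le (by linarith))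
  have h4 : ∑ p ∈ s, Real.log p / ((p:ℝ) - K) ≤ ∑ p ∈ s, Real.log p / p + C' := by
    have : ∑ p ∈ s, 4 * (K:ℝ) * ((p:ℝ) ^ ((3:ℝ)/2))⁻¹ ≤ C' :=
      hsum.sum_le_tsum s (fun n _ => by positivity)
    refine le_trans ?_ (add_le_add_right this _)
    rw [← Finset.sum_add_distrib]
    apply Finset.sum_le_sum
    intro p hp
    obtain ⟨h1, h2, h3⟩ := hs p hp
    have hpK : 2 * (K:ℝ) ≤ p := by
      have : 2 * K ≤ p := by omega
      exact_mod_cast this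
    have hp0 : (0:ℝ) < p := by exact_mod_cast h1.pos
    have hK0 : (0:ℝ) ≤ K := by positivity
    have hlog : Real.log p ≤ 2 * (p:ℝ)^((1:ℝ)/2) := by
      have := Real.log_le_rpow_div hp0.le (ε := 1/2) (by norm_num)
      linarith
    have hlog0 := Real.log_natCast_nonneg p
    have e1 : Real.log p / ((p:ℝ) - K) ≤ Real.log p / p + 2 * K * (Real.log p / (p^2)) := by
      have hpk0 : (0:ℝ) < p - K := by linarith
      have : 1 / ((p:ℝ) - K) ≤ 1/p + 2 * K / p^2 := by
        rw [div_le_iff₀ hpk0]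
        have : (1 / (p:ℝ) + 2 * K / p^2) * (p - K) = 1 + K * (p - 2 * K) / p^2 := by
          field_simp; ring
        rw [this]
        have : 0 ≤ (K:ℝ) * (p - 2 * K) / p^2 := by
          apply div_nonneg (mul_nonneg hK0 (by linarith)) (by positivity)
        linarith
      calc Real.log p / ((p:ℝ) - K) = Real.log p * (1 / ((p:ℝ) - K)) := by ring
        _ ≤ Real.log p * (1/p + 2 * K / p^2) := mul_le_mul_of_nonneg_left this hlog0
        _ = _ := by ring
    have e2 : Real.log p / (p^2) ≤ 2 * ((p:ℝ) ^ ((3:ℝ)/2))⁻¹ := by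
      rw [div_le_iff₀ (by positivity)]
      refine hlog.trans (le_of_eq ?_)
      have : (p:ℝ)^2 = (p:ℝ)^((1:ℝ)/2) * (p:ℝ)^((3:ℝ)/2) := by
        rw [← Real.rpow_add hp0]; norm_num
      rw [this]
      have : (p:ℝ)^((3:ℝ)/2) ≠ 0 := by positivity
      field_simp
    have e3 := mul_le_mul_of_nonneg_left e2 (show 0 ≤ 2 * (K:ℝ) by positivity)
    linarith
  linarith

/-- convergent product over large primes -/
theorem prod_tail (K : ℕ) (δ : ℝ) (hδ : 0 < δ) : ∃ D₀ : ℕ, 2 * K < D₀ ∧ ∀ s : Finset ℕ,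
    (∀ p ∈ s, D₀ < p) → ∏ p ∈ s, (1 + (K:ℝ) / (p * ((p:ℝ) - K))) ≤ 1 + δ := by
  obtain ⟨D, hD⟩ := exists_nat_gt (2 * K / Real.log (1 + δ))
  have hl : 0 < Real.log (1+δ) := Real.log_pos (by linarith)
  refine ⟨max D (2*K+1), by omega, ?_⟩
  intro s hs
  set D1 := max D (2*K+1)
  have hD1 : (D:ℝ) ≤ D1 := by exact_mod_cast le_max_left _ _
  have hD1pos : (0:ℝ) < D1 := by
    have : 0 < D1 := by omega
    exact_mod_cast this
  calc ∏ p ∈ s, (1 + (K:ℝ) / (p * ((p:ℝ) - K))) ≤ ∏ p ∈ s, (1 + 2 * (K:ℝ) * (1/(p:ℝ)^2)) := by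
        apply Finset.prod_le_prod
        · intro p hp
          have := hs p hp
          have h2 : 2 * (K:ℝ) + 1 ≤ p := by
            have : 2 * K + 1 ≤ p := by omega
            exact_mod_cast this
          have hK : (0:ℝ) ≤ K := by positivity
          have : (0:ℝ) ≤ (p:ℝ) - K := by linarith
          positivity
        · intro p hp
          have := hs p hp
          have h2 : 2 * (K:ℝ) + 1 ≤ p := by
            have : 2 * K + 1 ≤ p := by omega
            exact_mod_cast this
          have hK : (0:ℝ) ≤ K := by positivity
          have h3 : (0:ℝ) < p := by linarith
          have h4 : (0:ℝ) < (p:ℝ) - K := by linarith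
          rw [add_le_add_iff_left, mul_one_div, div_le_div_iff₀ (by positivity) (by positivity)]
          nlinarith [mul_nonneg (mul_nonneg hK h3.le) (show (0:ℝ) ≤ p - 2*K by linarith)]
    _ ≤ Real.exp (∑ p ∈ s, 2 * (K:ℝ) * (1/(p:ℝ)^2)) := by
        apply Real.prod_one_add_le_exp_sum
        intro p; positivity
    _ ≤ Real.exp (Real.log (1 + δ)) := by
        apply Real.exp_le_exp.mpr
        rw [← Finset.mul_sum]
        have h1 := sum_inv_sq_le D1 (by omega) s hs
        have h2 : 2 * (K:ℝ) * ∑ p ∈ s, (1/(p:ℝ)^2) ≤ 2 * K * (1/D1) :=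
          mul_le_mul_of_nonneg_left h1 (by positivity)
        refine h2.trans ?_
        rw [mul_one_div, div_le_iff₀ hD1pos]
        rw [div_lt_iff₀ hl] at hD
        nlinarith
    _ = 1 + δ := Real.exp_log (by linarith)

end GPY

namespace GPY

def pr (D : Finset ℕ) : ℕ := ∏ p ∈ D, p

noncomputable def DD (P : Finset ℕ) (x : ℝ) : Finset (Finset ℕ) :=
  P.powerset.filter (fun D => (pr D : ℝ) ≤ x)

noncomputable def om (M : ℕ) : ℝ := ∏ p ∈ M.primeFactors, (1 - 1 / (p : ℝ))

noncomputable def Pset (M : ℕ) (R : ℝ) : Finset ℕ :=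
  (Icc 1 ⌊R⌋₊).filter (fun p => p.Prime ∧ ¬ p ∣ M)

theorem mem_Pset {M : ℕ} {R : ℝ} {p : ℕ} : p ∈ Pset M R ↔ p.Prime ∧ ¬ p ∣ M ∧ (p : ℝ) ≤ R := by
  unfold Pset
  simp only [mem_filter, mem_Icc]
  constructor
  · rintro ⟨⟨h1, h2⟩, h3, h4⟩
    exact ⟨h3, h4, (Nat.le_floor_iff' h3.pos.ne').1 h2⟩
  · rintro ⟨h3, h4, h5⟩
    exact ⟨⟨h3.one_le, Nat.le_floor h5⟩, h3, h4⟩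

theorem mem_DD {P : Finset ℕ} {x : ℝ} {D : Finset ℕ} : D ∈ DD P x ↔ D ⊆ P ∧ (pr D : ℝ) ≤ x := by
  simp [DD]

theorem pr_union {A B : Finset ℕ} (h : Disjoint A B) : pr (A ∪ B) = pr A * pr B := by
  unfold pr; exact prod_union h

theorem pr_pos {P D : Finset ℕ} (hP : ∀ p ∈ P, 0 < p) (h : D ⊆ P) : 0 < pr D :=
  prod_pos fun p hp => hP p (h hp)

@[simp] theorem pr_empty : pr ∅ = 1 := by simp [pr]

theorem pr_insert {p : ℕ} {D : Finset ℕ} (h : p ∉ D) : pr (insert p D) = p * pr D := by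
  unfold pr; exact prod_insert h

theorem empty_mem_DD {P : Finset ℕ} {x : ℝ} (hx : 1 ≤ x) : ∅ ∈ DD P x := by
  simp [mem_DD, hx]

theorem DD_one_le {P : Finset ℕ} (hP : ∀ p ∈ P, 0 < p) {x : ℝ} {D : Finset ℕ} (h : D ∈ DD P x) :
    1 ≤ x := by
  rw [mem_DD] at h
  have := pr_pos hP h.1
  have h2 : (1:ℝ) ≤ pr D := by exact_mod_cast this
  linarith [h.2]

theorem sum_fact (P : Finset ℕ) (hP : ∀ p ∈ P, 0 < p) (x : ℝ) (F : Finset ℕ → Finset ℕ → ℝ) :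
    ∑ D ∈ DD P x, ∑ A ∈ D.powerset, F A (D \ A) =
    ∑ B ∈ DD P x, ∑ A ∈ (DD P (x / pr B)).filter (fun A => Disjoint A B), F A B := by
  rw [sum_sigma', sum_sigma']
  refine sum_nbij' (fun s => ⟨s.1 \ s.2, s.2⟩) (fun s => ⟨s.2 ∪ s.1, s.2⟩) ?_ ?_ ?_ ?_ ?_
  · rintro ⟨D, A⟩ h
    simp only [mem_sigma, mem_DD, mem_powerset, mem_filter] at h ⊢
    obtain ⟨⟨h1, h2⟩, h3⟩ := h
    have e : pr D = pr A * pr (D \ A) := by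
      rw [← pr_union disjoint_sdiff, union_sdiff_of_subset h3]
    have pA : 0 < pr A := pr_pos hP (h3.trans h1)
    have pB : 0 < pr (D \ A) := pr_pos hP (sdiff_subset.trans h1)
    have pB' : (0:ℝ) < pr (D \ A) := by exact_mod_cast pB
    have pA' : (1:ℝ) ≤ pr A := by exact_mod_cast pA
    rw [e, Nat.cast_mul] at h2
    refine ⟨⟨sdiff_subset.trans h1, ?_⟩, ⟨h3.trans h1, ?_⟩, disjoint_sdiff⟩
    · nlinarith
    · rw [le_div_iff₀ pB']; exact h2
  · rintro ⟨B, A⟩ h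
    simp only [mem_sigma, mem_DD, mem_powerset, mem_filter] at h ⊢
    obtain ⟨⟨h1, h2⟩, ⟨h3, h4⟩, h5⟩ := h
    have pB : 0 < pr B := pr_pos hP h1
    have pB' : (0:ℝ) < pr B := by exact_mod_cast pB
    refine ⟨⟨union_subset h3 h1, ?_⟩, subset_union_left⟩
    rw [pr_union h5, Nat.cast_mul]
    rwa [le_div_iff₀ pB'] at h4
  · rintro ⟨D, A⟩ h
    simp only [mem_sigma, mem_DD, mem_powerset] at h ⊢
    simp [union_sdiff_of_subset h.2]
  · rintro ⟨B, A⟩ h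
    simp only [mem_sigma, mem_DD, mem_filter] at h ⊢
    simp [union_sdiff_cancel_left h.2.2]
  · rintro ⟨D, A⟩ h
    rfl

theorem conv_eq (P : Finset ℕ) (hP : ∀ p ∈ P, 0 < p) (x : ℝ) (α β : ℕ → ℝ) (G : ℕ → ℝ) :
    ∑ D ∈ DD P x, (∏ p ∈ D, (α p + β p)) * G (pr D) =
    ∑ B ∈ DD P x, (∏ p ∈ B, β p) * ∑ A ∈ (DD P (x / pr B)).filter (fun A => Disjoint A B),
      (∏ p ∈ A, α p) * G (pr A * pr B) := by
  have := sum_fact P hP x (fun A B => (∏ p ∈ B, β p) * ((∏ p ∈ A, α p) * G (pr A * pr B)))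
  simp only [← mul_sum] at this
  rw [← this]
  refine sum_congr rfl fun D hD => ?_
  rw [prod_add, sum_mul]
  refine sum_congr rfl fun A hA => ?_
  rw [← pr_union disjoint_sdiff, union_sdiff_of_subset (mem_powerset.1 hA)]
  ring

theorem conv_le (P : Finset ℕ) (hP : ∀ p ∈ P, 0 < p) (x : ℝ) (α β : ℕ → ℝ) (G : ℕ → ℝ)
    (hα : ∀ p ∈ P, 0 ≤ α p) (hβ : ∀ p ∈ P, 0 ≤ β p) (hG : ∀ n : ℕ, (n:ℝ) ≤ x → 0 ≤ G n) :
    ∑ D ∈ DD P x, (∏ p ∈ D, (α p + β p)) * G (pr D) ≤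
    ∑ B ∈ DD P x, (∏ p ∈ B, β p) * ∑ A ∈ DD P (x / pr B), (∏ p ∈ A, α p) * G (pr A * pr B) := by
  rw [conv_eq P hP]
  refine sum_le_sum fun B hB => mul_le_mul_of_nonneg_left ?_ ?_
  · refine sum_le_sum_of_subset_of_nonneg (filter_subset _ _) fun A hA _ => ?_
    rw [mem_DD] at hA hB
    have pB' : (0:ℝ) < pr B := by exact_mod_cast pr_pos hP hB.1
    refine mul_nonneg (prod_nonneg fun p hp => hα p (hA.1 hp)) (hG _ ?_)
    push_cast
    exact (le_div_iff₀ pB').1 hA.2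
  · exact prod_nonneg fun p hp => hβ p ((mem_DD.1 hB).1 hp)

theorem DD_mono {P : Finset ℕ} {x y : ℝ} (h : x ≤ y) : DD P x ⊆ DD P y := by
  intro D hD
  rw [mem_DD] at hD ⊢
  exact ⟨hD.1, hD.2.trans h⟩

/-- power bound -/
theorem sum_pow_le (P : Finset ℕ) (hP : ∀ p ∈ P, 0 < p) (x : ℝ) (hx : 1 ≤ x) (u : ℕ → ℝ)
    (hu : ∀ p ∈ P, 0 ≤ u p) (j : ℕ) :
    ∑ D ∈ DD P x, ∏ p ∈ D, ((j : ℝ) * u p) ≤ (∑ D ∈ DD P x, ∏ p ∈ D, u p) ^ j := by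
  have nn : ∀ D ∈ DD P x, 0 ≤ ∏ p ∈ D, u p := fun D hD =>
    prod_nonneg fun p hp => hu p ((mem_DD.1 hD).1 hp)
  induction j with
  | zero =>
    rw [pow_zero]
    rw [sum_eq_single ∅]
    · simp
    · intro D hD hne
      obtain ⟨p, hp⟩ := nonempty_iff_ne_empty.2 hne
      exact prod_eq_zero hp (by simp)
    · intro h; exact absurd (empty_mem_DD hx) h
  | succ j ih =>
    have h := conv_le P hP x u (fun p => (j:ℝ) * u p) (fun _ => 1) hu
      (fun p hp => mul_nonneg (Nat.cast_nonneg _) (hu p hp)) (fun _ _ => zero_le_one)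
    simp only [mul_one] at h
    have e : ∀ D : Finset ℕ, ∏ p ∈ D, (((j+1 : ℕ) : ℝ) * u p) = ∏ p ∈ D, (u p + (j:ℝ) * u p) := by
      intro D; refine prod_congr rfl fun p _ => ?_; push_cast; ring
    simp only [e]
    refine h.trans ?_
    rw [pow_succ]
    refine le_trans ?_ (mul_le_mul_of_nonneg_right ih (sum_nonneg nn))
    rw [sum_mul]
    refine sum_le_sum fun B hB => mul_le_mul_of_nonneg_left ?_ ?_
    · refine sum_le_sum_of_subset_of_nonneg (DD_mono ?_) fun D hD _ => nn D hD
      have : (1:ℝ) ≤ pr B := by exact_mod_cast pr_pos hP (mem_DD.1 hB).1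
      exact div_le_self (by linarith) this
    · exact prod_nonneg fun p hp => mul_nonneg (Nat.cast_nonneg _) (hu p ((mem_DD.1 hB).1 hp))

end GPY

namespace GPY

theorem one_sub_inv_pos {p : ℕ} (hp : p.Prime) : (0:ℝ) < 1 - 1 / (p:ℝ) := by
  have h : (2:ℝ) ≤ p := by exact_mod_cast hp.two_le
  have : 1 / (p:ℝ) ≤ 1 / 2 := one_div_le_one_div_of_le (by norm_num) h
  linarith

theorem one_sub_inv_le {p : ℕ} : 1 - 1 / (p:ℝ) ≤ 1 := by
  have : 0 ≤ 1 / (p:ℝ) := by positivity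
  linarith

theorem om_pos (M : ℕ) : 0 < om M :=
  prod_pos fun _ hp => one_sub_inv_pos (Nat.prime_of_mem_primeFactors hp)

theorem om_le_one (M : ℕ) : om M ≤ 1 :=
  prod_le_one (fun _ hp => (one_sub_inv_pos (Nat.prime_of_mem_primeFactors hp)).le)
    fun _ _ => one_sub_inv_le

noncomputable def invHom : ℕ →*₀ ℝ where
  toFun n := (n:ℝ)⁻¹
  map_zero' := by simp
  map_one' := by simp
  map_mul' a b := by push_cast; rw [mul_inv]

theorem FN (s : Finset ℕ) (hs : ∀ p ∈ s, p.Prime) (T : Finset ℕ)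
    (hT : ∀ n ∈ T, n ≠ 0 ∧ n.primeFactors ⊆ s) :
    ∑ n ∈ T, 1 / (n:ℝ) ≤ ∏ p ∈ s, (1 - 1 / (p:ℝ))⁻¹ := by
  have key := EulerProduct.summable_and_hasSum_factoredNumbers_prod_filter_prime_geometric
    (f := (invHom : ℕ →* ℝ)) (by
      intro p hp
      have h : (1:ℝ) < p := by exact_mod_cast hp.one_lt
      change ‖(p:ℝ)⁻¹‖ < 1
      rw [norm_inv, Real.norm_natCast]
      exact inv_lt_one_of_one_lt₀ h) s
  have e1 : s.filter Nat.Prime = s := filter_true_of_mem hs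
  have h2 := key.2
  rw [e1] at h2
  have h3 : ∀ p : ℕ, (1 - (invHom : ℕ →* ℝ) p)⁻¹ = (1 - 1 / (p:ℝ))⁻¹ := by
    intro p; change (1 - (p:ℝ)⁻¹)⁻¹ = _; rw [one_div]
  simp only [h3] at h2
  have hmem : ∀ n ∈ T, n ∈ Nat.factoredNumbers s := fun n hn => by
    rw [Nat.mem_factoredNumbers_iff_primeFactors_subset]; exact hT n hn
  have := sum_le_hasSum (T.attach.map ⟨fun n => (⟨n.1, hmem n.1 n.2⟩ : Nat.factoredNumbers s), by
    intro a b hab; simp only [Subtype.mk.injEq] at hab; exact Subtype.ext hab⟩) (by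
      intro i _
      change 0 ≤ ((i:ℕ):ℝ)⁻¹
      positivity) h2
  refine le_trans (le_of_eq ?_) this
  rw [sum_map]
  rw [← sum_attach]
  refine sum_congr rfl fun n _ => ?_
  change _ = ((n:ℕ):ℝ)⁻¹
  rw [one_div]

theorem log_le_sum {x : ℝ} (hx : 1 ≤ x) : Real.log x ≤ ∑ n ∈ Icc 1 ⌊x⌋₊, 1 / (n:ℝ) := by
  refine (log_le_harmonic_floor x (by linarith)).trans (le_of_eq ?_)
  rw [harmonic_eq_sum_Icc]
  push_cast
  simp

theorem sum_le_log {x : ℝ} (hx : 1 ≤ x) : ∑ n ∈ Icc 1 ⌊x⌋₊, 1 / (n:ℝ) ≤ 1 + Real.log x := by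
  refine le_trans (le_of_eq ?_) (harmonic_floor_le_one_add_log x hx)
  rw [harmonic_eq_sum_Icc]
  push_cast
  simp

theorem pr_dvd {A : Finset ℕ} {n : ℕ} (hA : A ⊆ n.primeFactors) : pr A ∣ n := by
  unfold pr
  exact (prod_dvd_prod_of_subset _ _ _ hA).trans (Nat.prod_primeFactors_dvd n)

theorem onedim_lower (P : Finset ℕ) (M : ℕ) (x : ℝ) (hx : 1 ≤ x)
    (hP : ∀ p : ℕ, p.Prime → ¬ p ∣ M → (p:ℝ) ≤ x → p ∈ P) (hM : M ≠ 0)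
    (hPp : ∀ p ∈ P, p.Prime)
    (B : Finset ℕ) (hB : ∀ p ∈ B, p.Prime) :
    om M * (∏ p ∈ B, (1 - 1 / (p:ℝ))) * Real.log x ≤
      ∑ A ∈ (DD P x).filter (fun A => Disjoint A B), ∏ p ∈ A, 1 / ((p:ℝ) - 1) := by
  set s := M.primeFactors ∪ B with hs
  have hsp : ∀ p ∈ s, p.Prime := by
    intro p hp
    rcases mem_union.1 hp with h | h
    · exact Nat.prime_of_mem_primeFactors h
    · exact hB p h
  set C := ∏ p ∈ s, (1 - 1 / (p:ℝ)) with hC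
  have hCpos : 0 < C := prod_pos fun p hp => one_sub_inv_pos (hsp p hp)
  have hCle : om M * (∏ p ∈ B, (1 - 1 / (p:ℝ))) ≤ C := by
    have h := prod_union_inter (s₁ := M.primeFactors) (s₂ := B) (f := fun p : ℕ => (1 - 1 / (p:ℝ)))
    unfold om
    rw [← h]
    refine mul_le_of_le_one_right hCpos.le ?_
    exact prod_le_one (fun p hp => (one_sub_inv_pos (hB p (mem_inter.1 hp).2)).le)
      fun _ _ => one_sub_inv_le
  have hlog : 0 ≤ Real.log x := Real.log_nonneg hx
  refine (mul_le_mul_of_nonneg_right hCle hlog).trans ?_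
  refine (mul_le_mul_of_nonneg_left (log_le_sum hx) hCpos.le).trans ?_
  have hmap : ∀ n ∈ Icc 1 ⌊x⌋₊, n.primeFactors \ s ∈ (DD P x).filter (fun A => Disjoint A B) := by
    intro n hn
    rw [mem_Icc] at hn
    have hnx : (n:ℝ) ≤ x := (Nat.le_floor_iff (by linarith)).1 hn.2
    rw [mem_filter, mem_DD]
    refine ⟨⟨?_, ?_⟩, ?_⟩
    · intro p hp
      rw [mem_sdiff] at hp
      have hpp := Nat.prime_of_mem_primeFactors hp.1
      refine hP p hpp ?_ ?_
      · intro hd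
        exact hp.2 (mem_union_left _ (Nat.mem_primeFactors.2 ⟨hpp, hd, hM⟩))
      · refine le_trans ?_ hnx
        exact_mod_cast Nat.le_of_dvd (by omega) (Nat.dvd_of_mem_primeFactors hp.1)
    · refine le_trans ?_ hnx
      exact_mod_cast Nat.le_of_dvd (by omega) (pr_dvd sdiff_subset)
    · exact disjoint_of_subset_right subset_union_right sdiff_disjoint
  rw [← sum_fiberwise_of_maps_to hmap, mul_sum]
  refine sum_le_sum fun A hA => ?_
  rw [mem_filter, mem_DD] at hA
  have hAp : ∀ p ∈ A, p.Prime := fun p hp => hPp p (hA.1.1 hp)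
  by_cases hAs : Disjoint A s
  swap
  · rw [filter_false_of_mem]
    · rw [sum_empty, mul_zero]
      refine prod_nonneg fun p hp => ?_
      have : (1:ℝ) ≤ p := by exact_mod_cast (hAp p hp).one_le
      exact one_div_nonneg.2 (by linarith)
    · intro n _ h
      exact hAs (h ▸ sdiff_disjoint)
  have prpos : 0 < pr A := pr_pos (fun p hp => (hAp p hp).pos) (Subset.refl A)
  have prpos' : (0:ℝ) < pr A := by exact_mod_cast prpos
  set F := (Icc 1 ⌊x⌋₊).filter (fun n => n.primeFactors \ s = A) with hF
  have hdv : ∀ n ∈ F, pr A ∣ n := fun n hn => pr_dvd ((mem_filter.1 hn).2 ▸ sdiff_subset)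
  have h1 : ∑ n ∈ F, 1 / (n:ℝ) = (1 / (pr A:ℝ)) * ∑ m ∈ F.image (fun n => n / pr A), 1 / (m:ℝ) := by
    rw [sum_image, mul_sum]
    · refine sum_congr rfl fun n hn => ?_
      obtain ⟨m, rfl⟩ := hdv n hn
      rw [Nat.mul_div_cancel_left _ prpos, Nat.cast_mul]
      rw [one_div_mul_one_div]
    · intro a ha b hb hab
      obtain ⟨m, rfl⟩ := hdv a ha
      obtain ⟨m', rfl⟩ := hdv b hb
      simp only [Nat.mul_div_cancel_left _ prpos] at hab
      rw [hab]
  have h2 : ∑ m ∈ F.image (fun n => n / pr A), 1 / (m:ℝ) ≤ ∏ p ∈ A ∪ s, (1 - 1 / (p:ℝ))⁻¹ := by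
    refine FN _ ?_ _ ?_
    · intro p hp
      rcases mem_union.1 hp with h | h
      · exact hAp p h
      · exact hsp p h
    · intro m hm
      obtain ⟨n, hn, rfl⟩ := mem_image.1 hm
      have hnF := hn
      obtain ⟨m', hm'⟩ := hdv n hn
      rw [hF, mem_filter, mem_Icc] at hn
      have hm0 : m' ≠ 0 := by rintro rfl; omega
      rw [hm', Nat.mul_div_cancel_left _ prpos]
      refine ⟨hm0, ?_⟩
      have : m'.primeFactors ⊆ n.primeFactors := Nat.primeFactors_mono ⟨pr A, by rw [hm']; ring⟩ (by omega)
      intro p hp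
      have hp' := this hp
      rw [mem_union]
      by_cases h : p ∈ s
      · exact Or.inr h
      · left; rw [← hn.2]; exact mem_sdiff.2 ⟨hp', h⟩
  rw [prod_union hAs] at h2
  rw [h1]
  have h3 : ∏ p ∈ s, (1 - 1 / (p:ℝ))⁻¹ = C⁻¹ := by rw [prod_inv_distrib]
  have h4 : (1 / (pr A:ℝ)) * ∏ p ∈ A, (1 - 1 / (p:ℝ))⁻¹ = ∏ p ∈ A, 1 / ((p:ℝ) - 1) := by
    unfold pr
    push_cast
    rw [one_div, ← prod_inv_distrib, ← prod_mul_distrib]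
    refine prod_congr rfl fun p hp => ?_
    have : (1:ℝ) < p := by exact_mod_cast (hAp p hp).one_lt
    have h1 : (p:ℝ) - 1 ≠ 0 := by linarith
    have h2 : (p:ℝ) ≠ 0 := by linarith
    rw [← mul_inv, one_div]
    congr 1
    field_simp
  rw [h3] at h2
  have h5 := mul_le_mul_of_nonneg_left h2 (one_div_nonneg.2 prpos'.le)
  rw [← mul_assoc, h4] at h5
  calc C * (1 / (pr A:ℝ) * ∑ m ∈ F.image (fun n => n / pr A), 1 / (m:ℝ))
      ≤ C * ((∏ p ∈ A, 1 / ((p:ℝ) - 1)) * C⁻¹) := mul_le_mul_of_nonneg_left h5 hCpos.le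
    _ = _ := by field_simp

theorem sum_coprime_le (a : ℕ) (s : Finset ℕ) : (∀ p ∈ s, p.Prime) → ∀ (T : Finset ℕ) (x : ℝ), 1 ≤ x →
    (∀ m ∈ T, 1 ≤ m ∧ (m:ℝ) ≤ x ∧ ∀ p ∈ s, ¬ p ∣ m) →
    (∑ m ∈ T, 1 / (m:ℝ)) * ∏ p ∈ s, (∑ e ∈ range a, (1 / (p:ℝ)) ^ e) ≤
      1 + Real.log x + a * Real.log (pr s) := by
  induction s using Finset.induction_on with
  | empty =>
    intro _ T x hx hT
    simp only [prod_empty, mul_one, pr_empty, Nat.cast_one, Real.log_one, mul_zero, add_zero]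
    refine le_trans ?_ (sum_le_log hx)
    refine sum_le_sum_of_subset_of_nonneg ?_ fun _ _ _ => by positivity
    intro m hm
    obtain ⟨h1, h2, _⟩ := hT m hm
    exact mem_Icc.2 ⟨h1, Nat.le_floor h2⟩
  | insert q s hq ih =>
    intro hs T x hx hT
    have hqp : q.Prime := hs q (mem_insert_self _ _)
    have hq1 : (1:ℝ) ≤ q := by exact_mod_cast hqp.one_le
    have hsp : ∀ p ∈ s, p.Prime := fun p hp => hs p (mem_insert_of_mem hp)
    set T' := (T ×ˢ range a).image (fun z => z.1 * q ^ z.2) with hT'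
    have inj : Set.InjOn (fun z : ℕ × ℕ => z.1 * q ^ z.2) (T ×ˢ range a : Finset (ℕ × ℕ)) := by
      rintro ⟨m, e⟩ h ⟨m', e'⟩ h' heq
      simp only [coe_product, Set.mem_prod, mem_coe] at h h'
      simp only at heq
      have hm := hT m h.1
      have hm' := hT m' h'.1
      have v1 : (m * q ^ e).factorization q = e := by
        rw [Nat.factorization_mul (by omega) (pow_ne_zero _ hqp.ne_zero)]
        simp [Nat.factorization_eq_zero_of_not_dvd (hm.2.2 q (mem_insert_self _ _)), hqp.factorization_self]
      have v2 : (m' * q ^ e').factorization q = e' := by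
        rw [Nat.factorization_mul (by omega) (pow_ne_zero _ hqp.ne_zero)]
        simp [Nat.factorization_eq_zero_of_not_dvd (hm'.2.2 q (mem_insert_self _ _)), hqp.factorization_self]
      have he : e = e' := by rw [← v1, ← v2, heq]
      subst he
      have := Nat.eq_of_mul_eq_mul_right (pow_pos hqp.pos e) heq
      rw [this]
    have key := ih hsp T' (x * (q:ℝ) ^ a) (by nlinarith [one_le_pow₀ hq1 (n := a)]) (by
      intro m hm
      obtain ⟨⟨m0, e⟩, hz, rfl⟩ := mem_image.1 hm
      rw [mem_product] at hz
      obtain ⟨h1, h2, h3⟩ := hT m0 hz.1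
      refine ⟨Nat.mul_pos h1 (pow_pos hqp.pos _), ?_, ?_⟩
      · push_cast
        refine mul_le_mul h2 (pow_le_pow_right₀ hq1 (mem_range.1 hz.2).le) (by positivity) (by linarith)
      · intro p hp hd
        rcases (hsp p hp).dvd_mul.1 hd with h | h
        · exact h3 p (mem_insert_of_mem hp) h
        · have := (Nat.prime_dvd_prime_iff_eq (hsp p hp) hqp).1 ((hsp p hp).dvd_of_dvd_pow h)
          exact hq (this ▸ hp))
    rw [hT', sum_image inj, sum_product] at key
    rw [prod_insert hq, ← mul_assoc]
    have e1 : ∑ m ∈ T, ∑ e ∈ range a, 1 / ((m * q ^ e : ℕ) : ℝ) =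
        (∑ m ∈ T, 1 / (m:ℝ)) * ∑ e ∈ range a, (1 / (q:ℝ)) ^ e := by
      rw [sum_mul_sum]
      refine sum_congr rfl fun m _ => sum_congr rfl fun e _ => ?_
      push_cast
      rw [one_div_pow, one_div_mul_one_div]
    rw [e1] at key
    refine key.trans (le_of_eq ?_)
    rw [pr_insert hq, Real.log_mul (by linarith) (by positivity), Real.log_pow, Nat.cast_mul,
      Real.log_mul (by linarith)]
    · ring
    · have := pr_pos (fun p hp => (hsp p hp).pos) (Subset.refl s)
      positivity

theorem one_sub_sum_le_prod {ι : Type*} (s : Finset ι) (f : ι → ℝ) (hf : ∀ i ∈ s, 0 ≤ f i ∧ f i ≤ 1) :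
    1 - ∑ i ∈ s, f i ≤ ∏ i ∈ s, (1 - f i) := by
  classical
  induction s using Finset.induction_on with
  | empty => simp
  | insert q s hq ih =>
    rw [sum_insert hq, prod_insert hq]
    have h1 := ih fun i hi => hf i (mem_insert_of_mem hi)
    have h2 := hf q (mem_insert_self _ _)
    have h3 : 0 ≤ ∑ i ∈ s, f i := sum_nonneg fun i hi => (hf i (mem_insert_of_mem hi)).1
    nlinarith [mul_le_mul_of_nonneg_left h1 (sub_nonneg.2 h2.2), mul_nonneg h2.1 h3]

theorem onedim_upper (P : Finset ℕ) (M : ℕ) (hM : M ≠ 0) (x : ℝ) (hx : 1 ≤ x)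
    (hPp : ∀ p ∈ P, p.Prime ∧ ¬ p ∣ M) (a : ℕ) (ha : 2 ≤ a) :
    (∑ A ∈ DD P x, ∏ p ∈ A, 1 / (p:ℝ)) * (1 - (1/2:ℝ) ^ (a - 2)) ≤
      om M * (1 + Real.log x + a * Real.log M) := by
  have hPpos : ∀ p ∈ P, 0 < p := fun p hp => (hPp p hp).1.pos
  have inj : Set.InjOn pr (DD P x : Set (Finset ℕ)) := by
    intro A hA B hB h
    rw [mem_coe, mem_DD] at hA hB
    have e : ∀ A ⊆ P, (pr A).primeFactors = A := fun A hA =>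
      Nat.primeFactors_prod fun p hp => (hPp p (hA hp)).1
    rw [← e A hA.1, ← e B hB.1, h]
  have key := sum_coprime_le a M.primeFactors (fun p hp => Nat.prime_of_mem_primeFactors hp)
    ((DD P x).image pr) x hx (by
      intro m hm
      obtain ⟨A, hA, rfl⟩ := mem_image.1 hm
      rw [mem_DD] at hA
      refine ⟨pr_pos hPpos hA.1, hA.2, ?_⟩
      intro p hp hd
      have hpp := Nat.prime_of_mem_primeFactors hp
      obtain ⟨q, hq, hpq⟩ := (hpp.prime.dvd_finsetProd_iff _).1 hd
      have := (Nat.prime_dvd_prime_iff_eq hpp (hPp q (hA.1 hq)).1).1 hpq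
      subst this
      exact (hPp p (hA.1 hq)).2 (Nat.dvd_of_mem_primeFactors hp))
  rw [sum_image inj] at key
  have e0 : ∀ A : Finset ℕ, 1 / (pr A : ℝ) = ∏ p ∈ A, 1 / (p:ℝ) := by
    intro A; unfold pr; push_cast; rw [prod_div_distrib]; simp
  simp only [e0] at key
  have hSnn : 0 ≤ ∑ A ∈ DD P x, ∏ p ∈ A, 1 / (p:ℝ) :=
    sum_nonneg fun A _ => prod_nonneg fun p _ => by positivity
  have hpr : Real.log (pr M.primeFactors) ≤ Real.log M := by
    refine Real.log_le_log ?_ ?_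
    · exact_mod_cast pr_pos (fun p hp => (Nat.prime_of_mem_primeFactors hp).pos) (Subset.refl _)
    · exact_mod_cast Nat.le_of_dvd (Nat.pos_of_ne_zero hM) (Nat.prod_primeFactors_dvd M)
  have hgeo : ∏ p ∈ M.primeFactors, (∑ e ∈ range a, (1 / (p:ℝ)) ^ e) =
      (om M)⁻¹ * ∏ p ∈ M.primeFactors, (1 - (1 / (p:ℝ)) ^ a) := by
    unfold om
    rw [← prod_inv_distrib, ← prod_mul_distrib]
    refine prod_congr rfl fun p hp => ?_
    have h := one_sub_inv_pos (Nat.prime_of_mem_primeFactors hp)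
    rw [eq_inv_mul_iff_mul_eq₀ h.ne', mul_comm, geom_sum_mul_neg]
  have hprod : 1 - (1/2:ℝ) ^ (a - 2) ≤ ∏ p ∈ M.primeFactors, (1 - (1 / (p:ℝ)) ^ a) := by
    have hin : ∀ p ∈ M.primeFactors, (1 / (p:ℝ)) ≤ 1/2 := by
      intro p hp
      have h : (2:ℝ) ≤ p := by exact_mod_cast (Nat.prime_of_mem_primeFactors hp).two_le
      exact one_div_le_one_div_of_le (by norm_num) h
    have h1 : 1 - ∑ p ∈ M.primeFactors, (1 / (p:ℝ)) ^ a ≤ ∏ p ∈ M.primeFactors, (1 - (1 / (p:ℝ)) ^ a) :=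
      one_sub_sum_le_prod _ _ (fun p hp => ⟨by positivity, pow_le_one₀ (by positivity) ((hin p hp).trans (by norm_num))⟩)
    have h2 : ∑ p ∈ M.primeFactors, (1 / (p:ℝ)) ^ a ≤ (1/2:ℝ) ^ (a - 2) := by
      calc ∑ p ∈ M.primeFactors, (1 / (p:ℝ)) ^ a
          ≤ ∑ p ∈ M.primeFactors, (1/2:ℝ) ^ (a - 2) * (1 / (p:ℝ) ^ 2) := by
            refine sum_le_sum fun p hp => ?_
            have : (1 / (p:ℝ)) ^ a = (1 / (p:ℝ)) ^ (a - 2) * (1 / (p:ℝ)) ^ 2 := by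
              rw [← pow_add]; congr 1; omega
            rw [this, one_div_pow (p:ℝ) 2]
            exact mul_le_mul_of_nonneg_right (pow_le_pow_left₀ (by positivity) (hin p hp) _) (by positivity)
        _ ≤ (1/2:ℝ) ^ (a - 2) * 1 := by
            rw [← mul_sum]
            refine mul_le_mul_of_nonneg_left ?_ (by positivity)
            have := sum_inv_sq_le 1 le_rfl M.primeFactors (fun p hp => (Nat.prime_of_mem_primeFactors hp).one_lt)
            simpa using this
        _ = _ := mul_one _
    linarith
  rw [hgeo] at key
  have h6 : (∑ A ∈ DD P x, ∏ p ∈ A, 1 / (p:ℝ)) * ((om M)⁻¹ * (1 - (1/2:ℝ) ^ (a - 2))) ≤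
      1 + Real.log x + a * Real.log M := by
    refine le_trans (mul_le_mul_of_nonneg_left
      (mul_le_mul_of_nonneg_left hprod (inv_nonneg.2 (om_pos M).le)) hSnn) (key.trans ?_)
    have := mul_le_mul_of_nonneg_left hpr (Nat.cast_nonneg (α := ℝ) a)
    linarith
  have h7 := mul_le_mul_of_nonneg_left h6 (om_pos M).le
  refine le_trans (le_of_eq ?_) h7
  have := (om_pos M).ne'
  field_simp

end GPY

namespace GPY

theorem SK_upper (K : ℕ) (δ : ℝ) (hδ : 0 < δ) : ∃ D₀ : ℕ, 2 * K < D₀ ∧ ∃ a : ℕ,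
    ∀ (P : Finset ℕ) (M : ℕ), M ≠ 0 → (∀ p ∈ P, p.Prime ∧ ¬ p ∣ M ∧ D₀ < p) → ∀ x : ℝ, 1 ≤ x →
    ∑ A ∈ DD P x, ∏ p ∈ A, 1 / ((p:ℝ) - K) ≤
      (1 + δ) * om M * (Real.log x + (1 + a * Real.log M)) := by
  set δ1 := min (δ / 3) (1/4) with hδ1
  have hδp1 : 0 < δ1 := by positivity
  have hδa1 : δ1 ≤ δ / 3 := min_le_left _ _
  have hδb1 : δ1 ≤ 1 / 4 := min_le_right _ _
  obtain ⟨D₀, hD, hprod⟩ := prod_tail K δ1 hδp1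
  obtain ⟨a, ha⟩ := exists_pow_lt_of_lt_one (show (0:ℝ) < δ1 / 2 by positivity) (show (1/2:ℝ) < 1 by norm_num)
  refine ⟨D₀, hD, a + 2, fun P M hM hP x hx => ?_⟩
  have hPpos : ∀ p ∈ P, 0 < p := fun p hp => (hP p hp).1.pos
  have hKp : ∀ p ∈ P, (0:ℝ) < (p:ℝ) - K := by
    intro p hp
    have h1 := (hP p hp).2.2
    have : K < p := by omega
    have : (K:ℝ) < p := by exact_mod_cast this
    linarith
  have hp0 : ∀ p ∈ P, (0:ℝ) < (p:ℝ) := fun p hp => by exact_mod_cast hPpos p hp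
  have h1 := onedim_upper P M hM x hx (fun p hp => ⟨(hP p hp).1, (hP p hp).2.1⟩) (a + 2) (by omega)
  set S := ∑ A ∈ DD P x, ∏ p ∈ A, 1 / (p:ℝ) with hS
  have hSnn : 0 ≤ S := sum_nonneg fun A _ => prod_nonneg fun p _ => by positivity
  have hb : ∀ p ∈ P, 0 ≤ (K:ℝ) / (p * ((p:ℝ) - K)) := fun p hp =>
    div_nonneg (Nat.cast_nonneg _) (mul_nonneg (hp0 p hp).le (hKp p hp).le)
  have h2 := conv_le P hPpos x (fun p => 1 / (p:ℝ)) (fun p => (K:ℝ) / (p * ((p:ℝ) - K))) (fun _ => 1)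
    (fun p hp => by positivity) hb (fun _ _ => zero_le_one)
  simp only [mul_one] at h2
  have h3 : ∑ D ∈ DD P x, ∏ p ∈ D, (1 / (p:ℝ) + (K:ℝ) / (p * ((p:ℝ) - K))) =
      ∑ A ∈ DD P x, ∏ p ∈ A, 1 / ((p:ℝ) - K) := by
    refine sum_congr rfl fun A hA => prod_congr rfl fun p hp => ?_
    have hpP := (mem_DD.1 hA).1 hp
    have e1 := (hKp p hpP).ne'
    have e2 := (hp0 p hpP).ne'
    field_simp
    ring
  rw [h3] at h2
  have h4 : ∑ B ∈ DD P x, (∏ p ∈ B, (K:ℝ) / (p * ((p:ℝ) - K))) * ∑ A ∈ DD P (x / pr B), ∏ p ∈ A, 1 / (p:ℝ)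
      ≤ (1 + δ1) * S := by
    calc _ ≤ ∑ B ∈ DD P x, (∏ p ∈ B, (K:ℝ) / (p * ((p:ℝ) - K))) * S := by
          refine sum_le_sum fun B hB => mul_le_mul_of_nonneg_left ?_ ?_
          · refine sum_le_sum_of_subset_of_nonneg (DD_mono ?_) fun D hD _ => prod_nonneg fun p _ => by positivity
            have : (1:ℝ) ≤ pr B := by exact_mod_cast pr_pos hPpos (mem_DD.1 hB).1
            exact div_le_self (by linarith) this
          · exact prod_nonneg fun p hp => hb p ((mem_DD.1 hB).1 hp)
      _ = (∑ B ∈ DD P x, (∏ p ∈ B, (K:ℝ) / (p * ((p:ℝ) - K)))) * S := by rw [sum_mul]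
      _ ≤ (1 + δ1) * S := by
          refine mul_le_mul_of_nonneg_right ?_ hSnn
          refine le_trans ?_ (hprod P (fun p hp => (hP p hp).2.2))
          rw [prod_one_add]
          refine sum_le_sum_of_subset_of_nonneg (filter_subset _ _) fun B hB _ => ?_
          exact prod_nonneg fun p hp => hb p ((mem_powerset.1 hB) hp)
  have h5 := h2.trans h4
  have e : a + 2 - 2 = a := by omega
  rw [e] at h1
  set Y := 1 + Real.log x + ((a + 2 : ℕ):ℝ) * Real.log M with hY
  have hM1 : (1:ℝ) ≤ M := by exact_mod_cast Nat.one_le_iff_ne_zero.2 hM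
  have hYnn : 0 ≤ Y := by
    have := Real.log_nonneg hx
    have := Real.log_nonneg hM1
    positivity
  have hoY : 0 ≤ om M * Y := mul_nonneg (om_pos M).le hYnn
  have h6 : S ≤ (1 + δ1) * (om M * Y) := by
    have : S * (1 - δ1 / 2) ≤ om M * Y := le_trans (mul_le_mul_of_nonneg_left (by linarith) hSnn) h1
    have h7 : 1 ≤ (1 - δ1 / 2) * (1 + δ1) := by nlinarith
    calc S ≤ S * ((1 - δ1 / 2) * (1 + δ1)) := le_mul_of_one_le_right hSnn h7
      _ = (1 + δ1) * (S * (1 - δ1 / 2)) := by ring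
      _ ≤ _ := mul_le_mul_of_nonneg_left this (by linarith)
  calc _ ≤ (1 + δ1) * S := h5
    _ ≤ (1 + δ1) * ((1 + δ1) * (om M * Y)) := mul_le_mul_of_nonneg_left h6 (by linarith)
    _ = ((1 + δ1) * (1 + δ1)) * (om M * Y) := by ring
    _ ≤ (1 + δ) * (om M * Y) := mul_le_mul_of_nonneg_right (by nlinarith) hoY
    _ = _ := by rw [hY]; ring

noncomputable def TT (P : Finset ℕ) (K j a : ℕ) (x : ℝ) : ℝ :=
  ∑ D ∈ DD P x, (∏ p ∈ D, (j:ℝ) / ((p:ℝ) - K)) * (Real.log (x / pr D)) ^ a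

theorem TT_term_nonneg {P : Finset ℕ} {K j a : ℕ} {x : ℝ} (hP : ∀ p ∈ P, K < p) :
    ∀ D ∈ DD P x, 0 ≤ (∏ p ∈ D, (j:ℝ) / ((p:ℝ) - K)) ∧ 0 ≤ (Real.log (x / pr D)) ^ a := by
  intro D hD
  rw [mem_DD] at hD
  refine ⟨prod_nonneg fun p hp => ?_, ?_⟩
  · have : (K:ℝ) < p := by exact_mod_cast hP p (hD.1 hp)
    exact div_nonneg (Nat.cast_nonneg _) (by linarith)
  · have h : (0:ℝ) < pr D := by exact_mod_cast pr_pos (fun p hp => by have := hP p hp; omega) hD.1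
    exact pow_nonneg (Real.log_nonneg ((one_le_div h).2 hD.2)) _

theorem TT_nonneg {P : Finset ℕ} {K j a : ℕ} {x : ℝ} (hP : ∀ p ∈ P, K < p) : 0 ≤ TT P K j a x :=
  sum_nonneg fun D hD => mul_nonneg (TT_term_nonneg (a := a) hP D hD).1 (TT_term_nonneg (j := j) hP D hD).2

theorem TT_conv (P : Finset ℕ) (K j a : ℕ) (x c E : ℝ) (hP : ∀ p ∈ P, K < p)
    (hS : ∀ y : ℝ, 1 ≤ y → y ≤ x → ∑ A ∈ DD P y, ∏ p ∈ A, 1 / ((p:ℝ) - K) ≤ c * (Real.log y + E)) :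
    TT P K (j+1) a x ≤ c * (TT P K j (a+1) x / ((a:ℝ)+1) + E * TT P K j a x) := by
  have hPpos : ∀ p ∈ P, 0 < p := fun p hp => by have := hP p hp; omega
  have hKp : ∀ p ∈ P, (0:ℝ) < (p:ℝ) - K := by
    intro p hp
    have : (K:ℝ) < p := by exact_mod_cast hP p hp
    linarith
  have h := conv_le P hPpos x (fun p => 1 / ((p:ℝ) - K)) (fun p => (j:ℝ) / ((p:ℝ) - K))
    (fun n => Real.log (x / n) ^ a) (fun p hp => (one_div_pos.2 (hKp p hp)).le)
    (fun p hp => div_nonneg (Nat.cast_nonneg _) (hKp p hp).le) (by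
      intro n hn
      rcases Nat.eq_zero_or_pos n with rfl | h0
      · simp only [Nat.cast_zero, div_zero, Real.log_zero]; positivity
      · have : (0:ℝ) < n := by exact_mod_cast h0
        exact pow_nonneg (Real.log_nonneg ((one_le_div this).2 hn)) _)
  have e0 : TT P K (j+1) a x = ∑ D ∈ DD P x, (∏ p ∈ D, (1 / ((p:ℝ) - K) + (j:ℝ) / ((p:ℝ) - K))) *
      Real.log (x / pr D) ^ a := by
    unfold TT
    refine sum_congr rfl fun D _ => ?_
    congr 1
    refine prod_congr rfl fun p _ => ?_
    push_cast; ring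
  rw [e0]
  refine h.trans ?_
  have e1 : c * (TT P K j (a+1) x / ((a:ℝ)+1) + E * TT P K j a x) =
      ∑ B ∈ DD P x, (∏ p ∈ B, (j:ℝ) / ((p:ℝ) - K)) *
        (c * ((Real.log (x / pr B)) ^ (a+1) / ((a:ℝ)+1) + E * Real.log (x / pr B) ^ a)) := by
    unfold TT
    rw [sum_div, mul_sum, ← sum_add_distrib, mul_sum]
    refine sum_congr rfl fun B _ => ?_
    ring
  rw [e1]
  refine sum_le_sum fun B hB => mul_le_mul_of_nonneg_left ?_ (TT_term_nonneg (a := a) hP B hB).1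
  rw [mem_DD] at hB
  have pB1 : (1:ℝ) ≤ pr B := by exact_mod_cast pr_pos hPpos hB.1
  have pB : (0:ℝ) < pr B := by linarith
  set y := x / pr B with hy
  have hy1 : 1 ≤ y := (one_le_div pB).2 hB.2
  have hyx : y ≤ x := div_le_self (by linarith [hB.2]) pB1
  have := abel_le (DD P y) (fun A => ∏ p ∈ A, 1 / ((p:ℝ) - K)) (fun A => (pr A:ℝ)) y c E hy1
    (fun A hA => ⟨by exact_mod_cast pr_pos hPpos (mem_DD.1 hA).1, (mem_DD.1 hA).2⟩)
    (fun t ht1 hty => by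
      have e : (DD P y).filter (fun A => (pr A:ℝ) ≤ t) = DD P t := by
        ext A
        simp only [mem_filter, mem_DD]
        constructor
        · rintro ⟨⟨h1, _⟩, h2⟩; exact ⟨h1, h2⟩
        · rintro ⟨h1, h2⟩; exact ⟨⟨h1, h2.trans hty⟩, h2⟩
      rw [e]
      exact hS t ht1 (hty.trans hyx)) a
  refine le_trans (le_of_eq ?_) this
  refine sum_congr rfl fun A hA => ?_
  have pA : (0:ℝ) < pr A := by exact_mod_cast pr_pos hPpos (mem_DD.1 hA).1
  congr 3
  rw [hy]; push_cast; field_simp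

theorem TT_step (P : Finset ℕ) (K j a : ℕ) (x : ℝ) (hP : ∀ p ∈ P, K < p ∧ 1 < p)
    (hS : ∀ y : ℝ, 1 ≤ y → ∑ p ∈ P.filter (fun p : ℕ => (p:ℝ) ≤ y), Real.log p / ((p:ℝ) - K) ≤ Real.log y) :
    Real.log x * TT P K j a x ≤ (1 + (j:ℝ) / ((a:ℝ)+1)) * TT P K j (a+1) x := by
  have hPpos : ∀ p ∈ P, 0 < p := fun p hp => by have := (hP p hp).2; omega
  have hPK : ∀ p ∈ P, K < p := fun p hp => (hP p hp).1
  have hKp : ∀ p ∈ P, (0:ℝ) < (p:ℝ) - K := by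
    intro p hp
    have : (K:ℝ) < p := by exact_mod_cast hPK p hp
    linarith
  set w : Finset ℕ → ℝ := fun D => ∏ p ∈ D, (j:ℝ) / ((p:ℝ) - K) with hw
  have e1 : Real.log x * TT P K j a x = TT P K j (a+1) x +
      ∑ D ∈ DD P x, ∑ p ∈ D, w D * Real.log p * Real.log (x / pr D) ^ a := by
    unfold TT
    rw [mul_sum, ← sum_add_distrib]
    refine sum_congr rfl fun D hD => ?_
    rw [mem_DD] at hD
    have hpos : (0:ℝ) < pr D := by exact_mod_cast pr_pos hPpos hD.1
    have hx0 : x ≠ 0 := by linarith [hD.2]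
    have h1 : Real.log (x / pr D) = Real.log x - ∑ p ∈ D, Real.log p := by
      rw [Real.log_div hx0 hpos.ne']
      congr 1
      unfold pr
      push_cast
      rw [Real.log_prod]
      intro p hp
      have := hPpos p (hD.1 hp)
      positivity
    rw [← sum_mul, ← mul_sum, pow_succ]
    have h2 : Real.log x = Real.log (x / pr D) + ∑ p ∈ D, Real.log p := by rw [h1]; ring
    nth_rewrite 1 [h2]
    ring
  have e2 : ∑ D ∈ DD P x, ∑ p ∈ D, w D * Real.log p * Real.log (x / pr D) ^ a =
      ∑ D ∈ DD P x, ∑ p ∈ P.filter (fun p : ℕ => (p:ℝ) ≤ x / pr D ∧ p ∉ D), w D * j *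
        (Real.log p / ((p:ℝ) - K) * Real.log (x / pr D / p) ^ a) := by
    rw [sum_sigma', sum_sigma']
    refine sum_nbij' (fun s => ⟨s.1.erase s.2, s.2⟩) (fun s => ⟨insert s.2 s.1, s.2⟩) ?_ ?_ ?_ ?_ ?_
    · rintro ⟨D, p⟩ h
      simp only [mem_sigma, mem_DD, mem_filter] at h ⊢
      obtain ⟨⟨h1, h2⟩, h3⟩ := h
      have e : pr D = p * pr (D.erase p) := by rw [← pr_insert (notMem_erase p D), insert_erase h3]
      have hp0 : (1:ℝ) ≤ p := by exact_mod_cast hPpos p (h1 h3)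
      have hpos : (0:ℝ) < pr (D.erase p) := by exact_mod_cast pr_pos hPpos ((erase_subset _ _).trans h1)
      rw [e, Nat.cast_mul] at h2
      refine ⟨⟨(erase_subset _ _).trans h1, by nlinarith⟩, h1 h3, ?_, notMem_erase _ _⟩
      rw [le_div_iff₀ hpos]; exact h2
    · rintro ⟨D, p⟩ h
      simp only [mem_sigma, mem_DD, mem_filter] at h ⊢
      obtain ⟨⟨h1, h2⟩, h3, h4, h5⟩ := h
      have hpos : (0:ℝ) < pr D := by exact_mod_cast pr_pos hPpos h1
      refine ⟨⟨insert_subset h3 h1, ?_⟩, mem_insert_self _ _⟩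
      rw [pr_insert h5, Nat.cast_mul]
      rwa [le_div_iff₀ hpos] at h4
    · rintro ⟨D, p⟩ h
      simp only [mem_sigma] at h ⊢
      simp [insert_erase h.2]
    · rintro ⟨D, p⟩ h
      simp only [mem_sigma, mem_filter] at h ⊢
      simp [erase_insert h.2.2.2]
    · rintro ⟨D, p⟩ h
      simp only [mem_sigma, mem_DD] at h ⊢
      obtain ⟨⟨h1, h2⟩, h3⟩ := h
      have e : pr D = p * pr (D.erase p) := by rw [← pr_insert (notMem_erase p D), insert_erase h3]
      have ew : w D = (j:ℝ) / ((p:ℝ) - K) * w (D.erase p) := by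
        simp only [hw]; rw [mul_prod_erase D (fun p : ℕ => (j:ℝ) / ((p:ℝ) - K)) h3]
      have hp0 : (1:ℝ) ≤ p := by exact_mod_cast hPpos p (h1 h3)
      have hpos : (0:ℝ) < pr (D.erase p) := by exact_mod_cast pr_pos hPpos ((erase_subset _ _).trans h1)
      have e3 : x / (pr (D.erase p)) / p = x / pr D := by
        rw [e, Nat.cast_mul, div_div, mul_comm]
      rw [e3, ew]
      ring
  have e3 : ∑ D ∈ DD P x, ∑ p ∈ P.filter (fun p : ℕ => (p:ℝ) ≤ x / pr D ∧ p ∉ D), w D * j *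
        (Real.log p / ((p:ℝ) - K) * Real.log (x / pr D / p) ^ a) ≤
      ∑ D ∈ DD P x, w D * j * ((Real.log (x / pr D)) ^ (a+1) / ((a:ℝ)+1)) := by
    refine sum_le_sum fun D hD => ?_
    rw [← mul_sum]
    refine mul_le_mul_of_nonneg_left ?_ (mul_nonneg (TT_term_nonneg (a := a) hPK D hD).1 (Nat.cast_nonneg _))
    rw [mem_DD] at hD
    have hpos : (0:ℝ) < pr D := by exact_mod_cast pr_pos hPpos hD.1
    set y := x / pr D with hy
    have hy1 : 1 ≤ y := (one_le_div hpos).2 hD.2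
    have := abel_le (P.filter (fun p : ℕ => (p:ℝ) ≤ y)) (fun p => Real.log p / ((p:ℝ) - K)) (fun p => (p:ℝ)) y 1 0 hy1
      (fun p hp => ⟨by exact_mod_cast hPpos p (mem_filter.1 hp).1, (mem_filter.1 hp).2⟩)
      (fun t ht1 hty => by
        have e : (P.filter (fun p : ℕ => (p:ℝ) ≤ y)).filter (fun p : ℕ => (p:ℝ) ≤ t) =
            P.filter (fun p : ℕ => (p:ℝ) ≤ t) := by
          ext p
          simp only [mem_filter]
          constructor
          · rintro ⟨⟨h1, _⟩, h2⟩; exact ⟨h1, h2⟩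
          · rintro ⟨h1, h2⟩; exact ⟨⟨h1, h2.trans hty⟩, h2⟩
        rw [e]
        simpa using hS t ht1) a
    simp only [zero_mul, add_zero, one_mul] at this
    refine le_trans ?_ this
    refine sum_le_sum_of_subset_of_nonneg ?_ ?_
    · intro p hp
      simp only [mem_filter] at hp ⊢
      exact ⟨hp.1, hp.2.1⟩
    · intro p hp _
      simp only [mem_filter] at hp
      have hp0 : (1:ℝ) ≤ p := by exact_mod_cast hPpos p hp.1
      refine mul_nonneg (div_nonneg (Real.log_nonneg hp0) (hKp p hp.1).le) (pow_nonneg (Real.log_nonneg ?_) _)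
      exact (one_le_div (by linarith)).2 hp.2
  rw [e1, e2]
  have e4 : ∑ D ∈ DD P x, w D * j * ((Real.log (x / pr D)) ^ (a+1) / ((a:ℝ)+1)) =
      (j:ℝ) / ((a:ℝ)+1) * TT P K j (a+1) x := by
    unfold TT
    rw [mul_sum]
    refine sum_congr rfl fun D _ => ?_
    simp only [hw]; ring
  linarith

end GPY

namespace GPY

theorem U_lower (P : Finset ℕ) (M : ℕ) (hM : M ≠ 0) (x : ℝ) (hx : 1 ≤ x) (K : ℕ)
    (hP : ∀ p : ℕ, p.Prime → ¬ p ∣ M → (p:ℝ) ≤ x → p ∈ P)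
    (hPp : ∀ p ∈ P, p.Prime ∧ K < p) (j : ℕ) (hj : j ≤ K) :
    (om M * Real.log x) ^ j ≤ ∑ D ∈ DD P (x ^ j), ∏ p ∈ D, (j:ℝ) / ((p:ℝ) - j) := by
  have hPpos : ∀ p ∈ P, 0 < p := fun p hp => (hPp p hp).1.pos
  induction j with
  | zero =>
    rw [pow_zero]
    refine le_trans ?_ (single_le_sum (f := fun D : Finset ℕ => ∏ p ∈ D, ((0:ℕ):ℝ) / ((p:ℝ) - (0:ℕ))) (fun D _ => prod_nonneg fun p hp => by simp) (empty_mem_DD (by simp)))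
    simp
  | succ j ih =>
    have ih := ih (by omega)
    have hlog : 0 ≤ om M * Real.log x := mul_nonneg (om_pos M).le (Real.log_nonneg hx)
    have hjp : ∀ p ∈ P, (0:ℝ) < (p:ℝ) - j - 1 := by
      intro p hp
      have h1 := (hPp p hp).2
      have : j + 1 < p := by omega
      have : ((j + 1 : ℕ):ℝ) < p := by exact_mod_cast this
      push_cast at this
      linarith
    have hp1 : ∀ p ∈ P, (1:ℝ) < p := fun p hp => by exact_mod_cast (hPp p hp).1.one_lt
    have j0 : (0:ℝ) ≤ j := Nat.cast_nonneg _
    calc (om M * Real.log x) ^ (j+1) = (om M * Real.log x) ^ j * (om M * Real.log x) := pow_succ _ _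
      _ ≤ (∑ D ∈ DD P (x ^ j), ∏ p ∈ D, (j:ℝ) / ((p:ℝ) - j)) * (om M * Real.log x) :=
          mul_le_mul_of_nonneg_right ih hlog
      _ ≤ ∑ B ∈ DD P (x ^ j), (∏ p ∈ B, (j:ℝ) / ((p:ℝ) - j - 1)) *
            ∑ A ∈ (DD P x).filter (fun A => Disjoint A B), ∏ p ∈ A, 1 / ((p:ℝ) - 1) := by
          rw [sum_mul]
          refine sum_le_sum fun B hB => ?_
          rw [mem_DD] at hB
          have h1 := onedim_lower P M x hx hP hM (fun p hp => (hPp p hp).1) B (fun p hp => (hPp p (hB.1 hp)).1)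
          have h2 : ∏ p ∈ B, (j:ℝ) / ((p:ℝ) - j) ≤ (∏ p ∈ B, (j:ℝ) / ((p:ℝ) - j - 1)) * ∏ p ∈ B, (1 - 1 / (p:ℝ)) := by
            rw [← prod_mul_distrib]
            refine prod_le_prod (fun p hp => div_nonneg j0 (by linarith [hjp p (hB.1 hp)])) fun p hp => ?_
            have a1 := hjp p (hB.1 hp)
            have a2 := hp1 p (hB.1 hp)
            have e : 1 - 1 / (p:ℝ) = (p - 1) / p := by field_simp
            rw [e, div_mul_div_comm, div_le_div_iff₀ (by linarith) (mul_pos a1 (by linarith))]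
            nlinarith [mul_nonneg j0 j0]
          calc _ ≤ ((∏ p ∈ B, (j:ℝ) / ((p:ℝ) - j - 1)) * ∏ p ∈ B, (1 - 1 / (p:ℝ))) * (om M * Real.log x) :=
                mul_le_mul_of_nonneg_right h2 hlog
            _ = (∏ p ∈ B, (j:ℝ) / ((p:ℝ) - j - 1)) * (om M * (∏ p ∈ B, (1 - 1 / (p:ℝ))) * Real.log x) := by ring
            _ ≤ _ := mul_le_mul_of_nonneg_left h1
                (prod_nonneg fun p hp => div_nonneg j0 (hjp p (hB.1 hp)).le)
      _ ≤ ∑ B ∈ DD P (x ^ (j+1)), (∏ p ∈ B, (j:ℝ) / ((p:ℝ) - j - 1)) *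
            ∑ A ∈ (DD P (x ^ (j+1) / pr B)).filter (fun A => Disjoint A B), ∏ p ∈ A, 1 / ((p:ℝ) - 1) := by
          have nnA : ∀ A ⊆ P, 0 ≤ ∏ p ∈ A, 1 / ((p:ℝ) - 1) := fun A hA =>
            prod_nonneg fun p hp => one_div_nonneg.2 (by linarith [hp1 p (hA hp)])
          have nnB : ∀ B ⊆ P, 0 ≤ ∏ p ∈ B, (j:ℝ) / ((p:ℝ) - j - 1) := fun B hB =>
            prod_nonneg fun p hp => div_nonneg j0 (hjp p (hB hp)).le
          refine le_trans (sum_le_sum fun B hB => mul_le_mul_of_nonneg_left ?_ (nnB B (mem_DD.1 hB).1))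
            (sum_le_sum_of_subset_of_nonneg (DD_mono (pow_le_pow_right₀ hx (Nat.le_succ j))) ?_)
          · refine sum_le_sum_of_subset_of_nonneg (filter_subset_filter _ (DD_mono ?_)) ?_
            · rw [mem_DD] at hB
              have hpos : (0:ℝ) < pr B := by exact_mod_cast pr_pos hPpos hB.1
              rw [le_div_iff₀ hpos, pow_succ, mul_comm]
              exact mul_le_mul_of_nonneg_right hB.2 (by linarith)
            · intro A hA _
              exact nnA A (mem_DD.1 (mem_filter.1 hA).1).1
          · intro B hB _
            refine mul_nonneg (nnB B (mem_DD.1 hB).1) (sum_nonneg fun A hA => nnA A (mem_DD.1 (mem_filter.1 hA).1).1)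
      _ = ∑ D ∈ DD P (x ^ (j+1)), ∏ p ∈ D, (1 / ((p:ℝ) - 1) + (j:ℝ) / ((p:ℝ) - j - 1)) := by
          have := conv_eq P hPpos (x ^ (j+1)) (fun p => 1 / ((p:ℝ) - 1)) (fun p => (j:ℝ) / ((p:ℝ) - j - 1)) (fun _ => 1)
          simp only [mul_one] at this
          rw [this]
      _ ≤ _ := by
          refine sum_le_sum fun D hD => ?_
          have hDP := (mem_DD.1 hD).1
          refine prod_le_prod (fun p hp => ?_) fun p hp => ?_
          · exact add_nonneg (one_div_nonneg.2 (by linarith [hp1 p (hDP hp)])) (div_nonneg j0 (hjp p (hDP hp)).le)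
          · have a1 := hjp p (hDP hp)
            have : 1 / ((p:ℝ) - 1) ≤ 1 / ((p:ℝ) - j - 1) := one_div_le_one_div_of_le a1 (by linarith)
            have e : ((j + 1 : ℕ):ℝ) / ((p:ℝ) - (j + 1 : ℕ)) = 1 / ((p:ℝ) - j - 1) + (j:ℝ) / ((p:ℝ) - j - 1) := by
              push_cast
              rw [← add_div]
              congr 1 <;> ring
            rw [e]
            linarith

theorem ystar_lower (P : Finset ℕ) (M : ℕ) (hM : M ≠ 0) (y : ℝ) (hy : 1 ≤ y)
    (hP : ∀ p : ℕ, p.Prime → ¬ p ∣ M → (p:ℝ) ≤ y → p ∈ P)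
    (hPp : ∀ p ∈ P, p.Prime) (B : Finset ℕ) (hB : ∀ p ∈ B, p.Prime) (l : ℕ) :
    om M * (∏ p ∈ B, (1 - 1 / (p:ℝ))) * (Real.log y ^ (l+1) / ((l:ℝ)+1)) ≤
      ∑ A ∈ (DD P y).filter (fun A => Disjoint A B), (∏ p ∈ A, 1 / ((p:ℝ) - 1)) * Real.log (y / pr A) ^ l := by
  have hPpos : ∀ p ∈ P, 0 < p := fun p hp => (hPp p hp).pos
  refine abel_ge ((DD P y).filter (fun A => Disjoint A B)) (fun A => ∏ p ∈ A, 1 / ((p:ℝ) - 1)) (fun A => (pr A:ℝ)) y _ hy ?_ ?_ l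
  · intro A hA
    have := (mem_DD.1 (mem_filter.1 hA).1)
    exact ⟨by exact_mod_cast pr_pos hPpos this.1, this.2⟩
  · intro t ht hty
    refine (onedim_lower P M t ht (fun p h1 h2 h3 => hP p h1 h2 (h3.trans hty)) hM hPp B hB).trans (le_of_eq ?_)
    refine sum_congr ?_ fun _ _ => rfl
    ext A
    simp only [mem_filter, mem_DD]
    constructor
    · rintro ⟨⟨h1, h2⟩, h3⟩; exact ⟨⟨⟨h1, h2.trans hty⟩, h3⟩, h2⟩
    · rintro ⟨⟨⟨h1, h2⟩, h3⟩, h4⟩; exact ⟨⟨h1, h4⟩, h3⟩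

end GPY

namespace GPY

noncomputable def lam (𝒟 : Finset (Finset ℕ)) (κ : ℕ → ℝ) (z : Finset ℕ → ℝ) (D : Finset ℕ) : ℝ :=
  (∏ p ∈ D, (-(1 / κ p))) * ∑ S ∈ 𝒟.filter (fun S => D ⊆ S), z S

theorem diag (𝒟 : Finset (Finset ℕ)) (hdown : ∀ D ∈ 𝒟, ∀ r ⊆ D, r ∈ 𝒟) (l : Finset ℕ → ℝ) (κ : ℕ → ℝ)
    (hκ : ∀ D ∈ 𝒟, ∀ p ∈ D, κ p ≠ 0) :
    ∑ D ∈ 𝒟, ∑ E ∈ 𝒟, l D * l E * ∏ p ∈ D ∪ E, κ p =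
    ∑ r ∈ 𝒟, (∏ p ∈ r, (1 / κ p - 1)) * (∑ D ∈ 𝒟.filter (fun D => r ⊆ D), l D * ∏ p ∈ D, κ p) ^ 2 := by
  have h1 : ∀ D ∈ 𝒟, ∀ E ∈ 𝒟, l D * l E * ∏ p ∈ D ∪ E, κ p =
      ∑ r ∈ 𝒟, (if r ⊆ D then (if r ⊆ E then (∏ p ∈ r, (1 / κ p - 1)) * ((l D * ∏ p ∈ D, κ p) * (l E * ∏ p ∈ E, κ p)) else 0) else 0) := by
    intro D hD E hE
    have e1 : ∏ p ∈ D ∩ E, (1 / κ p) = ∑ r ∈ (D ∩ E).powerset, ∏ p ∈ r, (1 / κ p - 1) := by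
      rw [← prod_one_add]; refine prod_congr rfl fun p _ => by ring
    have e2 : (D ∩ E).powerset = 𝒟.filter (fun r => r ⊆ D ∧ r ⊆ E) := by
      ext r
      simp only [mem_powerset, mem_filter, subset_inter_iff]
      exact ⟨fun h => ⟨hdown D hD r h.1, h⟩, fun h => h.2⟩
    have e3 : ∏ p ∈ D ∪ E, κ p = (∏ p ∈ D, κ p) * (∏ p ∈ E, κ p) * ∏ p ∈ D ∩ E, (1 / κ p) := by
      rw [← prod_union_inter, mul_assoc, ← prod_mul_distrib]
      rw [prod_eq_one (s := D ∩ E), mul_one]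
      intro p hp
      exact mul_one_div_cancel (hκ D hD p (mem_inter.1 hp).1)
    rw [e3, e1, e2, sum_filter]
    rw [mul_sum, mul_sum]
    refine sum_congr rfl fun r _ => ?_
    by_cases a1 : r ⊆ D <;> by_cases a2 : r ⊆ E <;> simp [a1, a2]
    ring
  rw [sum_congr rfl fun D hD => sum_congr rfl fun E hE => h1 D hD E hE]
  rw [sum_congr rfl fun D _ => sum_comm]
  rw [sum_comm]
  refine sum_congr rfl fun r _ => ?_
  rw [sum_filter, sq, sum_mul_sum, mul_sum]
  refine sum_congr rfl fun D _ => ?_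
  rw [mul_sum]
  refine sum_congr rfl fun E _ => ?_
  by_cases a1 : r ⊆ D <;> by_cases a2 : r ⊆ E <;> simp [a1, a2]

theorem lam_inner (𝒟 : Finset (Finset ℕ)) (hdown : ∀ D ∈ 𝒟, ∀ r ⊆ D, r ∈ 𝒟) (κ κ' : ℕ → ℝ)
    (z : Finset ℕ → ℝ) (r : Finset ℕ) :
    ∑ D ∈ 𝒟.filter (fun D => r ⊆ D), lam 𝒟 κ z D * ∏ p ∈ D, κ' p =
    (∏ p ∈ r, (-(κ' p / κ p))) * ∑ S ∈ 𝒟.filter (fun S => r ⊆ S), z S * ∏ p ∈ S \ r, (1 - κ' p / κ p) := by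
  have e1 : ∀ D, lam 𝒟 κ z D * ∏ p ∈ D, κ' p =
      ∑ S ∈ 𝒟.filter (fun S => D ⊆ S), z S * ∏ p ∈ D, (-(κ' p / κ p)) := by
    intro D
    unfold lam
    rw [← sum_mul, mul_right_comm, mul_comm, ← prod_mul_distrib]
    congr 1
    refine prod_congr rfl fun p _ => by ring
  simp only [e1]
  have e2 : ∑ D ∈ 𝒟.filter (fun D => r ⊆ D), ∑ S ∈ 𝒟.filter (fun S => D ⊆ S), z S * ∏ p ∈ D, (-(κ' p / κ p)) =
      ∑ S ∈ 𝒟.filter (fun S => r ⊆ S), ∑ D ∈ Finset.Icc r S, z S * ∏ p ∈ D, (-(κ' p / κ p)) := by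
    refine sum_comm' ?_
    intro D S
    simp only [mem_filter, mem_Icc]
    constructor
    · rintro ⟨⟨h1, h2⟩, h3, h4⟩; exact ⟨⟨h2, h4⟩, h3, h2.trans h4⟩
    · rintro ⟨⟨h1, h2⟩, h3, h4⟩; exact ⟨⟨hdown S h3 D h2, h1⟩, h3, h2⟩
  rw [e2, mul_sum]
  refine sum_congr rfl fun S hS => ?_
  rw [mem_filter] at hS
  rw [← mul_sum, Finset.Icc_eq_image_powerset hS.2, sum_image]
  · have : ∀ A ∈ (S \ r).powerset, ∏ p ∈ r ∪ A, (-(κ' p / κ p)) = (∏ p ∈ r, (-(κ' p / κ p))) * ∏ p ∈ A, (-(κ' p / κ p)) := by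
      intro A hA
      rw [mem_powerset] at hA
      exact prod_union (disjoint_of_subset_right hA disjoint_sdiff)
    rw [sum_congr rfl this, ← mul_sum, ← prod_one_add]
    have : ∏ p ∈ S \ r, (1 + -(κ' p / κ p)) = ∏ p ∈ S \ r, (1 - κ' p / κ p) :=
      prod_congr rfl fun p _ => by ring
    rw [this]; ring
  · intro A hA B hB hAB
    simp only [coe_powerset, Set.mem_preimage, Set.mem_powerset_iff, coe_subset] at hA hB
    have dA : Disjoint r A := disjoint_of_subset_right hA disjoint_sdiff
    have dB : Disjoint r B := disjoint_of_subset_right hB disjoint_sdiff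
    have := congrArg (fun X => X \ r) hAB
    simp only [union_sdiff_cancel_left dA, union_sdiff_cancel_left dB] at this
    exact this

theorem DD_down {P : Finset ℕ} (hP : ∀ p ∈ P, 0 < p) {x : ℝ} : ∀ D ∈ DD P x, ∀ r ⊆ D, r ∈ DD P x := by
  intro D hD r hr
  rw [mem_DD] at hD ⊢
  refine ⟨hr.trans hD.1, le_trans ?_ hD.2⟩
  have : pr r ∣ pr D := prod_dvd_prod_of_subset _ _ _ hr
  exact_mod_cast Nat.le_of_dvd (pr_pos hP hD.1) this

/-- the Selberg weights -/
noncomputable def kap (k : ℕ) (p : ℕ) : ℝ := (k:ℝ) / p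

noncomputable def yy (l : ℕ) (R : ℝ) (D : Finset ℕ) : ℝ := (Real.log (R / pr D)) ^ l

noncomputable def zz (k l : ℕ) (R : ℝ) (D : Finset ℕ) : ℝ := (∏ p ∈ D, (k:ℝ) / ((p:ℝ) - k)) * yy l R D

noncomputable def lamb (P : Finset ℕ) (k l : ℕ) (R : ℝ) (D : Finset ℕ) : ℝ :=
  lam (DD P R) (kap k) (zz k l R) D

noncomputable def QQ (P : Finset ℕ) (k l : ℕ) (R : ℝ) (κ : ℕ → ℝ) : ℝ :=
  ∑ D ∈ DD P R, ∑ E ∈ DD P R, lamb P k l R D * lamb P k l R E * ∏ p ∈ D ∪ E, κ p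

theorem QQ_eq (P : Finset ℕ) (k l : ℕ) (R : ℝ) (hP : ∀ p ∈ P, 0 < p) (κ : ℕ → ℝ)
    (hκ : ∀ p ∈ P, κ p ≠ 0) : QQ P k l R κ =
    ∑ r ∈ DD P R, (∏ p ∈ r, (1 / κ p - 1)) * ((∏ p ∈ r, (-(κ p / kap k p))) *
      ∑ S ∈ (DD P R).filter (fun S => r ⊆ S), zz k l R S * ∏ p ∈ S \ r, (1 - κ p / kap k p)) ^ 2 := by
  unfold QQ
  rw [diag (DD P R) (DD_down hP) _ κ (fun D hD p hp => hκ p ((mem_DD.1 hD).1 hp))]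
  refine sum_congr rfl fun r _ => ?_
  unfold lamb
  rw [lam_inner (DD P R) (DD_down hP)]

theorem Q1_eq (P : Finset ℕ) (k l : ℕ) (hk : 0 < k) (R : ℝ) (hP : ∀ p ∈ P, k < p) :
    QQ P k l R (kap k) = TT P k k (2 * l) R := by
  have hPpos : ∀ p ∈ P, 0 < p := fun p hp => by have := hP p hp; omega
  have hk0 : (0:ℝ) < k := by exact_mod_cast hk
  have hκ : ∀ p ∈ P, kap k p ≠ 0 := by
    intro p hp
    have : (0:ℝ) < p := by exact_mod_cast hPpos p hp
    unfold kap; positivity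
  rw [QQ_eq P k l R hPpos _ hκ]
  unfold TT
  refine sum_congr rfl fun r hr => ?_
  have hrP := (mem_DD.1 hr).1
  have e1 : ∑ S ∈ (DD P R).filter (fun S => r ⊆ S), zz k l R S * ∏ p ∈ S \ r, (1 - kap k p / kap k p) = zz k l R r := by
    rw [sum_eq_single r]
    · simp
    · intro S hS hne
      rw [mem_filter] at hS
      have : (S \ r).Nonempty := by
        rw [sdiff_nonempty]; intro h; exact hne (subset_antisymm h hS.2)
      obtain ⟨p, hp⟩ := this
      have hpP := (mem_DD.1 hS.1).1 (mem_sdiff.1 hp).1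
      rw [prod_eq_zero hp, mul_zero]
      rw [div_self (hκ p hpP), sub_self]
    · intro h; exact absurd (mem_filter.2 ⟨hr, Subset.refl r⟩) h
  rw [e1]
  unfold zz yy
  rw [mul_pow, mul_pow, ← mul_assoc, ← mul_assoc, ← pow_mul, mul_comm l 2]
  congr 1
  rw [← prod_pow, ← prod_pow, ← prod_mul_distrib, ← prod_mul_distrib]
  refine prod_congr rfl fun p hp => ?_
  have h1 : (k:ℝ) < p := by exact_mod_cast hP p (hrP hp)
  have h2 : (0:ℝ) < (p:ℝ) - k := by linarith
  have h3 : (0:ℝ) < p := by linarith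
  rw [div_self (hκ p (hrP hp))]
  unfold kap
  field_simp

theorem sum_super (P : Finset ℕ) (hP : ∀ p ∈ P, 0 < p) (R : ℝ) (r : Finset ℕ) (hr : r ⊆ P)
    (F : Finset ℕ → ℝ) :
    ∑ S ∈ (DD P R).filter (fun S => r ⊆ S), F S =
    ∑ A ∈ (DD P (R / pr r)).filter (fun A => Disjoint A r), F (A ∪ r) := by
  have hpos : (0:ℝ) < pr r := by exact_mod_cast pr_pos hP hr
  refine sum_nbij' (fun S => S \ r) (fun A => A ∪ r) ?_ ?_ ?_ ?_ ?_
  · intro S hS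
    rw [mem_filter, mem_DD] at hS
    rw [mem_filter, mem_DD]
    refine ⟨⟨sdiff_subset.trans hS.1.1, ?_⟩, sdiff_disjoint⟩
    rw [le_div_iff₀ hpos]
    have : pr S = pr (S \ r) * pr r := by rw [← pr_union sdiff_disjoint, sdiff_union_of_subset hS.2]
    rw [this] at hS
    exact_mod_cast hS.1.2
  · intro A hA
    rw [mem_filter, mem_DD] at hA
    rw [mem_filter, mem_DD]
    refine ⟨⟨union_subset hA.1.1 hr, ?_⟩, subset_union_right⟩
    rw [pr_union hA.2]
    rw [le_div_iff₀ hpos] at hA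
    exact_mod_cast hA.1.2
  · intro S hS
    rw [mem_filter] at hS
    exact sdiff_union_of_subset hS.2
  · intro A hA
    rw [mem_filter] at hA
    exact union_sdiff_cancel_right hA.2
  · intro S hS
    rw [mem_filter] at hS
    rw [sdiff_union_of_subset hS.2]

theorem Q2_ge (P : Finset ℕ) (k l M : ℕ) (hk : 2 ≤ k) (R : ℝ) (hM : M ≠ 0)
    (hP : ∀ p ∈ P, p.Prime ∧ k < p)
    (hPf : ∀ p : ℕ, p.Prime → ¬ p ∣ M → (p:ℝ) ≤ R → p ∈ P) :
    (om M) ^ 2 / ((l:ℝ)+1) ^ 2 * TT P k (k-1) (2 * l + 2) R ≤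
      QQ P k l R (fun p => ((k:ℝ) - 1) / ((p:ℝ) - 1)) := by
  have hPpos : ∀ p ∈ P, 0 < p := fun p hp => (hP p hp).1.pos
  have hk0 : (1:ℝ) < k := by exact_mod_cast hk
  have hpk : ∀ p ∈ P, (k:ℝ) < p := fun p hp => by exact_mod_cast (hP p hp).2
  have hκ : ∀ p ∈ P, ((k:ℝ) - 1) / ((p:ℝ) - 1) ≠ 0 := by
    intro p hp
    have := hpk p hp
    exact (div_pos (by linarith) (by linarith)).ne'
  rw [QQ_eq P k l R hPpos _ hκ]
  unfold TT
  rw [mul_sum]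
  refine sum_le_sum fun r hr => ?_
  have hrD := mem_DD.1 hr
  have hrP := hrD.1
  have hpos1 : (1:ℝ) ≤ pr r := by exact_mod_cast pr_pos hPpos hrP
  have hpos : (0:ℝ) < pr r := by linarith
  have hy1 : 1 ≤ R / pr r := (one_le_div hpos).2 hrD.2
  have hyR : R / pr r ≤ R := div_le_self (by linarith [hrD.2]) hpos1
  rw [sum_super P hPpos R r hrP]
  have e1 : ∀ A ∈ (DD P (R / pr r)).filter (fun A => Disjoint A r),
      zz k l R (A ∪ r) * ∏ p ∈ (A ∪ r) \ r, (1 - ((k:ℝ) - 1) / ((p:ℝ) - 1) / kap k p) =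
      (∏ p ∈ r, (k:ℝ) / ((p:ℝ) - k)) * ((∏ p ∈ A, 1 / ((p:ℝ) - 1)) * Real.log (R / pr r / pr A) ^ l) := by
    intro A hA
    rw [mem_filter, mem_DD] at hA
    rw [union_sdiff_cancel_right hA.2]
    unfold zz yy
    rw [prod_union hA.2, pr_union hA.2]
    have : R / ((pr A * pr r : ℕ):ℝ) = R / pr r / pr A := by
      push_cast; rw [div_div, mul_comm]
    rw [this]
    have h2 : (∏ p ∈ A, (k:ℝ) / ((p:ℝ) - k)) * ∏ p ∈ A, (1 - ((k:ℝ) - 1) / ((p:ℝ) - 1) / kap k p) =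
        ∏ p ∈ A, 1 / ((p:ℝ) - 1) := by
      rw [← prod_mul_distrib]
      refine prod_congr rfl fun p hp => ?_
      have h1 := hpk p (hA.1.1 hp)
      have a1 : (p:ℝ) - k ≠ 0 := by linarith
      have a2 : (p:ℝ) - 1 ≠ 0 := by linarith
      have a3 : (p:ℝ) ≠ 0 := by linarith
      have a4 : (k:ℝ) ≠ 0 := by linarith
      unfold kap
      field_simp
      ring
    rw [← h2]; ring
  rw [sum_congr rfl e1, ← mul_sum]
  set Y := ∑ A ∈ (DD P (R / pr r)).filter (fun A => Disjoint A r), (∏ p ∈ A, 1 / ((p:ℝ) - 1)) * Real.log (R / pr r / pr A) ^ l with hY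
  have hYl := ystar_lower P M hM (R / pr r) hy1 (fun p h1 h2 h3 => hPf p h1 h2 (h3.trans hyR))
    (fun p hp => (hP p hp).1) r (fun p hp => (hP p (hrP hp)).1) l
  rw [← hY] at hYl
  set Gr := ∏ p ∈ r, (1 - 1 / (p:ℝ)) with hG
  have hGpos : 0 < Gr := prod_pos fun p hp => one_sub_inv_pos (hP p (hrP hp)).1
  have e2 : (∏ p ∈ r, (1 / (((k:ℝ) - 1) / ((p:ℝ) - 1)) - 1)) * ((∏ p ∈ r, (-(((k:ℝ) - 1) / ((p:ℝ) - 1) / kap k p))) *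
      ((∏ p ∈ r, (k:ℝ) / ((p:ℝ) - k)) * Y)) ^ 2 =
      (∏ p ∈ r, (((k-1:ℕ):ℝ) / ((p:ℝ) - k))) * (Y / Gr) ^ 2 := by
    rw [hG, div_pow, mul_pow, mul_pow, ← prod_pow, ← prod_pow, ← prod_pow, ← mul_assoc, ← mul_assoc,
      ← prod_mul_distrib, ← prod_mul_distrib, ← mul_div_assoc, mul_div_right_comm, ← prod_div_distrib]
    congr 1
    refine prod_congr rfl fun p hp => ?_
    have h1 := hpk p (hrP hp)
    have a1 : (p:ℝ) - k ≠ 0 := by linarith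
    have a2 : (p:ℝ) - 1 ≠ 0 := by linarith
    have a3 : (p:ℝ) ≠ 0 := by linarith
    have a4 : (k:ℝ) ≠ 0 := by linarith
    have a5 : (k:ℝ) - 1 ≠ 0 := by linarith
    have e : 1 - 1 / (p:ℝ) = (p - 1) / p := by field_simp
    rw [e]
    unfold kap
    rw [Nat.cast_sub (by omega)]
    push_cast
    field_simp
    ring
  rw [e2]
  have h3 : om M * (Real.log (R / pr r) ^ (l+1) / ((l:ℝ)+1)) ≤ Y / Gr := by
    rw [le_div_iff₀ hGpos]
    linarith
  have hL : 0 ≤ Real.log (R / pr r) := Real.log_nonneg hy1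
  have h4 : 0 ≤ om M * (Real.log (R / pr r) ^ (l+1) / ((l:ℝ)+1)) :=
    mul_nonneg (om_pos M).le (div_nonneg (pow_nonneg hL _) (by positivity))
  have h5 := pow_le_pow_left₀ h4 h3 2
  have h6 : 0 ≤ ∏ p ∈ r, (((k-1:ℕ):ℝ) / ((p:ℝ) - k)) := prod_nonneg fun p hp =>
    div_nonneg (Nat.cast_nonneg _) (by linarith [hpk p (hrP hp)])
  refine le_trans (le_of_eq ?_) (mul_le_mul_of_nonneg_left h5 h6)
  have : 2 * l + 2 = (l+1) * 2 := by ring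
  rw [this, pow_mul]
  field_simp

end GPY

namespace GPY

theorem pow_diff_le (l : ℕ) (a b c : ℝ) (hb : 0 ≤ b) (hba : b ≤ a) (hac : a ≤ c) (hl : 1 ≤ l) :
    a ^ l - b ^ l ≤ l * (a - b) * c ^ (l - 1) := by
  have ha : 0 ≤ a := hb.trans hba
  have h : a ^ l - b ^ l ≤ (a - b) * (l * a ^ (l - 1)) := by
    rw [← (Commute.all a b).mul_geom_sum₂]
    refine mul_le_mul_of_nonneg_left ?_ (by linarith)
    calc ∑ i ∈ range l, a ^ i * b ^ (l - 1 - i) ≤ ∑ i ∈ range l, a ^ (l - 1) := by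
          refine sum_le_sum fun i hi => ?_
          rw [mem_range] at hi
          calc a ^ i * b ^ (l - 1 - i) ≤ a ^ i * a ^ (l - 1 - i) :=
                mul_le_mul_of_nonneg_left (pow_le_pow_left₀ hb hba _) (pow_nonneg ha _)
            _ = a ^ (l - 1) := by rw [← pow_add]; congr 1; omega
      _ = l * a ^ (l - 1) := by simp
  have h2 : a ^ (l-1) ≤ c ^ (l-1) := pow_le_pow_left₀ ha hac _
  have h3 : 0 ≤ (l:ℝ) * (a - b) := mul_nonneg (Nat.cast_nonneg _) (by linarith)
  nlinarith [mul_le_mul_of_nonneg_left h2 h3]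

theorem Qp_le (P : Finset ℕ) (k l : ℕ) (hk : 0 < k) (hl : 1 ≤ l) (R : ℝ) (hR : 1 ≤ R)
    (hP : ∀ p ∈ P, k < p ∧ 1 < p) (q : ℕ) (hq : q ∈ P) :
    QQ P k l R (Function.update (kap k) q 1) ≤
      ((l:ℝ) * Real.log q * (Real.log R) ^ (l - 1)) ^ 2 * TT P k k 0 R := by
  have hPpos : ∀ p ∈ P, 0 < p := fun p hp => by have := hP p hp; omega
  have hk0 : (0:ℝ) < k := by exact_mod_cast hk
  have hpk : ∀ p ∈ P, (k:ℝ) < p := fun p hp => by exact_mod_cast (hP p hp).1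
  have hκ0 : ∀ p ∈ P, kap k p ≠ 0 := by
    intro p hp
    have : (0:ℝ) < p := by exact_mod_cast hPpos p hp
    unfold kap; positivity
  have hκ : ∀ p ∈ P, Function.update (kap k) q 1 p ≠ 0 := by
    intro p hp
    by_cases h : p = q
    · subst h; simp
    · rw [Function.update_of_ne h]; exact hκ0 p hp
  rw [QQ_eq P k l R hPpos _ hκ]
  unfold TT
  rw [mul_sum]
  have hlogR : 0 ≤ Real.log R := Real.log_nonneg hR
  have hlogq : 0 ≤ Real.log q := Real.log_nonneg (by exact_mod_cast hPpos q hq)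
  refine sum_le_sum fun r hr => ?_
  have hrD := mem_DD.1 hr
  have hrP := hrD.1
  have hw : 0 ≤ ∏ p ∈ r, (k:ℝ) / ((p:ℝ) - k) := prod_nonneg fun p hp =>
    div_nonneg hk0.le (by linarith [hpk p (hrP hp)])
  rw [pow_zero, mul_one]
  by_cases hqr : q ∈ r
  · rw [prod_eq_zero hqr (by simp), zero_mul]
    positivity
  have hne : ∀ p ∈ r, p ≠ q := fun p hp h => hqr (h ▸ hp)
  have e1 : ∏ p ∈ r, (1 / Function.update (kap k) q 1 p - 1) = ∏ p ∈ r, ((p:ℝ) - k) / k := by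
    refine prod_congr rfl fun p hp => ?_
    rw [Function.update_of_ne (hne p hp)]
    have : (0:ℝ) < p := by exact_mod_cast hPpos p (hrP hp)
    unfold kap
    field_simp
  have e2 : (∏ p ∈ r, (-(Function.update (kap k) q 1 p / kap k p))) ^ 2 = 1 := by
    rw [← prod_pow]
    refine prod_eq_one fun p hp => ?_
    rw [Function.update_of_ne (hne p hp), div_self (hκ0 p (hrP hp))]
    norm_num
  have e3 : ∑ S ∈ (DD P R).filter (fun S => r ⊆ S), zz k l R S *
      ∏ p ∈ S \ r, (1 - Function.update (kap k) q 1 p / kap k p) =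
      (∏ p ∈ r, (k:ℝ) / ((p:ℝ) - k)) * (yy l R r - if insert q r ∈ DD P R then yy l R (insert q r) else 0) := by
    have hsub : (DD P R).filter (fun S => r ⊆ S ∧ S ⊆ insert q r) ⊆ (DD P R).filter (fun S => r ⊆ S) := by
      intro S hS
      rw [mem_filter] at hS ⊢
      exact ⟨hS.1, hS.2.1⟩
    rw [← sum_subset hsub]
    · have : (DD P R).filter (fun S => r ⊆ S ∧ S ⊆ insert q r) =
          if insert q r ∈ DD P R then {r, insert q r} else {r} := by
        ext S
        rw [mem_filter]
        constructor
        · rintro ⟨h1, h2, h3⟩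
          by_cases hqS : q ∈ S
          · have : S = insert q r := subset_antisymm h3 (insert_subset hqS h2)
            subst this
            rw [if_pos h1]; simp
          · have : S = r := by
              refine subset_antisymm (fun p hp => ?_) h2
              rcases mem_insert.1 (h3 hp) with h | h
              · exact absurd (h ▸ hp) hqS
              · exact h
            subst this
            split_ifs <;> simp
        · intro h
          split_ifs at h with hi
          · rw [mem_insert, mem_singleton] at h
            rcases h with rfl | rfl
            · exact ⟨hr, Subset.refl _, subset_insert _ _⟩
            · exact ⟨hi, subset_insert _ _, Subset.refl _⟩
          · rw [mem_singleton] at h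
            subst h
            exact ⟨hr, Subset.refl _, subset_insert _ _⟩
      rw [this]
      split_ifs with hi
      · rw [sum_pair (by intro h; exact hqr (h ▸ mem_insert_self q r))]
        have e4 : insert q r \ r = {q} := by
          ext p
          simp only [mem_sdiff, mem_insert, mem_singleton]
          constructor
          · rintro ⟨h1 | h1, h2⟩
            · exact h1
            · exact absurd h1 h2
          · rintro rfl; exact ⟨Or.inl rfl, hqr⟩
        rw [e4, sdiff_self, bot_eq_empty, prod_empty, prod_singleton, Function.update_self]
        unfold zz
        rw [prod_insert hqr]
        have h1 := hpk q hq
        have a1 : (q:ℝ) - k ≠ 0 := by linarith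
        have a3 : (q:ℝ) ≠ 0 := by linarith
        have e5 : (k:ℝ) / ((q:ℝ) - k) * (1 - 1 / kap k q) = -1 := by
          unfold kap
          field_simp
          ring
        linear_combination (∏ p ∈ r, (k:ℝ) / ((p:ℝ) - k)) * yy l R (insert q r) * e5
      · simp [zz]
    · intro S hS hS'
      rw [mem_filter] at hS hS'
      have : ¬ S ⊆ insert q r := fun h => hS' ⟨hS.1, hS.2, h⟩
      rw [not_subset] at this
      obtain ⟨p, hp, hp'⟩ := this
      rw [mem_insert, not_or] at hp'
      rw [prod_eq_zero (mem_sdiff.2 ⟨hp, hp'.2⟩), mul_zero]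
      rw [Function.update_of_ne hp'.1, div_self (hκ0 p ((mem_DD.1 hS.1).1 hp)), sub_self]
  rw [e3, mul_pow, e2, one_mul, e1, mul_pow, ← mul_assoc]
  have e6 : (∏ p ∈ r, ((p:ℝ) - k) / k) * (∏ p ∈ r, (k:ℝ) / ((p:ℝ) - k)) ^ 2 = ∏ p ∈ r, (k:ℝ) / ((p:ℝ) - k) := by
    rw [← prod_pow, ← prod_mul_distrib]
    refine prod_congr rfl fun p hp => ?_
    have : (0:ℝ) < (p:ℝ) - k := by linarith [hpk p (hrP hp)]
    field_simp
  rw [e6, mul_comm]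
  refine mul_le_mul_of_nonneg_right ?_ hw
  have hpos1 : (1:ℝ) ≤ pr r := by exact_mod_cast pr_pos hPpos hrP
  have hpos : (0:ℝ) < pr r := by linarith
  have hLr : 0 ≤ Real.log (R / pr r) := Real.log_nonneg ((one_le_div hpos).2 hrD.2)
  have hLR : Real.log (R / pr r) ≤ Real.log R := by
    refine Real.log_le_log (by positivity) (div_le_self (by linarith) hpos1)
  have hq0 : (0:ℝ) < q := by exact_mod_cast hPpos q hq
  have hsplit : Real.log (R / pr (insert q r)) = Real.log (R / pr r) - Real.log q := by
    rw [pr_insert hqr, Nat.cast_mul, ← Real.log_div (by positivity) hq0.ne', div_div, mul_comm]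
  unfold yy
  split_ifs with hi
  · have hb : 0 ≤ Real.log (R / pr (insert q r)) := by
      refine Real.log_nonneg ((one_le_div ?_).2 (mem_DD.1 hi).2)
      exact_mod_cast pr_pos hPpos (mem_DD.1 hi).1
    have hba : Real.log (R / pr (insert q r)) ≤ Real.log (R / pr r) := by rw [hsplit]; linarith
    have := pow_diff_le l _ _ _ hb hba hLR hl
    have e7 : Real.log (R / pr r) - Real.log (R / pr (insert q r)) = Real.log q := by rw [hsplit]; ring
    rw [e7] at this
    exact pow_le_pow_left₀ (sub_nonneg.2 (pow_le_pow_left₀ hb hba _)) this 2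
  · rw [sub_zero]
    have hlt : Real.log (R / pr r) ≤ Real.log q := by
      have : ¬ ((pr (insert q r) : ℝ) ≤ R) := fun h => hi (mem_DD.2 ⟨insert_subset hq hrP, h⟩)
      rw [pr_insert hqr, Nat.cast_mul, not_le] at this
      refine Real.log_le_log (by positivity) ?_
      rw [div_le_iff₀ hpos]; exact this.le
    refine pow_le_pow_left₀ (pow_nonneg hLr _) ?_ 2
    obtain ⟨m, rfl⟩ : ∃ m, l = m + 1 := ⟨l - 1, by omega⟩
    rw [pow_succ, Nat.add_sub_cancel]
    have h1 : Real.log (R / pr r) ^ m ≤ Real.log R ^ m := pow_le_pow_left₀ hLr hLR _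
    have h2 : (1:ℝ) ≤ ((m+1:ℕ):ℝ) := by push_cast; linarith [Nat.cast_nonneg (α := ℝ) m]
    calc Real.log (R / pr r) ^ m * Real.log (R / pr r) ≤ Real.log R ^ m * Real.log q :=
          mul_le_mul h1 hlt hLr (pow_nonneg hlogR _)
      _ ≤ ((m+1:ℕ):ℝ) * (Real.log R ^ m * Real.log q) :=
          le_mul_of_one_le_left (mul_nonneg (pow_nonneg hlogR _) hlogq) h2
      _ = _ := by ring

theorem lamb_le (P : Finset ℕ) (k l : ℕ) (hk : 0 < k) (R : ℝ) (hR : 1 ≤ R)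
    (hP : ∀ p ∈ P, 2 * k < p) (D : Finset ℕ) (hD : D ∈ DD P R) :
    |lamb P k l R D| ≤ (Real.log R) ^ l * TT P k k 0 R * 2 ^ D.card := by
  have hPpos : ∀ p ∈ P, 0 < p := fun p hp => by have := hP p hp; omega
  have hPk : ∀ p ∈ P, k < p := fun p hp => by have := hP p hp; omega
  have hk0 : (0:ℝ) < k := by exact_mod_cast hk
  have hpk : ∀ p ∈ P, 2 * (k:ℝ) < p := fun p hp => by exact_mod_cast hP p hp
  have hDP := (mem_DD.1 hD).1
  have hlogR : 0 ≤ Real.log R := Real.log_nonneg hR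
  unfold lamb lam
  rw [sum_super P hPpos R D hDP, abs_mul]
  have h1 : |∑ A ∈ (DD P (R / pr D)).filter (fun A => Disjoint A D), zz k l R (A ∪ D)| ≤
      (∏ p ∈ D, (k:ℝ) / ((p:ℝ) - k)) * (Real.log R ^ l * TT P k k 0 R) := by
    refine (abs_sum_le_sum_abs _ _).trans ?_
    have hpos1 : (1:ℝ) ≤ pr D := by exact_mod_cast pr_pos hPpos hDP
    have h2 : ∀ A ∈ (DD P (R / pr D)).filter (fun A => Disjoint A D), |zz k l R (A ∪ D)| ≤
        (∏ p ∈ D, (k:ℝ) / ((p:ℝ) - k)) * (Real.log R ^ l * ∏ p ∈ A, (k:ℝ) / ((p:ℝ) - k)) := by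
      intro A hA
      rw [mem_filter, mem_DD] at hA
      have hAD : A ∪ D ∈ DD P R := by
        rw [mem_DD]
        refine ⟨union_subset hA.1.1 hDP, ?_⟩
        rw [pr_union hA.2, Nat.cast_mul]
        exact (le_div_iff₀ (by linarith)).1 hA.1.2
      have nn := TT_term_nonneg (j := k) (a := l) hPk _ hAD
      unfold zz yy
      rw [abs_of_nonneg (mul_nonneg nn.1 nn.2), prod_union hA.2]
      rw [prod_union hA.2] at nn
      have hposU : (1:ℝ) ≤ pr (A ∪ D) := by exact_mod_cast pr_pos hPpos (mem_DD.1 hAD).1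
      have : Real.log (R / pr (A ∪ D)) ^ l ≤ Real.log R ^ l := by
        refine pow_le_pow_left₀ (Real.log_nonneg ?_) (Real.log_le_log ?_ (div_le_self (by linarith) hposU)) _
        · exact (one_le_div (by linarith)).2 (mem_DD.1 hAD).2
        · have : (0:ℝ) < pr (A ∪ D) := by linarith
          positivity
      refine (mul_le_mul_of_nonneg_left this nn.1).trans (le_of_eq (by ring))
    refine (sum_le_sum h2).trans ?_
    rw [← mul_sum, ← mul_sum]
    refine mul_le_mul_of_nonneg_left (mul_le_mul_of_nonneg_left ?_ (pow_nonneg hlogR _)) ?_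
    · unfold TT
      simp only [pow_zero, mul_one]
      refine sum_le_sum_of_subset_of_nonneg ((filter_subset _ _).trans (DD_mono (div_le_self (by linarith) hpos1))) ?_
      intro A hA _
      exact (TT_term_nonneg (a := 0) hPk A hA).1
    · exact (TT_term_nonneg (a := 0) hPk D hD).1
  refine (mul_le_mul_of_nonneg_left h1 (abs_nonneg _)).trans ?_
  rw [← mul_assoc, mul_comm]
  refine mul_le_mul_of_nonneg_left ?_ (mul_nonneg (pow_nonneg hlogR _) (TT_nonneg hPk))
  rw [abs_prod, ← prod_mul_distrib, ← prod_const]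
  refine prod_le_prod (fun p hp => ?_) fun p hp => ?_
  · exact mul_nonneg (abs_nonneg _) (div_nonneg hk0.le (by linarith [hpk p (hDP hp)]))
  · have a := hpk p (hDP hp)
    have a0 : (0:ℝ) < p := by linarith
    have a1 : (0:ℝ) < (p:ℝ) - k := by linarith
    rw [abs_neg, abs_of_pos (by unfold kap; positivity)]
    unfold kap
    have : 1 / ((k:ℝ) / p) * (k / ((p:ℝ) - k)) = p / ((p:ℝ) - k) := by field_simp
    rw [this, div_le_iff₀ a1]
    linarith

theorem lamb_empty (P : Finset ℕ) (k : ℕ) (R : ℝ) : lamb P k 0 R ∅ = TT P k k 0 R := by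
  unfold lamb lam TT zz yy
  simp

end GPY

namespace GPY

theorem crt_card (M p : ℕ) (hM : 0 < M) (hp : 0 < p) (hco : Nat.Coprime M p) (A B : Finset ℕ)
    (hA : A ⊆ range M) (hB : B ⊆ range p) :
    ((range (M * p)).filter (fun c => c % M ∈ A ∧ c % p ∈ B)).card = A.card * B.card := by
  rw [← card_product]
  refine card_bij (fun c _ => (c % M, c % p)) ?_ ?_ ?_
  · intro c hc
    rw [mem_filter] at hc
    exact mem_product.2 hc.2
  · intro c hc d hd h
    rw [mem_filter, mem_range] at hc hd
    rw [Prod.mk.injEq] at h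
    have := (Nat.modEq_and_modEq_iff_modEq_mul hco).1 h
    exact Nat.ModEq.eq_of_lt_of_lt this hc.1 hd.1
  · rintro ⟨a, b⟩ h
    rw [mem_product] at h
    have ha := mem_range.1 (hA h.1)
    have hb := mem_range.1 (hB h.2)
    obtain ⟨c, hc1, hc2⟩ := Nat.chineseRemainder hco a b
    have e1 : c % (M * p) % M = a := by
      rw [Nat.mod_mul_right_mod, hc1, Nat.mod_eq_of_lt ha]
    have e2 : c % (M * p) % p = b := by
      rw [Nat.mod_mul_left_mod, hc2, Nat.mod_eq_of_lt hb]
    refine ⟨c % (M * p), ?_, by rw [e1, e2]⟩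
    rw [mem_filter, mem_range, e1, e2]
    exact ⟨Nat.mod_lt _ (by positivity), h⟩

theorem dvd_tuplePoly {p : ℕ} (hp : p.Prime) (H : Finset ℕ) (n : ℕ) :
    p ∣ tuplePoly H n ↔ ∃ h ∈ H, p ∣ n + h := by
  unfold tuplePoly
  exact hp.prime.dvd_finsetProd_iff _

theorem dvd_tuplePoly_mod {p : ℕ} (H : Finset ℕ) (n m : ℕ) (h : n ≡ m [MOD p]) :
    p ∣ tuplePoly H n ↔ p ∣ tuplePoly H m := by
  have : tuplePoly H n ≡ tuplePoly H m [MOD p] := by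
    unfold tuplePoly
    exact Nat.ModEq.prod fun i _ => h.add_right i
  exact this.dvd_iff (dvd_refl p)

theorem root_card {p : ℕ} (hp : p.Prime) (H : Finset ℕ)
    (hH : ∀ h ∈ H, ∀ h' ∈ H, h % p = h' % p → h = h') :
    ((range p).filter (fun c => p ∣ tuplePoly H c)).card = H.card := by
  symm
  refine card_bij (fun h _ => (p - h % p) % p) ?_ ?_ ?_
  · intro h hh
    rw [mem_filter, mem_range]
    refine ⟨Nat.mod_lt _ hp.pos, ?_⟩
    rw [dvd_tuplePoly hp]
    refine ⟨h, hh, ?_⟩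
    have := Nat.mod_lt h hp.pos
    rw [Nat.dvd_iff_mod_eq_zero, Nat.add_mod, Nat.mod_mod, ← Nat.add_mod]
    have h2 : (p - h % p + h) % p = (p - h % p + h % p) % p := by
      rw [Nat.add_mod, Nat.add_mod (p - h % p) (h % p), Nat.mod_mod]
    rw [h2, Nat.sub_add_cancel this.le, Nat.mod_self]
  · intro h hh h' hh' e
    refine hH h hh h' hh' ?_
    have a1 := Nat.mod_lt h hp.pos
    have a2 := Nat.mod_lt h' hp.pos
    rcases Nat.eq_zero_or_pos (h % p) with b1 | b1 <;> rcases Nat.eq_zero_or_pos (h' % p) with b2 | b2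
    · rw [b1, b2]
    · rw [b1, Nat.sub_zero, Nat.mod_self, Nat.mod_eq_of_lt (by omega)] at e; omega
    · rw [b2, Nat.sub_zero, Nat.mod_self, Nat.mod_eq_of_lt (by omega)] at e; omega
    · have e1 : (p - h % p) % p = p - h % p := Nat.mod_eq_of_lt (by omega)
      have e2 : (p - h' % p) % p = p - h' % p := Nat.mod_eq_of_lt (by omega)
      simp only [e1, e2] at e
      omega
  · intro c hc
    rw [mem_filter, mem_range, dvd_tuplePoly hp] at hc
    obtain ⟨hc1, h, hh, hd⟩ := hc
    refine ⟨h, hh, ?_⟩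
    have a1 := Nat.mod_lt h hp.pos
    have hd2 : (c + h % p) % p = 0 := by
      rw [Nat.add_mod, Nat.mod_mod, ← Nat.add_mod]; exact Nat.mod_eq_zero_of_dvd hd
    have hd3 := Nat.dvd_of_mod_eq_zero hd2
    obtain ⟨t, ht⟩ := hd3
    have ht2 : t < 2 := by
      by_contra hcon
      have : p * 2 ≤ p * t := Nat.mul_le_mul_left _ (by omega)
      omega
    interval_cases t
    · have : h % p = 0 := by omega
      have : c = 0 := by omega
      simp [*]
    · rw [mul_one] at ht
      have : p - h % p = c := by omega
      rw [this, Nat.mod_eq_of_lt hc1]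

theorem res_set (m : ℕ) (hm : 0 < m) (b : ℕ) (H Q : Finset ℕ)
    (hQ : ∀ p ∈ Q, p.Prime ∧ ¬ p ∣ m ∧ (∀ h ∈ H, ∀ h' ∈ H, h % p = h' % p → h = h')) :
    ∃ C ⊆ range (m * pr Q), C.card = H.card ^ Q.card ∧
      ∀ n, (n % m = b % m ∧ ∀ p ∈ Q, p ∣ tuplePoly H n) ↔ n % (m * pr Q) ∈ C := by
  induction Q using Finset.induction_on with
  | empty =>
    refine ⟨{b % m}, ?_, by simp, ?_⟩
    · simp [Nat.mod_lt _ hm]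
    · intro n; simp
  | insert p Q hp ih =>
    obtain ⟨C, hC1, hC2, hC3⟩ := ih fun q hq => hQ q (mem_insert_of_mem hq)
    obtain ⟨hpp, hpm, hpH⟩ := hQ p (mem_insert_self _ _)
    have hQpos : 0 < pr Q := pr_pos (fun q hq => (hQ q (mem_insert_of_mem hq)).1.pos) (Subset.refl Q)
    have hco : Nat.Coprime (m * pr Q) p := by
      refine Nat.Coprime.symm ((Nat.Prime.coprime_iff_not_dvd hpp).2 ?_)
      intro hd
      rcases hpp.dvd_mul.1 hd with h | h
      · exact hpm h
      · obtain ⟨q, hq, hpq⟩ := (hpp.prime.dvd_finsetProd_iff _).1 h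
        have := (Nat.prime_dvd_prime_iff_eq hpp (hQ q (mem_insert_of_mem hq)).1).1 hpq
        exact hp (this ▸ hq)
    have hMpos : 0 < m * pr Q := by positivity
    have e : m * pr (insert p Q) = m * pr Q * p := by rw [pr_insert hp]; ring
    set S := (range p).filter (fun c => p ∣ tuplePoly H c) with hS
    refine ⟨(range (m * pr Q * p)).filter (fun c => c % (m * pr Q) ∈ C ∧ c % p ∈ S), ?_, ?_, ?_⟩
    · rw [e]; exact filter_subset _ _
    · rw [crt_card _ p hMpos hpp.pos hco C S hC1 (filter_subset _ _), hC2, root_card hpp H hpH, card_insert_of_notMem hp, pow_succ]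
    · intro n
      rw [e, mem_filter, mem_range, Nat.mod_mul_right_mod, Nat.mod_mul_left_mod, ← hC3 n]
      have h1 : n % p ∈ S ↔ p ∣ tuplePoly H n := by
        rw [hS, mem_filter, mem_range, dvd_tuplePoly_mod H (n % p) n (Nat.mod_modEq n p)]
        exact ⟨fun h => h.2, fun h => ⟨Nat.mod_lt _ hpp.pos, h⟩⟩
      rw [h1]
      have h2 : n % (m * pr Q * p) < m * pr Q * p := Nat.mod_lt _ (by have := hpp.pos; positivity)
      simp only [mem_insert, forall_eq_or_imp]
      tauto

theorem count_class (N m c : ℕ) (hm : 0 < m) :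
    |(((Ioc N (2*N)).filter (fun n => n % m = c % m)).card : ℝ) - (N:ℝ) / m| ≤ 1 := by
  have h := Nat.Ioc_filter_modEq_card N (2*N) hm c
  have e : ((Ioc N (2*N)).filter (fun n => n ≡ c [MOD m])) = ((Ioc N (2*N)).filter (fun n => n % m = c % m)) := rfl
  rw [e] at h
  have hmq : (0:ℚ) < m := by exact_mod_cast hm
  set u : ℚ := (((2*N:ℕ):ℚ) - c) / m with hu
  set v : ℚ := ((N:ℚ) - c) / m with hv
  have huv : u - v = (N:ℚ) / m := by rw [hu, hv]; push_cast; field_simp; ring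
  have h0 : (0:ℚ) ≤ (N:ℚ) / m := by positivity
  have hle : ⌊v⌋ ≤ ⌊u⌋ := Int.floor_le_floor (by linarith)
  rw [max_eq_left (by omega)] at h
  have h2 : ((((Ioc N (2*N)).filter (fun n => n % m = c % m)).card : ℤ) : ℚ) = (⌊u⌋ : ℚ) - ⌊v⌋ := by
    rw [h]; push_cast; rfl
  have a1 := Int.floor_le u
  have a2 := Int.lt_floor_add_one u
  have a3 := Int.floor_le v
  have a4 := Int.lt_floor_add_one v
  have key : |((((Ioc N (2*N)).filter (fun n => n % m = c % m)).card : ℤ) : ℚ) - (N:ℚ) / m| ≤ 1 := by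
    rw [h2, abs_le]; constructor <;> linarith
  have key2 : ((|((((Ioc N (2*N)).filter (fun n => n % m = c % m)).card : ℤ) : ℚ) - (N:ℚ) / m| : ℚ) : ℝ) ≤ 1 := by
    exact_mod_cast key
  push_cast at key2
  exact key2

end GPY

namespace GPY

noncomputable def Lam (P : Finset ℕ) (k l : ℕ) (R : ℝ) (H : Finset ℕ) (n : ℕ) : ℝ :=
  ∑ D ∈ (DD P R).filter (fun D => ∀ p ∈ D, p ∣ tuplePoly H n), lamb P k l R D

theorem sq_expand (P : Finset ℕ) (k l : ℕ) (R : ℝ) (H S : Finset ℕ) (f : ℕ → ℝ) :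
    ∑ n ∈ S, f n * (Lam P k l R H n) ^ 2 =
    ∑ D ∈ DD P R, ∑ E ∈ DD P R, lamb P k l R D * lamb P k l R E *
      ∑ n ∈ S.filter (fun n => ∀ p ∈ D ∪ E, p ∣ tuplePoly H n), f n := by
  have h1 : ∀ n, f n * (Lam P k l R H n) ^ 2 = ∑ D ∈ DD P R, ∑ E ∈ DD P R,
      lamb P k l R D * lamb P k l R E * (if (∀ p ∈ D ∪ E, p ∣ tuplePoly H n) then f n else 0) := by
    intro n
    unfold Lam
    rw [sq, sum_filter, sum_mul_sum, mul_sum]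
    refine sum_congr rfl fun D _ => ?_
    rw [mul_sum]
    refine sum_congr rfl fun E _ => ?_
    by_cases hD : ∀ p ∈ D, p ∣ tuplePoly H n
    · by_cases hE : ∀ p ∈ E, p ∣ tuplePoly H n
      · have : ∀ p ∈ D ∪ E, p ∣ tuplePoly H n := by
          intro p hp; rcases mem_union.1 hp with h | h
          · exact hD p h
          · exact hE p h
        rw [if_pos hD, if_pos hE, if_pos this]; ring
      · have : ¬ ∀ p ∈ D ∪ E, p ∣ tuplePoly H n :=
          fun h => hE fun p hp => h p (mem_union_right _ hp)
        rw [if_neg hE, if_neg this]; ring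
    · have : ¬ ∀ p ∈ D ∪ E, p ∣ tuplePoly H n :=
          fun h => hD fun p hp => h p (mem_union_left _ hp)
      rw [if_neg hD, if_neg this]; ring
  simp_rw [h1]
  rw [sum_comm]
  refine sum_congr rfl fun D _ => ?_
  rw [sum_comm]
  refine sum_congr rfl fun E _ => ?_
  rw [← mul_sum, sum_filter]

theorem union_mem_DD {P D E : Finset ℕ} (hP : ∀ p ∈ P, 0 < p) {R : ℝ} (hD : D ∈ DD P R) (hE : E ∈ DD P R) :
    D ∪ E ∈ DD P (R ^ 2) := by
  rw [mem_DD] at *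
  refine ⟨union_subset hD.1 hE.1, ?_⟩
  have h1 : pr (D ∪ E) ∣ pr D * pr E := by
    have : D ∪ E = D ∪ (E \ D) := by rw [union_sdiff_self_eq_union]
    rw [this, pr_union disjoint_sdiff]
    exact mul_dvd_mul_left _ (prod_dvd_prod_of_subset _ _ _ sdiff_subset)
  have hp : 0 < pr D * pr E := Nat.mul_pos (pr_pos hP hD.1) (pr_pos hP hE.1)
  have h2 : ((pr (D ∪ E) : ℕ) : ℝ) ≤ pr D * pr E := by exact_mod_cast Nat.le_of_dvd hp h1
  have h3 : (0:ℝ) ≤ pr E := by positivity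
  nlinarith [hD.2, hE.2, (by positivity : (0:ℝ) ≤ pr D)]

theorem approx (P : Finset ℕ) (k l : ℕ) (hk : 0 < k) (R : ℝ) (hR : 1 ≤ R) (hP : ∀ p ∈ P, 2 * k < p)
    (H S : Finset ℕ) (f : ℕ → ℝ) (X : ℝ) (κ : ℕ → ℝ) (F : Finset ℕ → ℝ)
    (hF : ∀ Q ∈ DD P (R^2), |∑ n ∈ S.filter (fun n => ∀ p ∈ Q, p ∣ tuplePoly H n), f n - X * ∏ p ∈ Q, κ p| ≤ F Q) :
    |∑ n ∈ S, f n * (Lam P k l R H n) ^ 2 - X * QQ P k l R κ| ≤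
      ((Real.log R) ^ l * TT P k k 0 R) ^ 2 * ∑ Q ∈ DD P (R^2), 9 ^ Q.card * F Q := by
  set L := (Real.log R) ^ l * TT P k k 0 R with hL
  have hPpos : ∀ p ∈ P, 0 < p := fun p hp => by have := hP p hp; omega
  have hL0 : 0 ≤ L := mul_nonneg (pow_nonneg (Real.log_nonneg hR) _)
    (TT_nonneg fun p hp => by have := hP p hp; omega)
  rw [sq_expand, QQ, mul_sum, ← sum_sub_distrib]
  simp_rw [mul_sum]
  have hF0 : ∀ Q ∈ DD P (R^2), 0 ≤ F Q := fun Q hQ => (abs_nonneg _).trans (hF Q hQ)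
  have step1 : |∑ D ∈ DD P R, ((∑ E ∈ DD P R, lamb P k l R D * lamb P k l R E *
      ∑ n ∈ S.filter (fun n => ∀ p ∈ D ∪ E, p ∣ tuplePoly H n), f n) -
      ∑ E ∈ DD P R, X * (lamb P k l R D * lamb P k l R E * ∏ p ∈ D ∪ E, κ p))| ≤
      ∑ D ∈ DD P R, ∑ E ∈ DD P R, L ^ 2 * (2 ^ D.card * 2 ^ E.card * F (D ∪ E)) := by
    refine (abs_sum_le_sum_abs _ _).trans (sum_le_sum fun D hD => ?_)
    rw [← sum_sub_distrib]
    refine (abs_sum_le_sum_abs _ _).trans (sum_le_sum fun E hE => ?_)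
    have e : lamb P k l R D * lamb P k l R E *
      ∑ n ∈ S.filter (fun n => ∀ p ∈ D ∪ E, p ∣ tuplePoly H n), f n - X * (lamb P k l R D * lamb P k l R E * ∏ p ∈ D ∪ E, κ p)
      = lamb P k l R D * lamb P k l R E * (∑ n ∈ S.filter (fun n => ∀ p ∈ D ∪ E, p ∣ tuplePoly H n), f n - X * ∏ p ∈ D ∪ E, κ p) := by ring
    rw [e, abs_mul, abs_mul]
    have b1 := lamb_le P k l hk R hR hP D hD
    have b2 := lamb_le P k l hk R hR hP E hE
    have b3 := hF _ (union_mem_DD hPpos hD hE)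
    calc _ ≤ (L * 2 ^ D.card) * (L * 2 ^ E.card) * F (D ∪ E) := by
          refine mul_le_mul (mul_le_mul b1 b2 (abs_nonneg _) (by positivity)) b3 (abs_nonneg _) (by positivity)
      _ = _ := by ring
  simp_rw [mul_sum] at step1
  refine step1.trans ?_
  simp_rw [← mul_sum]
  refine mul_le_mul_of_nonneg_left ?_ (by positivity)
  rw [← sum_product']
  rw [← sum_fiberwise_of_maps_to (t := DD P (R^2)) (g := fun x : Finset ℕ × Finset ℕ => x.1 ∪ x.2)]
  swap
  · intro x hx
    rw [mem_product] at hx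
    exact union_mem_DD hPpos hx.1 hx.2
  refine sum_le_sum fun Q hQ => ?_
  calc _ ≤ ∑ x ∈ Q.powerset ×ˢ Q.powerset, 2 ^ x.1.card * 2 ^ x.2.card * F Q := by
        have : ∀ x ∈ (DD P R ×ˢ DD P R).filter (fun x : Finset ℕ × Finset ℕ => x.1 ∪ x.2 = Q),
            (2:ℝ) ^ x.1.card * 2 ^ x.2.card * F (x.1 ∪ x.2) = 2 ^ x.1.card * 2 ^ x.2.card * F Q := by
          intro x hx; rw [(mem_filter.1 hx).2]
        rw [sum_congr rfl this]
        refine sum_le_sum_of_subset_of_nonneg ?_ ?_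
        · intro x hx
          have := (mem_filter.1 hx).2
          rw [mem_product, mem_powerset, mem_powerset, ← this]
          exact ⟨subset_union_left, subset_union_right⟩
        · intro x _ _
          have := hF0 Q hQ
          positivity
    _ = _ := by
        rw [← sum_mul, sum_product]
        simp_rw [← mul_sum]
        rw [← sum_mul]
        have h3 : ∑ i ∈ Q.powerset, (2:ℝ) ^ i.card = 3 ^ Q.card := by
          have := Finset.sum_pow_mul_eq_add_pow (2:ℝ) 1 Q
          simp only [one_pow, mul_one] at this
          rw [this]; norm_num
        rw [h3, ← mul_pow]; norm_num

theorem inj_pr {P : Finset ℕ} (hP : ∀ p ∈ P, p.Prime) {D E : Finset ℕ} (hD : D ⊆ P) (hE : E ⊆ P) (h : pr D = pr E) : D = E := by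
  have key : ∀ A ⊆ P, (pr A).primeFactors = A := by
    intro A hA
    exact Nat.primeFactors_prod fun p hp => hP p (hA hp)
  rw [← key D hD, ← key E hE, h]

theorem sum_inv_pr_le (P : Finset ℕ) (hP : ∀ p ∈ P, p.Prime) (x : ℝ) (hx : 1 ≤ x) :
    ∑ D ∈ DD P x, ∏ p ∈ D, 1 / (p:ℝ) ≤ 1 + Real.log x := by
  refine le_trans ?_ (sum_le_log hx)
  have e : ∀ D ∈ DD P x, ∏ p ∈ D, 1 / (p:ℝ) = 1 / ((pr D : ℕ) : ℝ) := by
    intro D _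
    unfold pr; push_cast; rw [prod_div_distrib, prod_const_one]
  rw [sum_congr rfl e, ← sum_image (g := pr) (f := fun n : ℕ => 1 / (n:ℝ))]
  · refine sum_le_sum_of_subset_of_nonneg ?_ fun _ _ _ => by positivity
    intro n hn
    obtain ⟨D, hD, rfl⟩ := mem_image.1 hn
    rw [mem_DD] at hD
    rw [mem_Icc]
    exact ⟨pr_pos (fun p hp => (hP p hp).pos) hD.1, Nat.le_floor hD.2⟩
  · intro D hD E hE h
    exact inj_pr hP (mem_DD.1 hD).1 (mem_DD.1 hE).1 h

theorem sum_pow_inv_le (P : Finset ℕ) (hP : ∀ p ∈ P, p.Prime) (x : ℝ) (hx : 1 ≤ x) (j : ℕ) :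
    ∑ D ∈ DD P x, (j:ℝ) ^ D.card / pr D ≤ (1 + Real.log x) ^ j := by
  have h := sum_pow_le P (fun p hp => (hP p hp).pos) x hx (fun p => 1 / (p:ℝ)) (fun p _ => by positivity) j
  have h0 : 0 ≤ ∑ D ∈ DD P x, ∏ p ∈ D, 1 / (p:ℝ) := sum_nonneg fun D _ => prod_nonneg fun p _ => by positivity
  have h2 := pow_le_pow_left₀ h0 (sum_inv_pr_le P hP x hx) j
  refine le_trans (le_of_eq ?_) (h.trans h2)
  refine sum_congr rfl fun D _ => ?_
  rw [prod_mul_distrib, prod_const, prod_div_distrib, prod_const_one]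
  unfold pr; push_cast; ring

theorem rankin (P : Finset ℕ) (hP : ∀ p ∈ P, p.Prime) (x : ℝ) (hx : 1 ≤ x) (j : ℕ) :
    ∑ D ∈ DD P x, (j:ℝ) ^ D.card ≤ x * (1 + Real.log x) ^ j := by
  refine le_trans ?_ (mul_le_mul_of_nonneg_left (sum_pow_inv_le P hP x hx j) (by linarith))
  rw [mul_sum]
  refine sum_le_sum fun D hD => ?_
  rw [mem_DD] at hD
  have : (0:ℝ) < pr D := by exact_mod_cast pr_pos (fun p hp => (hP p hp).pos) hD.1
  rw [mul_div_assoc', le_div_iff₀ this]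
  nlinarith [hD.2, pow_nonneg (Nat.cast_nonneg (α := ℝ) j) D.card]

end GPY

namespace GPY

theorem sum_res (S C : Finset ℕ) (M : ℕ) (f : ℕ → ℝ) :
    ∑ n ∈ S.filter (fun n => n % M ∈ C), f n = ∑ c ∈ C, ∑ n ∈ S.filter (fun n => n % M = c), f n := by
  rw [← sum_fiberwise_of_maps_to (s := S.filter (fun n => n % M ∈ C)) (t := C) (g := fun n => n % M)]
  · refine sum_congr rfl fun c hc => sum_congr ?_ fun _ _ => rfl
    ext n; simp only [mem_filter]
    constructor
    · rintro ⟨⟨h1, h2⟩, h3⟩; exact ⟨h1, h3⟩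
    · rintro ⟨h1, h3⟩; exact ⟨⟨h1, h3 ▸ hc⟩, h3⟩
  · intro n hn; exact (mem_filter.1 hn).2

noncomputable def kapm (k m : ℕ) (p : ℕ) : ℝ := if p ∣ m then 1 else (k:ℝ) / p

theorem cnt (k : ℕ) (hk : 0 < k) (H : Finset ℕ) (hH : H.card = k) (N m b : ℕ) (hm : 0 < m) (Q : Finset ℕ)
    (hQ : ∀ p ∈ Q, p.Prime ∧ (∀ h ∈ H, ∀ h' ∈ H, h % p = h' % p → h = h'))
    (hb : ∀ p ∈ Q, p ∣ m → p ∣ tuplePoly H b) :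
    |∑ n ∈ ((Ioc N (2*N)).filter (fun n => n % m = b % m)).filter (fun n => ∀ p ∈ Q, p ∣ tuplePoly H n), (1:ℝ)
      - (N:ℝ) / m * ∏ p ∈ Q, kapm k m p| ≤ (k:ℝ) ^ Q.card := by
  set Q2 := Q.filter (fun p => ¬ p ∣ m) with hQ2
  obtain ⟨C, hC1, hC2, hC3⟩ := res_set m hm b H Q2 (fun p hp => by
    rw [hQ2, mem_filter] at hp; exact ⟨(hQ p hp.1).1, hp.2, (hQ p hp.1).2⟩)
  have hpos : 0 < m * pr Q2 := Nat.mul_pos hm (pr_pos (fun p hp => (hQ p (mem_filter.1 hp).1).1.pos) (Subset.refl Q2))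
  have e1 : ((Ioc N (2*N)).filter (fun n => n % m = b % m)).filter (fun n => ∀ p ∈ Q, p ∣ tuplePoly H n)
      = (Ioc N (2*N)).filter (fun n => n % (m * pr Q2) ∈ C) := by
    rw [filter_filter]
    refine filter_congr fun n _ => ?_
    rw [← hC3 n]
    refine and_congr_right fun hn => ?_
    constructor
    · intro h p hp; exact h p (mem_filter.1 hp).1
    · intro h p hp
      by_cases hpm : p ∣ m
      · rw [dvd_tuplePoly_mod H n b (Nat.ModEq.of_dvd hpm hn)]
        exact hb p hp hpm
      · exact h p (mem_filter.2 ⟨hp, hpm⟩)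
  have e2 : (N:ℝ) / m * ∏ p ∈ Q, kapm k m p = ∑ c ∈ C, (N:ℝ) / ((m * pr Q2 : ℕ) : ℝ) := by
    rw [sum_const, hC2, nsmul_eq_mul, ← prod_filter_mul_prod_filter_not Q (fun p => ¬ p ∣ m), ← hQ2, hH]
    have a1 : ∏ p ∈ Q2, kapm k m p = (k:ℝ) ^ Q2.card / pr Q2 := by
      rw [pr]; push_cast
      rw [← prod_const, ← prod_div_distrib]
      refine prod_congr rfl fun p hp => ?_
      rw [kapm, if_neg (mem_filter.1 hp).2]
    have a2 : ∏ p ∈ Q.filter (fun p => ¬ ¬ p ∣ m), kapm k m p = 1 := by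
      refine prod_eq_one fun p hp => ?_
      rw [kapm, if_pos (not_not.1 (mem_filter.1 hp).2)]
    rw [a1, a2]
    push_cast
    have : (m:ℝ) ≠ 0 := by positivity
    have : (pr Q2:ℝ) ≠ 0 := by
      have : 0 < pr Q2 := Nat.pos_of_mul_pos_left hpos
      positivity
    field_simp
  rw [e1, sum_res, e2, ← sum_sub_distrib]
  calc _ ≤ ∑ c ∈ C, (1:ℝ) := by
        refine (abs_sum_le_sum_abs _ _).trans (sum_le_sum fun c hc => ?_)
        have h1 := count_class N (m * pr Q2) c hpos
        have h2 : c % (m * pr Q2) = c := Nat.mod_eq_of_lt (mem_range.1 (hC1 hc))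
        rw [h2] at h1
        rw [sum_const, nsmul_eq_mul, mul_one]
        exact h1
    _ = (k:ℝ) ^ Q2.card := by rw [sum_const, hC2, hH, nsmul_eq_mul, mul_one]; push_cast; rfl
    _ ≤ _ := pow_le_pow_right₀ (by exact_mod_cast hk) (card_le_card (filter_subset _ _))

theorem S1_asym (P : Finset ℕ) (k l : ℕ) (hk : 0 < k) (R : ℝ) (hR : 1 ≤ R)
    (hP : ∀ p ∈ P, p.Prime ∧ 2 * k < p)
    (H : Finset ℕ) (hH : H.card = k)
    (hPH : ∀ p ∈ P, ∀ h ∈ H, ∀ h' ∈ H, h % p = h' % p → h = h') (N m b : ℕ) (hm : 0 < m)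
    (hb : ∀ p ∈ P, p ∣ m → p ∣ tuplePoly H b) :
    |∑ n ∈ (Ioc N (2*N)).filter (fun n => n % m = b % m), (Lam P k l R H n) ^ 2
      - (N:ℝ) / m * QQ P k l R (kapm k m)| ≤
     ((Real.log R) ^ l * TT P k k 0 R) ^ 2 * (R^2 * (1 + Real.log (R^2)) ^ (9 * k)) := by
  have h := approx P k l hk R hR (fun p hp => (hP p hp).2) H ((Ioc N (2*N)).filter (fun n => n % m = b % m))
    (fun _ => 1) ((N:ℝ) / m) (kapm k m) (fun Q => (k:ℝ) ^ Q.card) (by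
      intro Q hQ
      rw [mem_DD] at hQ
      exact cnt k hk H hH N m b hm Q (fun p hp => ⟨(hP p (hQ.1 hp)).1, hPH p (hQ.1 hp)⟩) (fun p hp => hb p (hQ.1 hp)))
  simp only [one_mul] at h
  refine h.trans (mul_le_mul_of_nonneg_left ?_ (sq_nonneg _))
  have h2 := rankin P (fun p hp => (hP p hp).1) (R^2) (by nlinarith) (9 * k)
  refine le_trans (le_of_eq ?_) h2
  refine sum_congr rfl fun Q _ => ?_
  push_cast; rw [mul_pow]

theorem exists_astar (x : ℕ) : ∃ a : ℕ → ℕ, (∀ q, Nat.Coprime (a q) q) ∧ ∀ q b, Nat.Coprime b q →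
    |primeSumAP x q b - (x:ℝ) / (Nat.totient q)| ≤ |primeSumAP x q (a q) - (x:ℝ) / (Nat.totient q)| := by
  have : ∀ q, ∃ a, Nat.Coprime a q ∧ ∀ b, Nat.Coprime b q →
    |primeSumAP x q b - (x:ℝ) / (Nat.totient q)| ≤ |primeSumAP x q a - (x:ℝ) / (Nat.totient q)| := by
    intro q
    rcases Nat.eq_zero_or_pos q with rfl | hq
    · refine ⟨1, by simp, ?_⟩
      intro b hb
      rw [Nat.coprime_zero_right] at hb
      rw [hb]
    · have hne : ((range q).filter (fun a => Nat.Coprime a q)).Nonempty := by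
        refine ⟨1 % q, ?_⟩
        rw [mem_filter, mem_range]
        refine ⟨Nat.mod_lt _ hq, ?_⟩
        rw [Nat.Coprime, ← Nat.gcd_rec]
        simp
      obtain ⟨a, ha, hmax⟩ := exists_max_image _ (fun a => |primeSumAP x q a - (x:ℝ) / (Nat.totient q)|) hne
      refine ⟨a, (mem_filter.1 ha).2, ?_⟩
      intro b hb
      have h1 := hmax (b % q) (by
        rw [mem_filter, mem_range]
        refine ⟨Nat.mod_lt _ hq, ?_⟩
        rw [Nat.Coprime, ← Nat.gcd_rec]; exact hb.symm)
      have h2 : primeSumAP x q (b % q) = primeSumAP x q b := by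
        unfold primeSumAP; simp only [Nat.mod_mod]
      rw [h2] at h1
      exact h1
  choose a ha using this
  exact ⟨a, fun q => (ha q).1, fun q => (ha q).2⟩

noncomputable def astar (x : ℕ) : ℕ → ℕ := (exists_astar x).choose

noncomputable def Est (x q : ℕ) : ℝ := |primeSumAP x q (astar x q) - (x:ℝ) / (Nat.totient q)|

theorem astar_coprime (x q : ℕ) : Nat.Coprime (astar x q) q := (exists_astar x).choose_spec.1 q

theorem Est_ge (x q b : ℕ) (hb : Nat.Coprime b q) : |primeSumAP x q b - (x:ℝ) / (Nat.totient q)| ≤ Est x q :=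
  (exists_astar x).choose_spec.2 q b hb

theorem Est_nonneg (x q : ℕ) : 0 ≤ Est x q := abs_nonneg _

theorem theta_sum (N q c h : ℕ) : ∑ n ∈ (Ioc N (2*N)).filter (fun n => n % q = c % q), theta (n + h)
    = primeSumAP (2*N+h) q (c+h) - primeSumAP (N+h) q (c+h) := by
  unfold primeSumAP theta
  rw [eq_sub_iff_add_eq]
  have hs : (range (N + h + 1)).filter (fun p => p.Prime ∧ p % q = (c+h) % q) ⊆ (range (2*N + h + 1)).filter (fun p => p.Prime ∧ p % q = (c+h) % q) := by
    refine filter_subset_filter _ ?_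
    rw [range_subset_range]; omega
  rw [← sum_sdiff hs]
  congr 1
  rw [← sum_filter]
  refine sum_nbij' (fun n => n + h) (fun p => p - h) ?_ ?_ ?_ ?_ ?_
  · intro n hn
    simp only [mem_filter, mem_Ioc, mem_sdiff, mem_range] at hn ⊢
    have : (n + h) % q = (c + h) % q := Nat.ModEq.add_right h hn.1.2
    refine ⟨⟨by omega, hn.2, this⟩, ?_⟩
    rintro ⟨h1, -⟩; omega
  · intro p hp
    simp only [mem_filter, mem_Ioc, mem_sdiff, mem_range] at hp ⊢
    have hlt : ¬ p < N + h + 1 := fun h' => hp.2 ⟨h', hp.1.2⟩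
    have e : p - h + h = p := by omega
    refine ⟨⟨by omega, ?_⟩, by rw [e]; exact hp.1.2.1⟩
    have : (p - h) + h ≡ c + h [MOD q] := by rw [e]; exact hp.1.2.2
    exact Nat.ModEq.add_right_cancel' h this
  · intro n hn; simp
  · intro p hp
    simp only [mem_filter, mem_sdiff, mem_range] at hp
    have hlt : ¬ p < N + h + 1 := fun h' => hp.2 ⟨h', hp.1.2⟩
    show p - h + h = p
    omega
  · intro n hn; rfl

end GPY

namespace GPY

theorem totient_pr (Q : Finset ℕ) (hQ : ∀ p ∈ Q, p.Prime) (W : ℕ) (hW : ∀ p ∈ Q, ¬ p ∣ W) :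
    (Nat.totient (W * pr Q) : ℝ) = Nat.totient W * ∏ p ∈ Q, ((p:ℝ) - 1) := by
  induction Q using Finset.induction_on with
  | empty => simp
  | insert p Q hp ih =>
    have hpp := hQ p (mem_insert_self _ _)
    have h1 := ih (fun q hq => hQ q (mem_insert_of_mem hq)) (fun q hq => hW q (mem_insert_of_mem hq))
    have hco : Nat.Coprime (W * pr Q) p := by
      refine Nat.Coprime.symm ((Nat.Prime.coprime_iff_not_dvd hpp).2 ?_)
      intro hd
      rcases hpp.dvd_mul.1 hd with h | h
      · exact hW p (mem_insert_self _ _) h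
      · obtain ⟨q, hq, hpq⟩ := (hpp.prime.dvd_finsetProd_iff _).1 h
        have := (Nat.prime_dvd_prime_iff_eq hpp (hQ q (mem_insert_of_mem hq))).1 hpq
        exact hp (this ▸ hq)
    rw [pr_insert hp, show W * (p * pr Q) = (W * pr Q) * p by ring, Nat.totient_mul hco, Nat.cast_mul, h1,
      Nat.totient_prime hpp, prod_insert hp, Nat.cast_sub hpp.one_le]
    push_cast; ring

theorem cnt2 (k : ℕ) (hk : 2 ≤ k) (H : Finset ℕ) (hH : H.card = k) (N W : ℕ) (hW : 0 < W) (Q : Finset ℕ)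
    (hQ : ∀ p ∈ Q, p.Prime ∧ (∀ h ∈ H, ∀ h' ∈ H, h % p = h' % p → h = h'))
    (hQW : ∀ p ∈ Q, ¬ p ∣ W ∧ p ≤ N) (hWH : ∀ h ∈ H, W ∣ h) (h : ℕ) (hh : h ∈ H) :
    |∑ n ∈ ((Ioc N (2*N)).filter (fun n => n % W = 1 % W)).filter (fun n => ∀ p ∈ Q, p ∣ tuplePoly H n), theta (n + h)
      - (N:ℝ) / (Nat.totient W) * ∏ p ∈ Q, (((k:ℝ) - 1) / ((p:ℝ) - 1))| ≤
      (k:ℝ) ^ Q.card * (Est (2*N+h) (W * pr Q) + Est (N+h) (W * pr Q)) := by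
  have hcard : (H.erase h).card = k - 1 := by rw [card_erase_of_mem hh, hH]
  have hk1 : ((k - 1 : ℕ) : ℝ) = (k:ℝ) - 1 := by rw [Nat.cast_sub (by omega)]; simp
  obtain ⟨C, hC1, hC2, hC3⟩ := res_set W hW 1 (H.erase h) Q (fun p hp =>
    ⟨(hQ p hp).1, (hQW p hp).1, fun a ha b hb => (hQ p hp).2 a (mem_of_mem_erase ha) b (mem_of_mem_erase hb)⟩)
  set M := W * pr Q with hM
  have e1 : ∑ n ∈ ((Ioc N (2*N)).filter (fun n => n % W = 1 % W)).filter (fun n => ∀ p ∈ Q, p ∣ tuplePoly H n), theta (n + h)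
     = ∑ n ∈ (Ioc N (2*N)).filter (fun n => n % M ∈ C), theta (n + h) := by
    rw [filter_filter, sum_filter, sum_filter]
    refine sum_congr rfl fun n hn => ?_
    rw [mem_Ioc] at hn
    by_cases hpr : (n + h).Prime
    · refine if_congr ?_ rfl rfl
      rw [← hC3 n]
      refine and_congr_right fun _ => ?_
      refine forall₂_congr fun p hp => ?_
      rw [dvd_tuplePoly (hQ p hp).1, dvd_tuplePoly (hQ p hp).1]
      constructor
      · rintro ⟨a, ha, hd⟩
        refine ⟨a, mem_erase.2 ⟨?_, ha⟩, hd⟩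
        rintro rfl
        have := (Nat.prime_dvd_prime_iff_eq (hQ p hp).1 hpr).1 hd
        have := (hQW p hp).2
        omega
      · rintro ⟨a, ha, hd⟩
        exact ⟨a, mem_of_mem_erase ha, hd⟩
    · have : theta (n + h) = 0 := by rw [theta, if_neg hpr]
      rw [this]; simp
  have e2 : (N:ℝ) / (Nat.totient W) * ∏ p ∈ Q, (((k:ℝ) - 1) / ((p:ℝ) - 1)) = ∑ c ∈ C, (N:ℝ) / (Nat.totient M) := by
    rw [sum_const, hC2, nsmul_eq_mul, hcard, hM, totient_pr Q (fun p hp => (hQ p hp).1) W (fun p hp => (hQW p hp).1),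
      prod_div_distrib, prod_const]
    push_cast
    rw [hk1, div_mul_div_comm, mul_div_assoc', mul_comm]
  rw [e1, sum_res, e2, ← sum_sub_distrib]
  calc _ ≤ ∑ c ∈ C, (Est (2*N+h) M + Est (N+h) M) := by
        refine (abs_sum_le_sum_abs _ _).trans (sum_le_sum fun c hc => ?_)
        have h2 : c % M = c := Nat.mod_eq_of_lt (mem_range.1 (hC1 hc))
        have h1 := theta_sum N M c h
        rw [h2] at h1
        rw [h1]
        have hc' := (hC3 c).2 (by rw [h2]; exact hc)
        have hco : Nat.Coprime (c + h) M := by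
          rw [hM]
          refine Nat.Coprime.mul_right ?_ ?_
          · have : c + h ≡ 1 [MOD W] := by
              have h5 : c ≡ 1 [MOD W] := hc'.1
              have h6 : h ≡ 0 [MOD W] := (Nat.modEq_zero_iff_dvd).2 (hWH h hh)
              exact h5.add h6
            have := this.gcd_eq
            rw [Nat.Coprime, this, Nat.gcd_one_left]
          · rw [pr]
            refine Nat.Coprime.prod_right fun p hp => ?_
            refine Nat.Coprime.symm ((Nat.Prime.coprime_iff_not_dvd (hQ p hp).1).2 ?_)
            intro hd
            obtain ⟨a, ha, hda⟩ := (dvd_tuplePoly (hQ p hp).1 _ _).1 (hc'.2 p hp)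
            have h7 : c + a ≡ c + h [MOD p] :=
              ((Nat.modEq_zero_iff_dvd).2 hda).trans ((Nat.modEq_zero_iff_dvd).2 hd).symm
            have h8 : a ≡ h [MOD p] := Nat.ModEq.add_left_cancel' c h7
            exact (mem_erase.1 ha).1 ((hQ p hp).2 a (mem_of_mem_erase ha) h hh h8)
        have b1 := Est_ge (2*N+h) M (c+h) hco
        have b2 := Est_ge (N+h) M (c+h) hco
        rw [abs_le] at *
        have e3 : (N:ℝ) / (Nat.totient M) = ((2*N+h:ℕ):ℝ) / (Nat.totient M) - ((N+h:ℕ):ℝ) / (Nat.totient M) := by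
          rw [← sub_div]; push_cast; congr 1; ring
        rw [e3]
        constructor <;> linarith [b1.1, b1.2, b2.1, b2.2]
    _ = ((k:ℝ)-1) ^ Q.card * (Est (2*N+h) M + Est (N+h) M) := by
        rw [sum_const, hC2, hcard, nsmul_eq_mul]; push_cast; rw [hk1]
    _ ≤ _ := by
        have hk2 : (2:ℝ) ≤ k := by exact_mod_cast hk
        exact mul_le_mul_of_nonneg_right (pow_le_pow_left₀ (by linarith) (by linarith) _)
          (add_nonneg (Est_nonneg _ _) (Est_nonneg _ _))

theorem S2_asym (P : Finset ℕ) (k l : ℕ) (hk : 2 ≤ k) (R : ℝ) (hR : 1 ≤ R)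
    (hP : ∀ p ∈ P, p.Prime ∧ 2 * k < p)
    (H : Finset ℕ) (hH : H.card = k)
    (hPH : ∀ p ∈ P, ∀ h ∈ H, ∀ h' ∈ H, h % p = h' % p → h = h') (N W : ℕ) (hW : 0 < W)
    (hPW : ∀ p ∈ P, ¬ p ∣ W ∧ p ≤ N) (hWH : ∀ h ∈ H, W ∣ h) (h : ℕ) (hh : h ∈ H) :
    |∑ n ∈ (Ioc N (2*N)).filter (fun n => n % W = 1 % W), theta (n + h) * (Lam P k l R H n) ^ 2
      - (N:ℝ) / (Nat.totient W) * QQ P k l R (fun p => ((k:ℝ) - 1) / ((p:ℝ) - 1))| ≤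
     ((Real.log R) ^ l * TT P k k 0 R) ^ 2 *
      ∑ Q ∈ DD P (R^2), ((9 * k : ℕ):ℝ) ^ Q.card * (Est (2*N+h) (W * pr Q) + Est (N+h) (W * pr Q)) := by
  have h := approx P k l (by omega) R hR (fun p hp => (hP p hp).2) H ((Ioc N (2*N)).filter (fun n => n % W = 1 % W))
    (fun n => theta (n + h)) ((N:ℝ) / (Nat.totient W)) (fun p => ((k:ℝ) - 1) / ((p:ℝ) - 1))
    (fun Q => (k:ℝ) ^ Q.card * (Est (2*N+h) (W * pr Q) + Est (N+h) (W * pr Q))) (by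
      intro Q hQ
      rw [mem_DD] at hQ
      exact cnt2 k hk H hH N W hW Q (fun p hp => ⟨(hP p (hQ.1 hp)).1, hPH p (hQ.1 hp)⟩) (fun p hp => hPW p (hQ.1 hp)) hWH h hh)
  refine h.trans (mul_le_mul_of_nonneg_left (le_of_eq ?_) (sq_nonneg _))
  refine sum_congr rfl fun Q _ => ?_
  push_cast; rw [mul_pow]; ring

/-- trivial bound for the error in progressions -/
theorem Est_triv (x W : ℕ) (hW : 0 < W) (Q : Finset ℕ) (hQ : ∀ p ∈ Q, p.Prime) (hQW : ∀ p ∈ Q, ¬ p ∣ W)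
    (hx : 1 ≤ Real.log x) (hle : pr Q ≤ x) :
    Est x (W * pr Q) ≤ 4 * x * Real.log x * (2 ^ Q.card / pr Q) := by
  have hq : 0 < pr Q := pr_pos (fun p hp => (hQ p hp).pos) (Subset.refl Q)
  have hqr : (0:ℝ) < pr Q := by exact_mod_cast hq
  have hlx : 0 ≤ Real.log x := by linarith
  have hqx : ((pr Q : ℕ):ℝ) ≤ x := by exact_mod_cast hle
  set a := astar x (W * pr Q)
  have h1 : primeSumAP x (W * pr Q) a ≤ Real.log x * (3 * x / pr Q) := by
    unfold primeSumAP
    calc _ ≤ ∑ p ∈ (range (x+1)).filter (fun p => p.Prime ∧ p % (W * pr Q) = a % (W * pr Q)), Real.log x := by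
          refine sum_le_sum fun p hp => ?_
          rw [mem_filter, mem_range] at hp
          exact Real.log_le_log (by exact_mod_cast hp.2.1.pos) (by exact_mod_cast (by omega : p ≤ x))
      _ ≤ ∑ p ∈ (range (x+1)).filter (fun p => p % (pr Q) = a % (pr Q)), Real.log x := by
          refine sum_le_sum_of_subset_of_nonneg ?_ fun _ _ _ => hlx
          intro p hp
          rw [mem_filter] at hp ⊢
          refine ⟨hp.1, ?_⟩
          exact Nat.ModEq.of_dvd (dvd_mul_left (pr Q) W) hp.2.2
      _ = (((range (x+1)).filter (fun p => p % (pr Q) = a % (pr Q))).card : ℝ) * Real.log x := by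
          rw [sum_const, nsmul_eq_mul]
      _ ≤ (3 * x / pr Q) * Real.log x := by
          refine mul_le_mul_of_nonneg_right ?_ hlx
          have hc : ((range (x+1)).filter (fun p => p % (pr Q) = a % (pr Q))).card ≤ (x+1) / pr Q + 1 := by
            have := Nat.count_modEq_card (b := x+1) hq a
            rw [Nat.count_eq_card_filter_range] at this
            have e : ((range (x+1)).filter (fun p => p % (pr Q) = a % (pr Q))) = ((range (x+1)).filter (fun p => p ≡ a [MOD (pr Q)])) := rfl
            rw [e, this]
            split_ifs <;> omega
          have hc2 : (((range (x+1)).filter (fun p => p % (pr Q) = a % (pr Q))).card : ℝ) ≤ ((x:ℝ)+1) / pr Q + 1 := by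
            calc _ ≤ (((x+1) / pr Q + 1 : ℕ) : ℝ) := by exact_mod_cast hc
              _ ≤ _ := by
                push_cast
                have := Nat.cast_div_le (α := ℝ) (m := x+1) (n := pr Q)
                push_cast at this
                linarith
          refine hc2.trans ?_
          rw [div_add_one hqr.ne', div_le_div_iff_of_pos_right hqr]
          have : (1:ℝ) ≤ pr Q := by exact_mod_cast hq
          linarith
      _ = _ := by ring
  have h0 : 0 ≤ primeSumAP x (W * pr Q) a := by
    unfold primeSumAP
    refine sum_nonneg fun p hp => Real.log_natCast_nonneg p
  have h2 : (x:ℝ) / (Nat.totient (W * pr Q)) ≤ x * (2 ^ Q.card / pr Q) := by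
    rw [totient_pr Q hQ W hQW, div_eq_mul_inv]
    refine mul_le_mul_of_nonneg_left ?_ (by positivity)
    have hp1 : ∏ p ∈ Q, ((p:ℝ) / 2) ≤ ∏ p ∈ Q, ((p:ℝ) - 1) := by
      refine prod_le_prod (fun p hp => by positivity) fun p hp => ?_
      have : (2:ℝ) ≤ p := by exact_mod_cast (hQ p hp).two_le
      linarith
    have hp2 : ∏ p ∈ Q, ((p:ℝ) / 2) = pr Q / 2 ^ Q.card := by
      rw [prod_div_distrib, prod_const, pr]; push_cast; rfl
    have hW1 : (1:ℝ) ≤ Nat.totient W := by exact_mod_cast Nat.totient_pos.2 hW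
    rw [hp2] at hp1
    have hpos : (0:ℝ) < pr Q / 2 ^ Q.card := by positivity
    have : (2:ℝ) ^ Q.card / pr Q = (pr Q / 2 ^ Q.card : ℝ)⁻¹ := by rw [inv_div]
    rw [this]
    refine inv_anti₀ hpos ?_
    nlinarith
  have h3 : (1:ℝ) ≤ 2 ^ Q.card := one_le_pow₀ (by norm_num)
  have h4 : (0:ℝ) ≤ x / pr Q := by positivity
  have h5 : (0:ℝ) ≤ (x:ℝ) / (Nat.totient (W * pr Q)) := by positivity
  unfold Est
  rw [abs_le]
  have h6 : Real.log x * (3 * x / pr Q) ≤ 3 * (x * Real.log x * (2 ^ Q.card / pr Q)) := by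
    have : Real.log x * (3 * x / pr Q) = 3 * ((x / pr Q) * Real.log x * 1) := by ring
    rw [this]
    have : x * Real.log x * (2 ^ Q.card / pr Q) = (x / pr Q) * Real.log x * 2 ^ Q.card := by ring
    rw [this]
    have h7 : 0 ≤ (x / pr Q : ℝ) * Real.log x := by positivity
    nlinarith
  have h8 : x * ((2:ℝ) ^ Q.card / pr Q) ≤ x * Real.log x * (2 ^ Q.card / pr Q) := by
    have : 0 ≤ x * ((2:ℝ) ^ Q.card / pr Q) := by positivity
    nlinarith
  have h9 : 0 ≤ x * Real.log x * ((2:ℝ) ^ Q.card / pr Q) := by positivity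
  constructor <;> linarith

end GPY

namespace GPY

theorem log_ge_eventually (c : ℝ) : ∃ N₀ : ℕ, 3 ≤ N₀ ∧ ∀ N : ℕ, N₀ ≤ N → c ≤ Real.log N := by
  have h := (Real.tendsto_log_atTop.comp tendsto_natCast_atTop_atTop).eventually_ge_atTop c
  obtain ⟨N₀, h⟩ := Filter.eventually_atTop.1 h
  exact ⟨max N₀ 3, le_max_right _ _, fun N hN => h N (le_trans (le_max_left _ _) hN)⟩

theorem lod_err (ϑ τ : ℝ) (W j : ℕ) (hW : 0 < W) (hL : HasLevelOfDistribution ϑ) (hτ : 0 < τ) (hτ1 : 2 * τ < ϑ)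
    (hτ2 : 2 * τ < 1) (A : ℕ) : ∃ N₀ : ℕ, ∀ N : ℕ, N₀ ≤ N → ∀ x : ℕ, N ≤ x → x ≤ 3 * N → ∀ P : Finset ℕ,
    (∀ p ∈ P, p.Prime ∧ ¬ p ∣ W) →
    ∑ Q ∈ DD P (((N:ℝ) ^ τ) ^ 2), (j:ℝ) ^ Q.card * Est x (W * pr Q) ≤ N / (Real.log N) ^ A := by
  set ε := (ϑ - 2 * τ) / 2 with hε
  have hε0 : 0 < ε := by rw [hε]; linarith
  set b := A + 2 * j ^ 2 + 3 with hb
  obtain ⟨C, hC0, hC⟩ := hL ((A + b + 1 : ℕ) : ℝ) (by positivity) ε hε0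
  obtain ⟨N₀, hN03, hN0⟩ := log_ge_eventually (max (max 2 (6 * C)) (max (48 * 4 ^ (2 * j ^ 2)) (Real.log W / ε)))
  refine ⟨N₀, fun N hN x hNx hxN P hP => ?_⟩
  have hy := hN0 N hN
  set y := Real.log N with hyd
  have hy2 : 2 ≤ y := le_trans (le_trans (le_max_left _ _) (le_max_left _ _)) hy
  have hyC : 6 * C ≤ y := le_trans (le_trans (le_max_right _ _) (le_max_left _ _)) hy
  have hyj : 48 * 4 ^ (2 * j ^ 2) ≤ y := le_trans (le_trans (le_max_left _ _) (le_max_right _ _)) hy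
  have hyW : Real.log W / ε ≤ y := le_trans (le_trans (le_max_right _ _) (le_max_right _ _)) hy
  have hN3 : 3 ≤ N := hN03.trans hN
  have hNr : (3:ℝ) ≤ N := by exact_mod_cast hN3
  have hNpos : (0:ℝ) < N := by linarith
  have hxr : (N:ℝ) ≤ x := by exact_mod_cast hNx
  have hxr3 : (x:ℝ) ≤ 3 * N := by exact_mod_cast hxN
  have hxpos : (0:ℝ) < x := by linarith
  have hlx1 : y ≤ Real.log x := Real.log_le_log hNpos hxr
  have hlx2 : Real.log x ≤ 2 * y := by
    have : Real.log x ≤ Real.log ((N:ℝ) * N) := Real.log_le_log hxpos (by nlinarith)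
    rw [Real.log_mul hNpos.ne' hNpos.ne'] at this
    linarith
  have hR2 : ((N:ℝ) ^ τ) ^ 2 = (N:ℝ) ^ (2 * τ) := by
    rw [← Real.rpow_natCast, ← Real.rpow_mul hNpos.le]; congr 1; push_cast; ring
  have hR2x : ((N:ℝ) ^ τ) ^ 2 ≤ x := by
    rw [hR2]
    calc (N:ℝ) ^ (2 * τ) ≤ (N:ℝ) ^ (1:ℝ) := Real.rpow_le_rpow_of_exponent_le (by linarith) hτ2.le
      _ = N := Real.rpow_one _
      _ ≤ x := hxr
  have hR1 : 1 ≤ ((N:ℝ) ^ τ) ^ 2 := by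
    rw [hR2]; exact Real.one_le_rpow (by linarith) (by linarith)
  have hWx : (W:ℝ) * ((N:ℝ) ^ τ) ^ 2 ≤ (x:ℝ) ^ (ϑ - ε) := by
    have e : ϑ - ε = ε + 2 * τ := by rw [hε]; ring
    rw [e, Real.rpow_add hxpos, hR2]
    refine mul_le_mul ?_ (Real.rpow_le_rpow hNpos.le hxr (by linarith)) (by positivity) (by positivity)
    rw [div_le_iff₀ hε0] at hyW
    have hW' : (0:ℝ) < W := by exact_mod_cast hW
    rw [← Real.log_le_log_iff hW' (by positivity), Real.log_rpow hxpos]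
    nlinarith
  -- sum of errors
  have hPp : ∀ p ∈ P, p.Prime := fun p hp => (hP p hp).1
  have s1 : ∑ Q ∈ DD P (((N:ℝ) ^ τ) ^ 2), Est x (W * pr Q) ≤ C * x / (Real.log x) ^ (A + b + 1) := by
    have h1 := hC x (by omega) (astar x) (astar_coprime x)
    rw [Real.rpow_natCast] at h1
    refine le_trans ?_ h1
    have h2 : ∑ Q ∈ DD P (((N:ℝ) ^ τ) ^ 2), Est x (W * pr Q) =
        ∑ q ∈ (DD P (((N:ℝ) ^ τ) ^ 2)).image (fun Q => W * pr Q), Est x q := by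
      rw [sum_image]
      intro D hD E hE h
      exact inj_pr hPp (mem_DD.1 hD).1 (mem_DD.1 hE).1 (Nat.eq_of_mul_eq_mul_left hW h)
    rw [h2]
    refine sum_le_sum_of_subset_of_nonneg ?_ fun _ _ _ => abs_nonneg _
    intro q hq
    obtain ⟨Q, hQ, rfl⟩ := mem_image.1 hq
    rw [mem_DD] at hQ
    rw [mem_Icc]
    refine ⟨Nat.mul_pos hW (pr_pos (fun p hp => (hPp p hp).pos) hQ.1), Nat.le_floor ?_⟩
    push_cast
    exact (mul_le_mul_of_nonneg_left hQ.2 (by positivity)).trans hWx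
  have s2 : ∑ Q ∈ DD P (((N:ℝ) ^ τ) ^ 2), ((j:ℝ) ^ Q.card) ^ 2 * Est x (W * pr Q) ≤
      4 * x * Real.log x * (2 * Real.log x) ^ (2 * j ^ 2) := by
    have h1 := sum_pow_inv_le P hPp _ hR1 (2 * j ^ 2)
    have h2 : 1 + Real.log (((N:ℝ) ^ τ) ^ 2) ≤ 2 * Real.log x := by
      have := Real.log_le_log (by linarith) hR2x
      linarith
    have h3 : 0 ≤ 1 + Real.log (((N:ℝ) ^ τ) ^ 2) := by
      have := Real.log_nonneg hR1; linarith
    have h4 := h1.trans (pow_le_pow_left₀ h3 h2 _)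
    refine le_trans ?_ (mul_le_mul_of_nonneg_left h4 (mul_nonneg (by positivity) (by linarith)))
    rw [mul_sum]
    refine sum_le_sum fun Q hQ => ?_
    rw [mem_DD] at hQ
    have h5 := Est_triv x W hW Q (fun p hp => hPp p (hQ.1 hp)) (fun p hp => (hP p (hQ.1 hp)).2) (by linarith)
      (by exact_mod_cast hQ.2.trans hR2x)
    calc _ ≤ ((j:ℝ) ^ Q.card) ^ 2 * (4 * x * Real.log x * (2 ^ Q.card / pr Q)) :=
          mul_le_mul_of_nonneg_left h5 (by positivity)
      _ = _ := by push_cast; rw [mul_pow, ← pow_mul, mul_comm Q.card 2, pow_mul]; ring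
  have s3 : ∑ Q ∈ DD P (((N:ℝ) ^ τ) ^ 2), (j:ℝ) ^ Q.card * Est x (W * pr Q) ≤
      y ^ b * (C * x / (Real.log x) ^ (A + b + 1)) + 4 * x * Real.log x * (2 * Real.log x) ^ (2 * j ^ 2) / y ^ b := by
    have hyb : 0 < y ^ b := by positivity
    calc _ ≤ ∑ Q ∈ DD P (((N:ℝ) ^ τ) ^ 2), (y ^ b * Est x (W * pr Q) + ((j:ℝ) ^ Q.card) ^ 2 * Est x (W * pr Q) / y ^ b) := by
          refine sum_le_sum fun Q _ => ?_
          have e : y ^ b * Est x (W * pr Q) + ((j:ℝ) ^ Q.card) ^ 2 * Est x (W * pr Q) / y ^ b =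
            (y ^ b + ((j:ℝ) ^ Q.card) ^ 2 / y ^ b) * Est x (W * pr Q) := by ring
          rw [e]
          refine mul_le_mul_of_nonneg_right ?_ (Est_nonneg _ _)
          set w := (j:ℝ) ^ Q.card
          have : y ^ b + w ^ 2 / y ^ b - w = ((y ^ b) ^ 2 + w ^ 2 - w * y ^ b) / y ^ b := by field_simp
          have h0 : 0 ≤ ((y ^ b) ^ 2 + w ^ 2 - w * y ^ b) / y ^ b := div_nonneg (by nlinarith [sq_nonneg (y^b - w), sq_nonneg (y^b + w)]) hyb.le
          linarith
      _ = y ^ b * ∑ Q ∈ DD P (((N:ℝ) ^ τ) ^ 2), Est x (W * pr Q) + (∑ Q ∈ DD P (((N:ℝ) ^ τ) ^ 2), ((j:ℝ) ^ Q.card) ^ 2 * Est x (W * pr Q)) / y ^ b := by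
          rw [sum_add_distrib, mul_sum, sum_div]
      _ ≤ _ := by gcongr
  refine s3.trans ?_
  have hy0 : 0 < y := by linarith
  have t1 : y ^ b * (C * x / (Real.log x) ^ (A + b + 1)) ≤ N / y ^ A / 2 := by
    calc y ^ b * (C * x / (Real.log x) ^ (A + b + 1)) ≤ y ^ b * (C * (3 * N) / y ^ (A + b + 1)) := by gcongr
      _ = (3 * C / y) * (N / y ^ A) := by
          have e : y ^ (A + b + 1) = y ^ A * y ^ b * y := by rw [pow_succ, pow_add y A b]
          rw [e]; field_simp
      _ ≤ (1/2) * (N / y ^ A) := by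
          refine mul_le_mul_of_nonneg_right ?_ (by positivity)
          rw [div_le_div_iff₀ hy0 (by norm_num)]; linarith
      _ = _ := by ring
  have t2 : 4 * x * Real.log x * (2 * Real.log x) ^ (2 * j ^ 2) / y ^ b ≤ N / y ^ A / 2 := by
    have hlx0 : 0 ≤ Real.log x := by linarith
    calc _ ≤ 4 * (3 * N) * (2 * y) * (2 * (2 * y)) ^ (2 * j ^ 2) / y ^ b := by gcongr
      _ = (24 * 4 ^ (2 * j ^ 2) / (y * y)) * (N / y ^ A) := by
          rw [hb, show 2 * (2 * y) = 4 * y by ring, mul_pow, pow_add, pow_add]; field_simp; norm_num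
      _ ≤ (1/2) * (N / y ^ A) := by
          refine mul_le_mul_of_nonneg_right ?_ (by positivity)
          rw [div_le_div_iff₀ (by positivity) (by norm_num)]; nlinarith
      _ = _ := by ring
  linarith

end GPY

namespace GPY

structure Ctx (k : ℕ) (δ : ℝ) (W a : ℕ) : Prop where
  hW : 0 < W
  big : ∀ p : ℕ, p.Prime → ¬ p ∣ W → 2 * (k + 1) < p
  SK : ∀ (P : Finset ℕ) (M : ℕ), M ≠ 0 → (∀ p ∈ P, p.Prime ∧ ¬ p ∣ M ∧ ¬ p ∣ W) → ∀ x : ℝ, 1 ≤ x →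
    ∑ A ∈ DD P x, ∏ p ∈ A, 1 / ((p:ℝ) - k) ≤ (1 + δ) * om M * (Real.log x + (1 + a * Real.log M))
  mert : ∀ y : ℝ, 1 ≤ y → ∀ s : Finset ℕ, (∀ p ∈ s, p.Prime ∧ ¬ p ∣ W ∧ (p:ℝ) ≤ y) →
    ∑ p ∈ s, Real.log p / ((p:ℝ) - k) ≤ Real.log y

theorem exists_ctx (k : ℕ) (δ : ℝ) (hδ : 0 < δ) (B : ℕ) : ∃ D a : ℕ, B ≤ D ∧ Ctx k δ D.factorial a := by
  obtain ⟨D1, h1, a, hS⟩ := SK_upper k δ hδ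
  obtain ⟨D2, h2, hm⟩ := mertens_tail k
  have key : ∀ p : ℕ, p.Prime → ¬ p ∣ (max (max D1 D2) (max B (2 * (k+1)))).factorial →
      max (max D1 D2) (max B (2 * (k+1))) < p := by
    intro p hp hd
    rw [hp.dvd_factorial, not_le] at hd
    exact hd
  refine ⟨max (max D1 D2) (max B (2 * (k+1))), a, by simp, ?_, ?_, ?_, ?_⟩
  · exact Nat.factorial_pos _
  · intro p hp hd
    have := key p hp hd
    omega
  · intro P M hM hP x hx
    refine hS P M hM ?_ x hx
    intro p hp
    refine ⟨(hP p hp).1, (hP p hp).2.1, ?_⟩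
    have := key p (hP p hp).1 (hP p hp).2.2
    omega
  · intro y hy s hs
    refine hm y hy s ?_
    intro p hp
    refine ⟨(hs p hp).1, ?_, (hs p hp).2.2⟩
    have := key p (hs p hp).1 (hs p hp).2.1
    omega

/-- data for a tuple -/
structure Tup (k : ℕ) (W M : ℕ) (H : Finset ℕ) : Prop where
  card : H.card = k
  hM : M ≠ 0
  hWM : W ∣ M
  hWH : ∀ h ∈ H, W ∣ h
  dist : ∀ p : ℕ, p.Prime → ¬ p ∣ M → ∀ h ∈ H, ∀ h' ∈ H, h % p = h' % p → h = h'

variable {k l W a M : ℕ} {δ R : ℝ} {H : Finset ℕ}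

theorem Ctx.P (hc : Ctx k δ W a) (ht : W ∣ M) : ∀ p ∈ Pset M R, p.Prime ∧ ¬ p ∣ M ∧ ¬ p ∣ W ∧ 2 * (k+1) < p ∧ (p:ℝ) ≤ R := by
  intro p hp
  rw [mem_Pset] at hp
  have : ¬ p ∣ W := fun h => hp.2.1 (h.trans ht)
  exact ⟨hp.1, hp.2.1, this, hc.big p hp.1 this, hp.2.2⟩

theorem Ctx.step (hc : Ctx k δ W a) (ht : W ∣ M) (j b : ℕ) :
    Real.log R * TT (Pset M R) k j b R ≤ (1 + (j:ℝ) / ((b:ℝ) + 1)) * TT (Pset M R) k j (b+1) R := by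
  refine TT_step _ _ _ _ _ ?_ ?_
  · intro p hp
    have := hc.P ht p hp
    exact ⟨by omega, this.1.one_lt⟩
  · intro y hy
    refine hc.mert y hy _ ?_
    intro p hp
    rw [mem_filter] at hp
    have := hc.P ht p hp.1
    exact ⟨this.1, this.2.2.1, hp.2⟩

theorem Ctx.TTnn (hc : Ctx k δ W a) (ht : W ∣ M) (j b : ℕ) : 0 ≤ TT (Pset M R) k j b R :=
  TT_nonneg fun p hp => by have := hc.P ht p hp; omega

theorem Ctx.pow_le (hc : Ctx k δ W a) (ht : W ∣ M) (hR : 1 ≤ R) (j b : ℕ) :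
    (Real.log R) ^ b * TT (Pset M R) k j 0 R ≤ (1 + (j:ℝ)) ^ b * TT (Pset M R) k j b R := by
  induction b with
  | zero => simp
  | succ b ih =>
    have hT : 0 ≤ Real.log R := Real.log_nonneg hR
    have h1 := hc.step (R := R) ht j b
    have h2 := hc.TTnn (R := R) ht j (b+1)
    have h3 : (j:ℝ) / ((b:ℝ)+1) ≤ j := div_le_self (by positivity) (by linarith [Nat.cast_nonneg (α := ℝ) b])
    calc (Real.log R) ^ (b+1) * TT (Pset M R) k j 0 R = Real.log R * ((Real.log R) ^ b * TT (Pset M R) k j 0 R) := by ring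
      _ ≤ Real.log R * ((1 + (j:ℝ)) ^ b * TT (Pset M R) k j b R) := mul_le_mul_of_nonneg_left ih hT
      _ = (1 + (j:ℝ)) ^ b * (Real.log R * TT (Pset M R) k j b R) := by ring
      _ ≤ (1 + (j:ℝ)) ^ b * ((1 + (j:ℝ)) * TT (Pset M R) k j (b+1) R) := by
          refine mul_le_mul_of_nonneg_left (h1.trans ?_) (by positivity)
          exact mul_le_mul_of_nonneg_right (by linarith) h2
      _ = _ := by ring

theorem Ctx.V_upper (hc : Ctx k δ W a) (ht : W ∣ M) (hM : M ≠ 0) (hR : 1 ≤ R) (hδ : 0 < δ) :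
    TT (Pset M R) k k 0 R ≤ ((1 + δ) * (Real.log R + (1 + a * Real.log M))) ^ k := by
  have hu : ∀ p ∈ Pset M R, (0:ℝ) ≤ 1 / ((p:ℝ) - k) := by
    intro p hp
    have := (hc.P ht p hp).2.2.2.1
    have : (k:ℝ) ≤ p := by exact_mod_cast (by omega : k ≤ p)
    exact div_nonneg zero_le_one (by linarith)
  have h1 := sum_pow_le (Pset M R) (fun p hp => (hc.P ht p hp).1.pos) R hR (fun p => 1 / ((p:ℝ) - k)) hu k
  have h2 := hc.SK (Pset M R) M hM (fun p hp => ⟨(hc.P ht p hp).1, (hc.P ht p hp).2.1, (hc.P ht p hp).2.2.1⟩) R hR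
  have h0 : 0 ≤ ∑ A ∈ DD (Pset M R) R, ∏ p ∈ A, 1 / ((p:ℝ) - k) :=
    sum_nonneg fun A hA => prod_nonneg fun p hp => hu p ((mem_DD.1 hA).1 hp)
  have hlM : 0 ≤ Real.log M := Real.log_natCast_nonneg M
  have hlR : 0 ≤ Real.log R := Real.log_nonneg hR
  have h3 : (1 + δ) * om M * (Real.log R + (1 + a * Real.log M)) ≤ (1 + δ) * (Real.log R + (1 + a * Real.log M)) := by
    refine mul_le_mul_of_nonneg_right ?_ (by positivity)
    have := om_le_one M
    nlinarith
  refine le_trans (le_of_eq ?_) (h1.trans (pow_le_pow_left₀ h0 (h2.trans h3) k))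
  unfold TT
  refine sum_congr rfl fun D _ => ?_
  rw [pow_zero, mul_one]
  refine prod_congr rfl fun p _ => ?_
  ring

theorem Ctx.ratio (hc : Ctx k δ W a) (ht : W ∣ M) (hM : M ≠ 0) (hk : k = (2*l+1)^2) (hl : 1 ≤ l) (hδ : 0 < δ) (hR : 1 < R)
    (hE : (2*l+1) * k * (1 + a * Real.log M) ≤ δ * Real.log R) :
    om M * Real.log R * QQ (Pset M R) k l R (kap k) ≤
      (1 + δ) ^ 2 * ((l:ℝ)+1) ^ 2 * QQ (Pset M R) k l R (fun p => ((k:ℝ) - 1) / ((p:ℝ) - 1)) := by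
  set P := Pset M R
  have hk2 : 2 ≤ k := by rw [hk]; nlinarith
  have hT : 0 < Real.log R := Real.log_pos hR
  set T := Real.log R
  set E := 1 + a * Real.log M with hEd
  have hE0 : 0 ≤ E := by have := Real.log_natCast_nonneg M; positivity
  set A3 := TT P k (k-1) (2*l+2) R with hA3
  set A2 := TT P k (k-1) (2*l+1) R with hA2
  set A1 := TT P k (k-1) (2*l) R with hA1
  have nA3 : 0 ≤ A3 := hc.TTnn ht _ _
  have nA2 : 0 ≤ A2 := hc.TTnn ht _ _
  have nA1 : 0 ≤ A1 := hc.TTnn ht _ _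
  have hk1 : ((k-1:ℕ):ℝ) = (k:ℝ) - 1 := by rw [Nat.cast_sub (by omega)]; simp
  have hkr : (k:ℝ) = (2*l+1)^2 := by rw [hk]; push_cast; ring
  have hl0 : (1:ℝ) ≤ l := by exact_mod_cast hl
  have e1 : QQ P k l R (kap k) = TT P k k (2 * l) R :=
    Q1_eq P k l (by omega) R (fun p hp => by have := hc.P ht p hp; omega)
  have c1 : TT P k (k-1+1) (2*l) R ≤ (1 + δ) * om M * (A2 / (((2*l:ℕ):ℝ)+1) + E * A1) := by
    refine TT_conv P k (k-1) (2*l) R ((1 + δ) * om M) E (fun p hp => by have := hc.P ht p hp; omega) ?_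
    intro y hy _
    exact hc.SK P M hM (fun p hp => ⟨(hc.P ht p hp).1, (hc.P ht p hp).2.1, (hc.P ht p hp).2.2.1⟩) y hy
  rw [show k - 1 + 1 = k by omega] at c1
  have c2 : T * A1 ≤ (1 + ((k-1:ℕ):ℝ) / (((2*l:ℕ):ℝ)+1)) * A2 := hc.step ht (k-1) (2*l)
  have c3 : T * A2 ≤ (1 + ((k-1:ℕ):ℝ) / (((2*l+1:ℕ):ℝ)+1)) * A3 := hc.step ht (k-1) (2*l+1)
  have c4 := Q2_ge P k l M hk2 R hM (fun p hp => ⟨(hc.P ht p hp).1, by have := hc.P ht p hp; omega⟩)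
    (fun p h1 h2 h3 => mem_Pset.2 ⟨h1, h2, h3⟩)
  rw [← hA3] at c4
  set Q2 := QQ P k l R (fun p => ((k:ℝ) - 1) / ((p:ℝ) - 1))
  have hom := om_pos M
  rw [e1]
  push_cast at c1 c2 c3
  rw [hk1] at c2 c3
  have c3' : T * A2 ≤ (2*l+1) * A3 := by
    have : 1 + ((k:ℝ) - 1) / (2*l+1+1) = 2*l+1 := by rw [hkr]; field_simp; ring
    rwa [this] at c3
  have c2' : T * A1 ≤ k * A2 := by
    refine c2.trans (mul_le_mul_of_nonneg_right ?_ nA2)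
    have : ((k:ℝ) - 1) / (2*l+1) ≤ (k:ℝ) - 1 := div_le_self (by rw [hkr]; nlinarith) (by linarith)
    linarith
  have c5 : (2*l+1) * (T * (E * A1)) ≤ δ * T * A2 := by
    calc (2*l+1) * (T * (E * A1)) = (2*l+1) * E * (T * A1) := by ring
      _ ≤ (2*l+1) * E * (k * A2) := mul_le_mul_of_nonneg_left c2' (by positivity)
      _ = ((2*l+1) * k * E) * A2 := by ring
      _ ≤ _ := mul_le_mul_of_nonneg_right hE nA2
  have hp : 0 ≤ (1 + δ) * om M := by positivity
  have c6 : (2*l+1) * (T * TT P k k (2*l) R) ≤ (1+δ) * om M * ((1 + δ) * (T * A2)) := by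
    calc (2*l+1) * (T * TT P k k (2*l) R) ≤ (2*l+1) * (T * ((1 + δ) * om M * (A2 / (2*l+1) + E * A1))) := by gcongr
      _ = (1+δ) * om M * (T * A2 + (2*l+1) * (T * (E * A1))) := by field_simp
      _ ≤ (1+δ) * om M * (T * A2 + δ * T * A2) := by gcongr
      _ = _ := by ring
  have c7 : T * TT P k k (2*l) R ≤ (1+δ)^2 * om M * A3 := by
    have h : (2*(l:ℝ)+1) * (T * TT P k k (2*l) R) ≤ (2*l+1) * ((1+δ)^2 * om M * A3) := by
      calc _ ≤ _ := c6
        _ ≤ (1+δ) * om M * ((1 + δ) * ((2*l+1) * A3)) := by gcongr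
        _ = _ := by ring
    exact le_of_mul_le_mul_left h (by positivity)
  have c8 : (om M)^2 * A3 ≤ ((l:ℝ)+1)^2 * Q2 := by
    rw [div_mul_eq_mul_div, div_le_iff₀ (by positivity)] at c4
    linarith
  calc om M * T * TT P k k (2*l) R = om M * (T * TT P k k (2*l) R) := by ring
    _ ≤ om M * ((1+δ)^2 * om M * A3) := by gcongr
    _ = (1+δ)^2 * ((om M)^2 * A3) := by ring
    _ ≤ (1+δ)^2 * (((l:ℝ)+1)^2 * Q2) := by gcongr
    _ = _ := by ring

end GPY

namespace GPY

theorem totient_om (W : ℕ) : (Nat.totient W : ℝ) = W * om W := by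
  have h := Nat.totient_eq_mul_prod_factors W
  have h2 : ((Nat.totient W : ℚ) : ℝ) = ((W * ∏ p ∈ W.primeFactors, (1 - (p : ℚ)⁻¹) : ℚ) : ℝ) := by rw [h]
  push_cast at h2
  rw [h2, om]
  simp only [one_div]

noncomputable def extra (W M : ℕ) : ℝ := ∑ p ∈ M.primeFactors.filter (fun p => ¬ p ∣ W), 1 / (p:ℝ)

theorem om_tame {W M : ℕ} (hW : 0 < W) : om W * (1 - extra W M) ≤ om M := by
  have h1 : om M = (∏ p ∈ M.primeFactors.filter (fun p => p ∣ W), (1 - 1 / (p:ℝ))) *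
      ∏ p ∈ M.primeFactors.filter (fun p => ¬ p ∣ W), (1 - 1 / (p:ℝ)) := by
    rw [om, prod_filter_mul_prod_filter_not]
  have hpp : ∀ p ∈ M.primeFactors.filter (fun p => ¬ p ∣ W), p.Prime := fun p hp =>
    Nat.prime_of_mem_primeFactors (mem_filter.1 hp).1
  have h2 : 1 - extra W M ≤ ∏ p ∈ M.primeFactors.filter (fun p => ¬ p ∣ W), (1 - 1 / (p:ℝ)) := by
    refine one_sub_sum_le_prod _ _ fun p hp => ⟨by positivity, ?_⟩
    have := one_sub_inv_pos (hpp p hp)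
    linarith
  have h3 : om W ≤ ∏ p ∈ M.primeFactors.filter (fun p => p ∣ W), (1 - 1 / (p:ℝ)) := by
    rw [om]
    refine Finset.prod_le_prod_of_subset_of_le_one ?_ ?_ ?_
    · intro p hp
      rw [mem_filter] at hp
      exact Nat.mem_primeFactors.2 ⟨Nat.prime_of_mem_primeFactors hp.1, hp.2, hW.ne'⟩
    · intro p hp; exact (one_sub_inv_pos (Nat.prime_of_mem_primeFactors hp)).le
    · intro p hp _; exact one_sub_inv_le
  have h4 : 0 ≤ ∏ p ∈ M.primeFactors.filter (fun p => ¬ p ∣ W), (1 - 1 / (p:ℝ)) :=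
    prod_nonneg fun p hp => (one_sub_inv_pos (hpp p hp)).le
  rw [h1]
  calc _ ≤ om W * ∏ p ∈ M.primeFactors.filter (fun p => ¬ p ∣ W), (1 - 1 / (p:ℝ)) :=
        mul_le_mul_of_nonneg_left h2 (om_pos W).le
    _ ≤ _ := mul_le_mul_of_nonneg_right h3 h4

theorem QQ_congr (P : Finset ℕ) (k l : ℕ) (R : ℝ) (κ κ' : ℕ → ℝ) (h : ∀ p ∈ P, κ p = κ' p) :
    QQ P k l R κ = QQ P k l R κ' := by
  unfold QQ
  refine sum_congr rfl fun D hD => sum_congr rfl fun E hE => ?_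
  congr 1
  refine prod_congr rfl fun p hp => h p ?_
  rcases mem_union.1 hp with h | h
  · exact (mem_DD.1 hD).1 h
  · exact (mem_DD.1 hE).1 h

def Rough (W : ℕ) (z : ℝ) (H : Finset ℕ) (n : ℕ) : Prop :=
  ∀ q : ℕ, q.Prime → ¬ q ∣ W → (q:ℝ) ≤ z → ¬ q ∣ tuplePoly H n

variable {k l W a M : ℕ} {δ R z : ℝ} {H : Finset ℕ}

noncomputable def Err (k l M : ℕ) (R : ℝ) : ℝ :=
  ((Real.log R) ^ l * TT (Pset M R) k k 0 R) ^ 2 * (R^2 * (1 + Real.log (R^2)) ^ (9 * k))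

theorem Err_nonneg (hR : 1 ≤ R) : 0 ≤ Err k l M R := by
  unfold Err
  have : 0 ≤ Real.log (R^2) := Real.log_nonneg (by nlinarith)
  positivity

theorem S1_main (hc : Ctx k δ W a) (ht : Tup k W M H) (hk : 0 < k) (hR : 1 ≤ R) (N : ℕ) :
    |∑ n ∈ (Ioc N (2*N)).filter (fun n => n % W = 1 % W), (Lam (Pset M R) k l R H n) ^ 2
      - (N:ℝ) / W * QQ (Pset M R) k l R (kap k)| ≤ Err k l M R := by
  have h := S1_asym (Pset M R) k l hk R hR (fun p hp => ⟨(hc.P ht.hWM p hp).1, by have := hc.P ht.hWM p hp; omega⟩) H ht.card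
    (fun p hp => ht.dist p (hc.P ht.hWM p hp).1 (hc.P ht.hWM p hp).2.1) N W 1 hc.hW
    (fun p hp hd => absurd hd (hc.P ht.hWM p hp).2.2.1)
  rw [QQ_congr _ _ _ _ (kapm k W) (kap k)] at h
  · exact h
  · intro p hp
    rw [kapm, if_neg (hc.P ht.hWM p hp).2.2.1, kap]

theorem S1_q (hc : Ctx k δ W a) (ht : Tup k W M H) (hk : 0 < k) (hl : 1 ≤ l) (hR : 1 ≤ R) (N : ℕ) (q : ℕ) (hq : q.Prime)
    (hqW : ¬ q ∣ W) (hqR : (q:ℝ) ≤ R) (h : ℕ) (hh : h ∈ H) :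
    ∑ n ∈ ((Ioc N (2*N)).filter (fun n => n % W = 1 % W)).filter (fun n => q ∣ n + h), (Lam (Pset M R) k l R H n) ^ 2
      ≤ (N:ℝ) / W * ((1 / (q:ℝ)) * (if q ∣ M then QQ (Pset M R) k l R (kap k) else
         ((l:ℝ) * Real.log q * (Real.log R) ^ (l - 1)) ^ 2 * TT (Pset M R) k k 0 R)) + Err k l M R := by
  have hco : Nat.Coprime W q := ((Nat.Prime.coprime_iff_not_dvd hq).2 hqW).symm
  obtain ⟨b, hb1, hb2⟩ := Nat.chineseRemainder hco 1 ((q - h % q) % q)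
  have hqb : q ∣ b + h := by
    have h1 : b ≡ q - h % q [MOD q] := hb2.trans (Nat.mod_modEq _ _)
    have h2 : b + h ≡ (q - h % q) + h % q [MOD q] := h1.add (Nat.mod_modEq h q).symm
    rw [Nat.sub_add_cancel (Nat.mod_lt h hq.pos).le] at h2
    exact (Nat.modEq_zero_iff_dvd).1 (h2.trans (by simp [Nat.ModEq]))
  have hPp := hc.P (R := R) ht.hWM
  have hs := S1_asym (Pset M R) k l hk R hR (fun p hp => ⟨(hPp p hp).1, by have := hPp p hp; omega⟩) H ht.card
    (fun p hp => ht.dist p (hPp p hp).1 (hPp p hp).2.1) N (W * q) b (Nat.mul_pos hc.hW hq.pos)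
    (by
      intro p hp hd
      rcases (hPp p hp).1.dvd_mul.1 hd with hd | hd
      · exact absurd hd (hPp p hp).2.2.1
      · rw [(Nat.prime_dvd_prime_iff_eq (hPp p hp).1 hq).1 hd, dvd_tuplePoly hq]
        exact ⟨h, hh, hqb⟩)
  have e1 : ((Ioc N (2*N)).filter (fun n => n % W = 1 % W)).filter (fun n => q ∣ n + h) =
      (Ioc N (2*N)).filter (fun n => n % (W * q) = b % (W * q)) := by
    rw [filter_filter]
    refine filter_congr fun n _ => ?_
    have : n % (W * q) = b % (W * q) ↔ n ≡ b [MOD W] ∧ n ≡ b [MOD q] := (Nat.modEq_and_modEq_iff_modEq_mul hco).symm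
    rw [this]
    refine and_congr ?_ ?_
    · exact ⟨fun h => Nat.ModEq.trans h hb1.symm, fun h => h.trans hb1⟩
    · constructor
      · intro hd
        exact Nat.ModEq.add_right_cancel' h (((Nat.modEq_zero_iff_dvd).2 hd).trans ((Nat.modEq_zero_iff_dvd).2 hqb).symm)
      · intro hm
        exact (Nat.modEq_zero_iff_dvd).1 ((hm.add_right h).trans ((Nat.modEq_zero_iff_dvd).2 hqb))
  rw [e1]
  have hle := (abs_le.1 hs).2
  have hkey : QQ (Pset M R) k l R (kapm k (W * q)) ≤ (if q ∣ M then QQ (Pset M R) k l R (kap k) else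
         ((l:ℝ) * Real.log q * (Real.log R) ^ (l - 1)) ^ 2 * TT (Pset M R) k k 0 R) := by
    have hdv : ∀ p ∈ Pset M R, (p ∣ W * q ↔ p = q) := by
      intro p hp
      constructor
      · intro hd
        rcases (hPp p hp).1.dvd_mul.1 hd with hd | hd
        · exact absurd hd (hPp p hp).2.2.1
        · exact (Nat.prime_dvd_prime_iff_eq (hPp p hp).1 hq).1 hd
      · rintro rfl; exact dvd_mul_left _ _
    split_ifs with hqM
    · refine le_of_eq (QQ_congr _ _ _ _ _ _ fun p hp => ?_)
      have : ¬ p ∣ W * q := by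
        rw [hdv p hp]; rintro rfl; exact (hPp p hp).2.1 hqM
      rw [kapm, if_neg this, kap]
    · have hqP : q ∈ Pset M R := mem_Pset.2 ⟨hq, hqM, hqR⟩
      refine le_trans (le_of_eq (QQ_congr _ _ _ _ _ _ fun p hp => ?_)) (Qp_le (Pset M R) k l hk hl R hR (fun p hp => ⟨by have := hPp p hp; omega, (hPp p hp).1.one_lt⟩) q hqP)
      by_cases hpq : p = q
      · rw [kapm, if_pos ((hdv p hp).2 hpq), hpq, Function.update_self]
      · rw [kapm, if_neg (fun hd => hpq ((hdv p hp).1 hd)), Function.update_of_ne hpq, kap]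
  have hWq : (N:ℝ) / ((W * q : ℕ):ℝ) = (N:ℝ) / W * (1 / q) := by
    push_cast
    rw [div_mul_div_comm, mul_one]
  rw [hWq] at hle
  have hnn : 0 ≤ (N:ℝ) / W * (1 / q) := by positivity
  have := mul_le_mul_of_nonneg_left hkey hnn
  have e3 : ∀ X : ℝ, (N:ℝ) / W * ((1 / (q:ℝ)) * X) = (N:ℝ) / W * (1 / q) * X := fun X => by ring
  rw [e3]
  unfold Err
  linarith

theorem mert_part (hc : Ctx k δ W a) (s : Finset ℕ) (hz : 1 ≤ z) (hsp : ∀ q ∈ s, q.Prime ∧ ¬ q ∣ W ∧ (q:ℝ) ≤ z)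
    (lR V : ℝ) (hlR : 0 ≤ lR) (hV0 : 0 ≤ V) :
    ∑ q ∈ s, 1 / (q:ℝ) * (((l:ℝ) * Real.log q * lR ^ (l - 1)) ^ 2 * V) ≤ (l:ℝ)^2 * lR ^ (2*(l-1)) * (Real.log z)^2 * V := by
  have hm := hc.mert z hz s hsp
  have hlz : 0 ≤ Real.log z := Real.log_nonneg hz
  set c := (l:ℝ)^2 * lR ^ (2*(l-1)) * V with hcd
  have hc0 : 0 ≤ c := by positivity
  calc _ ≤ ∑ q ∈ s, c * Real.log z * (Real.log q / ((q:ℝ) - k)) := by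
        refine sum_le_sum fun q hq => ?_
        have hqq := hsp q hq
        have hb := hc.big q hqq.1 hqq.2.1
        have hq0 : (0:ℝ) < q := by exact_mod_cast hqq.1.pos
        have hqk : (0:ℝ) < (q:ℝ) - k := by
          have : (k:ℝ) < q := by exact_mod_cast (by omega : k < q)
          linarith
        have hlq : 0 ≤ Real.log q := Real.log_natCast_nonneg q
        have hlqz : Real.log q ≤ Real.log z := Real.log_le_log hq0 hqq.2.2
        calc 1 / (q:ℝ) * (((l:ℝ) * Real.log q * lR ^ (l - 1)) ^ 2 * V) = c * Real.log q * (Real.log q / q) := by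
              rw [hcd, mul_comm 2 (l-1), pow_mul]; ring
          _ ≤ c * Real.log z * (Real.log q / ((q:ℝ) - k)) := by
              refine mul_le_mul (mul_le_mul_of_nonneg_left hlqz hc0) ?_ (by positivity) (by positivity)
              exact div_le_div_of_nonneg_left hlq hqk (by linarith [Nat.cast_nonneg (α := ℝ) k])
    _ = c * Real.log z * ∑ q ∈ s, (Real.log q / ((q:ℝ) - k)) := by rw [mul_sum]
    _ ≤ c * Real.log z * Real.log z := mul_le_mul_of_nonneg_left hm (by positivity)
    _ = _ := by rw [hcd]; ring

theorem bad_le (hc : Ctx k δ W a) (ht : Tup k W M H) (hk : 0 < k) (hl : 1 ≤ l) (hR : 1 ≤ R) (hz : 1 ≤ z) (hzR : z ≤ R) (N : ℕ)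
    (S : Finset ℕ) (hS : S ⊆ (Ioc N (2*N)).filter (fun n => n % W = 1 % W)) (hSr : ∀ n ∈ S, ¬ Rough W z H n) :
    ∑ n ∈ S, (Lam (Pset M R) k l R H n) ^ 2 ≤
      (N:ℝ) / W * (k * (extra W M * QQ (Pset M R) k l R (kap k) +
        (l:ℝ)^2 * (Real.log R) ^ (2*(l-1)) * (Real.log z)^2 * TT (Pset M R) k k 0 R)) + z * k * Err k l M R := by
  set F := fun n => (Lam (Pset M R) k l R H n) ^ 2 with hF
  set S0 := (Ioc N (2*N)).filter (fun n => n % W = 1 % W) with hS0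
  set V := TT (Pset M R) k k 0 R with hV
  set Q1 := QQ (Pset M R) k l R (kap k) with hQ1
  have hV0 : 0 ≤ V := hc.TTnn ht.hWM _ _
  have hQ10 : 0 ≤ Q1 := by
    rw [hQ1, Q1_eq _ k l hk R (fun p hp => by have := hc.P ht.hWM p hp; omega)]
    exact hc.TTnn ht.hWM _ _
  have st1 : ∑ n ∈ S, F n ≤ ∑ q ∈ Pset W z, ∑ h ∈ H, ∑ n ∈ S0.filter (fun n => q ∣ n + h), F n := by
    have : ∀ n ∈ S, F n ≤ ∑ q ∈ Pset W z, ∑ h ∈ H, if q ∣ n + h then F n else 0 := by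
      intro n hn
      have hr := hSr n hn
      unfold Rough at hr
      push Not at hr
      obtain ⟨q, hq, hqW, hqz, hd⟩ := hr
      obtain ⟨h, hh, hqh⟩ := (dvd_tuplePoly hq H n).1 hd
      have nn : ∀ q ∈ Pset W z, ∀ h ∈ H, 0 ≤ if q ∣ n + h then F n else 0 := by
        intro q _ h _; split_ifs
        · exact sq_nonneg _
        · exact le_rfl
      calc F n = if q ∣ n + h then F n else 0 := by rw [if_pos hqh]
        _ ≤ ∑ h ∈ H, if q ∣ n + h then F n else 0 :=
            single_le_sum (f := fun h => if q ∣ n + h then F n else 0) (nn q (mem_Pset.2 ⟨hq, hqW, hqz⟩)) hh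
        _ ≤ _ := single_le_sum (f := fun q => ∑ h ∈ H, if q ∣ n + h then F n else 0)
            (fun q hq => sum_nonneg (nn q hq)) (mem_Pset.2 ⟨hq, hqW, hqz⟩)
    refine (sum_le_sum this).trans ?_
    rw [sum_comm]
    refine sum_le_sum fun q _ => ?_
    rw [sum_comm]
    refine sum_le_sum fun h _ => ?_
    rw [← sum_filter]
    exact sum_le_sum_of_subset_of_nonneg (filter_subset_filter _ hS) fun _ _ _ => sq_nonneg _
  have st2 : ∀ q ∈ Pset W z, ∑ h ∈ H, ∑ n ∈ S0.filter (fun n => q ∣ n + h), F n ≤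
      k * ((N:ℝ) / W * ((1 / (q:ℝ)) * (if q ∣ M then Q1 else
         ((l:ℝ) * Real.log q * (Real.log R) ^ (l - 1)) ^ 2 * V)) + Err k l M R) := by
    intro q hq
    rw [mem_Pset] at hq
    calc _ ≤ ∑ h ∈ H, ((N:ℝ) / W * ((1 / (q:ℝ)) * (if q ∣ M then Q1 else
         ((l:ℝ) * Real.log q * (Real.log R) ^ (l - 1)) ^ 2 * V)) + Err k l M R) :=
          sum_le_sum fun h hh => S1_q hc ht hk hl hR N q hq.1 hq.2.1 (hq.2.2.trans hzR) h hh
      _ = _ := by rw [sum_const, ht.card, nsmul_eq_mul]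
  refine (st1.trans (sum_le_sum st2)).trans ?_
  rw [← mul_sum, sum_add_distrib, ← mul_sum, sum_const, nsmul_eq_mul]
  have hcard : ((Pset W z).card : ℝ) ≤ z := by
    have h1 : (Pset W z).card ≤ ⌊z⌋₊ := by
      unfold Pset
      refine (card_filter_le _ _).trans ?_
      simp
    calc ((Pset W z).card : ℝ) ≤ (⌊z⌋₊ : ℝ) := by exact_mod_cast h1
      _ ≤ z := Nat.floor_le (by linarith)
  have hE := Err_nonneg (k := k) (l := l) (M := M) hR
  have hmain : ∑ q ∈ Pset W z, ((1 / (q:ℝ)) * (if q ∣ M then Q1 else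
         ((l:ℝ) * Real.log q * (Real.log R) ^ (l - 1)) ^ 2 * V)) ≤ extra W M * Q1 +
         (l:ℝ)^2 * (Real.log R) ^ (2*(l-1)) * (Real.log z)^2 * V := by
    rw [← sum_filter_add_sum_filter_not (Pset W z) (fun q => q ∣ M)]
    refine add_le_add ?_ ?_
    · rw [extra, sum_mul]
      calc _ = ∑ q ∈ (Pset W z).filter (fun q => q ∣ M), 1 / (q:ℝ) * Q1 := by
            refine sum_congr rfl fun q hq => ?_
            rw [if_pos (mem_filter.1 hq).2]
        _ ≤ _ := by
            refine sum_le_sum_of_subset_of_nonneg ?_ fun _ _ _ => by positivity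
            intro q hq
            rw [mem_filter, mem_Pset] at hq
            rw [mem_filter, Nat.mem_primeFactors]
            exact ⟨⟨hq.1.1, hq.2, ht.hM⟩, hq.1.2.1⟩
    · set s := (Pset W z).filter (fun q => ¬ q ∣ M) with hs
      have hsp : ∀ q ∈ s, q.Prime ∧ ¬ q ∣ W ∧ (q:ℝ) ≤ z := by
        intro q hq
        rw [hs, mem_filter, mem_Pset] at hq; exact hq.1
      refine le_trans (le_of_eq ?_) (mert_part hc s hz hsp (Real.log R) V (Real.log_nonneg hR) hV0)
      refine sum_congr rfl fun q hq => ?_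
      rw [if_neg (mem_filter.1 hq).2]
  have hNW : 0 ≤ (N:ℝ) / W := by positivity
  calc _ ≤ (k:ℝ) * ((N:ℝ) / W * (extra W M * Q1 +
         (l:ℝ)^2 * (Real.log R) ^ (2*(l-1)) * (Real.log z)^2 * V) + z * Err k l M R) := by
        refine mul_le_mul_of_nonneg_left (add_le_add (mul_le_mul_of_nonneg_left hmain hNW) ?_) (Nat.cast_nonneg _)
        exact mul_le_mul_of_nonneg_right hcard hE
    _ = _ := by ring

theorem Lam_rough (hc : Ctx k δ W a) (ht : Tup k W M H) (hk : 0 < k) (hR : 1 ≤ R) (hz : 1 < z) (N n : ℕ) (hn : 0 < n)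
    (hnH : ∀ h ∈ H, n + h ≤ 3 * N) (hr : Rough W z H n) (B : ℕ) (hB : k * Real.log (3 * N) ≤ B * Real.log z) :
    (Lam (Pset M R) k l R H n) ^ 2 ≤ 9 ^ B * ((Real.log R) ^ l * TT (Pset M R) k k 0 R) ^ 2 := by
  set P := Pset M R
  set L := (Real.log R) ^ l * TT P k k 0 R with hL
  have hL0 : 0 ≤ L := mul_nonneg (pow_nonneg (Real.log_nonneg hR) _) (hc.TTnn ht.hWM _ _)
  set A := P.filter (fun p => p ∣ tuplePoly H n) with hA
  have hPp := hc.P (R := R) ht.hWM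
  have hAp : ∀ p ∈ A, p.Prime ∧ p ∣ tuplePoly H n ∧ z ≤ p := by
    intro p hp
    rw [hA, mem_filter] at hp
    refine ⟨(hPp p hp.1).1, hp.2, ?_⟩
    by_contra hcon
    push Not at hcon
    exact hr p (hPp p hp.1).1 (hPp p hp.1).2.2.1 hcon.le hp.2
  have htp : 0 < tuplePoly H n := prod_pos fun h _ => by omega
  have hcard : A.card ≤ B := by
    have h1 : pr A ∣ tuplePoly H n := pr_dvd fun p hp => Nat.mem_primeFactors.2 ⟨(hAp p hp).1, (hAp p hp).2.1, htp.ne'⟩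
    have h2 : ((pr A : ℕ):ℝ) ≤ tuplePoly H n := by exact_mod_cast Nat.le_of_dvd htp h1
    have h3 : ((tuplePoly H n : ℕ):ℝ) ≤ (3 * N) ^ k := by
      unfold tuplePoly
      push_cast
      rw [← ht.card, ← prod_const]
      refine prod_le_prod (fun _ _ => by positivity) fun h hh => ?_
      exact_mod_cast hnH h hh
    have h4 : z ^ A.card ≤ (pr A : ℕ) := by
      unfold pr; push_cast
      rw [← prod_const]
      exact prod_le_prod (fun _ _ => by linarith) fun p hp => (hAp p hp).2.2
    have h5 := Real.log_le_log (by positivity) (h4.trans (h2.trans h3))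
    rw [Real.log_pow, Real.log_pow] at h5
    have h6 : (A.card : ℝ) * Real.log z ≤ B * Real.log z := h5.trans hB
    have h7 := le_of_mul_le_mul_right h6 (Real.log_pos hz)
    exact_mod_cast h7
  have hab : |Lam P k l R H n| ≤ L * 3 ^ B := by
    unfold Lam
    calc _ ≤ ∑ D ∈ (DD P R).filter (fun D => ∀ p ∈ D, p ∣ tuplePoly H n), |lamb P k l R D| := abs_sum_le_sum_abs _ _
      _ ≤ ∑ D ∈ (DD P R).filter (fun D => ∀ p ∈ D, p ∣ tuplePoly H n), L * 2 ^ D.card := by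
          refine sum_le_sum fun D hD => ?_
          exact lamb_le P k l hk R hR (fun p hp => by have := hPp p hp; omega) D (mem_filter.1 hD).1
      _ ≤ ∑ D ∈ A.powerset, L * 2 ^ D.card := by
          refine sum_le_sum_of_subset_of_nonneg ?_ fun _ _ _ => by positivity
          intro D hD
          rw [mem_filter, mem_DD] at hD
          rw [mem_powerset]
          intro p hp
          exact mem_filter.2 ⟨hD.1.1 hp, hD.2 p hp⟩
      _ = L * 3 ^ A.card := by
          rw [← mul_sum]
          have := Finset.sum_pow_mul_eq_add_pow (2:ℝ) 1 A
          simp only [one_pow, mul_one] at this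
          rw [this]; norm_num
      _ ≤ L * 3 ^ B := mul_le_mul_of_nonneg_left (pow_le_pow_right₀ (by norm_num) hcard) hL0
  calc (Lam P k l R H n) ^ 2 = |Lam P k l R H n| ^ 2 := (sq_abs _).symm
    _ ≤ (L * 3 ^ B) ^ 2 := pow_le_pow_left₀ (abs_nonneg _) hab 2
    _ = _ := by rw [mul_pow, ← pow_mul, mul_comm B 2, pow_mul]; norm_num; ring

end GPY

namespace GPY

variable {k l W a M : ℕ} {δ R z : ℝ} {H : Finset ℕ}

def Two (H : Finset ℕ) (n : ℕ) : Prop := 2 ≤ (H.filter (fun h => (n + h).Prime)).card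

open Classical in
noncomputable def GoodS (W : ℕ) (z : ℝ) (N : ℕ) (H : Finset ℕ) : Finset ℕ :=
  ((Ioc N (2*N)).filter (fun n => n % W = 1 % W)).filter (fun n => Two H n ∧ Rough W z H n)

open Classical in
theorem split_sum (N : ℕ) (hN : 0 < N) (H S0 : Finset ℕ) (W : ℕ) (z : ℝ) (hS : ∀ n ∈ S0, n ≤ 2 * N) (hH : ∀ h ∈ H, h ≤ N) (F : ℕ → ℝ)
    (hF : ∀ n, 0 ≤ F n) :
    ∑ h ∈ H, ∑ n ∈ S0, theta (n + h) * F n - Real.log (3 * N) * ∑ n ∈ S0, F n ≤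
      H.card * Real.log (3 * N) * (∑ n ∈ S0.filter (fun n => Two H n ∧ Rough W z H n), F n +
        ∑ n ∈ S0.filter (fun n => Two H n ∧ ¬ Rough W z H n), F n) := by
  have hL : 0 ≤ Real.log (3 * (N:ℝ)) := by
    apply Real.log_nonneg
    have : (1:ℝ) ≤ N := by exact_mod_cast hN
    linarith
  have e1 : ∑ n ∈ S0.filter (fun n => Two H n ∧ Rough W z H n), F n +
        ∑ n ∈ S0.filter (fun n => Two H n ∧ ¬ Rough W z H n), F n = ∑ n ∈ S0, if Two H n then F n else 0 := by
    rw [← filter_filter, ← filter_filter, sum_filter_add_sum_filter_not, sum_filter]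
  rw [e1, sum_comm, mul_sum, mul_sum, ← sum_sub_distrib]
  refine sum_le_sum fun n hn => ?_
  rw [← sum_mul]
  have ht : ∀ h ∈ H, theta (n + h) ≤ if (n+h).Prime then Real.log (3 * N) else 0 := by
    intro h hh
    unfold theta
    split_ifs with hp
    · refine Real.log_le_log (by exact_mod_cast hp.pos) ?_
      have := hS n hn
      have := hH h hh
      exact_mod_cast (by omega : n + h ≤ 3 * N)
    · exact le_rfl
  have hs := sum_le_sum ht
  rw [← sum_filter, sum_const, nsmul_eq_mul] at hs
  have hFn := hF n
  have hcard : ((H.filter (fun h => (n+h).Prime)).card : ℝ) ≤ H.card := by exact_mod_cast card_filter_le _ _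
  split_ifs with h2
  · have : ∑ h ∈ H, theta (n + h) ≤ H.card * Real.log (3 * N) := hs.trans (mul_le_mul_of_nonneg_right hcard hL)
    nlinarith [mul_le_mul_of_nonneg_right this hFn, mul_nonneg hL hFn]
  · unfold Two at h2
    have : ((H.filter (fun h => (n+h).Prime)).card : ℝ) ≤ 1 := by exact_mod_cast (by omega)
    have : ∑ h ∈ H, theta (n + h) ≤ 1 * Real.log (3 * N) := hs.trans (mul_le_mul_of_nonneg_right this hL)
    nlinarith [mul_le_mul_of_nonneg_right this hFn]

theorem good_alg (k X y L3 Sg Sb S1 S2 E e2 z ρ : ℝ) (hk : 1 ≤ k) (hX : 0 ≤ X) (hy : 0 < y) (hSg : 0 ≤ Sg) (hE : 0 ≤ E) (hz : 0 ≤ z) 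
    (hL0 : 0 ≤ L3) (hρ : 0 < ρ) (hρ1 : ρ ≤ 1/2) (h1 : S2 - L3 * S1 ≤ k * L3 * (Sg + Sb))
    (h2 : (1 + 4 * ρ) * y * X - e2 ≤ S2) (h3 : S1 ≤ X + E) (h4 : Sb ≤ ρ / (4 * k) * X + z * k * E)
    (h5 : e2 ≤ ρ / 2 * y * X) (h6 : (2 + 2 * k ^ 2 * z) * E ≤ ρ / 2 * X) (hL : L3 ≤ (1 + ρ) * y) : ρ * X ≤ 2 * k * Sg := by
  have a1 : L3 * S1 ≤ (1 + ρ) * y * X + 2 * y * E := by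
    calc L3 * S1 ≤ L3 * (X + E) := mul_le_mul_of_nonneg_left h3 hL0
      _ ≤ (1 + ρ) * y * (X + E) := mul_le_mul_of_nonneg_right hL (by linarith)
      _ ≤ _ := by nlinarith [mul_nonneg hy.le hE]
  have hL2 : L3 ≤ 2 * y := by nlinarith
  have a2 : k * L3 * Sb ≤ y * (ρ / 2 * X) + 2 * y * k ^ 2 * z * E := by
    calc k * L3 * Sb ≤ k * L3 * (ρ / (4 * k) * X + z * k * E) := mul_le_mul_of_nonneg_left h4 (by positivity)
      _ ≤ k * (2 * y) * (ρ / (4 * k) * X + z * k * E) := by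
          refine mul_le_mul_of_nonneg_right ?_ (by positivity)
          exact mul_le_mul_of_nonneg_left hL2 (by linarith)
      _ = _ := by field_simp; ring
  have a3 : k * L3 * Sg ≤ k * (2 * y) * Sg := by
    refine mul_le_mul_of_nonneg_right ?_ hSg
    exact mul_le_mul_of_nonneg_left hL2 (by linarith)
  have a4 : y * ((2 + 2 * k ^ 2 * z) * E) ≤ y * (ρ / 2 * X) := mul_le_mul_of_nonneg_left h6 hy.le
  have a5 : y * (ρ * X) ≤ y * (2 * k * Sg) := by nlinarith [mul_nonneg hy.le hX, mul_nonneg hρ.le (mul_nonneg hy.le hX)]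
  exact le_of_mul_le_mul_left a5 hy

theorem V_pos (hc : Ctx k δ W a) (ht : W ∣ M) (hR : 1 ≤ R) : 1 ≤ TT (Pset M R) k k 0 R := by
  have := single_le_sum (f := fun D : Finset ℕ => (∏ p ∈ D, (k:ℝ) / ((p:ℝ) - k)) * (Real.log (R / pr D)) ^ 0)
    (fun D hD => mul_nonneg (TT_term_nonneg (a := 0) (fun p hp => by have := hc.P ht p hp; omega) D hD).1
      (TT_term_nonneg (K := k) (j := k) (fun p hp => by have := hc.P ht p hp; omega) D hD).2)
    (empty_mem_DD (P := Pset M R) hR)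
  simpa [TT] using this

set_option maxHeartbeats 4000000 in
/-- deterministic lower bound for the number of good `n`. -/
theorem good_det (hc : Ctx k δ W a) (ht : Tup k W M H) (hk : k = (2*l+1)^2) (hl : 1 ≤ l) (hδ : 0 < δ) (hδ1 : δ < 1)
    (N : ℕ) (hN : 3 ≤ N) (τ δ₁ ρ : ℝ) (hτ : 0 < τ) (hτ1 : τ ≤ 1) (hδ₁ : 0 < δ₁) (hδ₁1 : δ₁ ≤ 1) (hρ : 0 < ρ) (hρ1 : ρ ≤ 1/2)
    (hmain : (1 + 4 * ρ) * ((1 + δ)^2 * ((l:ℝ)+1)^2) ≤ k * τ * (1 - δ))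
    (hb1 : k * δ ≤ ρ / (8 * k)) (hb2 : k * ((l:ℝ)^2 * δ₁^2 * (1 + k)^(2*l)) ≤ ρ / (8 * k))
    (hex : extra W M ≤ δ) (hHN : ∀ h ∈ H, h ≤ N)
    (hE : (2*l+1) * k * (1 + a * Real.log M) ≤ δ * (τ * Real.log N))
    (hL3 : Real.log (3 * N) ≤ (1 + ρ) * Real.log N)
    (hEst : ∀ x : ℕ, N ≤ x → x ≤ 3 * N → ∀ P : Finset ℕ, (∀ p ∈ P, p.Prime ∧ ¬ p ∣ W) →
      ∑ Q ∈ DD P (((N:ℝ) ^ τ) ^ 2), ((9 * k : ℕ):ℝ) ^ Q.card * Est x (W * pr Q) ≤ N / (Real.log N) ^ k)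
    (he2 : 4 * W * k * ((1 + (k:ℝ)) ^ (2*l) * 4 ^ k) ≤ ρ * Real.log N)
    (he1 : (2 + 2 * (k:ℝ)^2 * (N:ℝ)^(δ₁*τ)) * ((1 + (k:ℝ)) ^ (2*l) * (4 * Real.log N) ^ k * (((N:ℝ)^τ)^2 * (1 + 2 * Real.log N)^(9*k)))
      ≤ ρ / 2 * (N / W)) (B : ℕ) (hB : k * Real.log (3 * N) ≤ B * (δ₁ * τ * Real.log N)) :
    ρ * (N / W) ≤ 2 * k * (9 ^ B * ((1 + (k:ℝ)) ^ (2*l) * (4 * Real.log N) ^ k)) * (GoodS W ((N:ℝ)^(δ₁*τ)) N H).card := by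
  classical
  set y := Real.log N with hy
  set R := (N:ℝ)^τ with hR
  set z := (N:ℝ)^(δ₁*τ) with hz
  have hN1 : (1:ℝ) < N := by exact_mod_cast (by omega : 1 < N)
  have hN0 : (0:ℝ) < N := by linarith
  have hy0 : 0 < y := Real.log_pos hN1
  have hR1 : 1 < R := Real.one_lt_rpow hN1 hτ
  have hz1 : 1 < z := Real.one_lt_rpow hN1 (by positivity)
  have hzR : z ≤ R := Real.rpow_le_rpow_of_exponent_le hN1.le (by nlinarith)
  have hRN : R ≤ N := by
    calc R ≤ (N:ℝ)^(1:ℝ) := Real.rpow_le_rpow_of_exponent_le hN1.le hτ1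
      _ = N := Real.rpow_one _
  have hlR : Real.log R = τ * y := Real.log_rpow hN0 _
  have hlz : Real.log z = δ₁ * τ * y := Real.log_rpow hN0 _
  set T := Real.log R with hT
  have hT0 : 0 < T := Real.log_pos hR1
  have hTy : T ≤ y := by rw [hlR]; nlinarith
  have hkn : 9 ≤ k := by rw [hk]; nlinarith
  have hk1 : (1:ℝ) ≤ k := by exact_mod_cast (by omega : 1 ≤ k)
  have hW0 : (0:ℝ) < W := by exact_mod_cast hc.hW
  set P := Pset M R with hP
  have hPp := hc.P (R := R) ht.hWM
  set V := TT P k k 0 R with hV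
  set Q1 := QQ P k l R (kap k) with hQ1
  set Q2 := QQ P k l R (fun p => ((k:ℝ) - 1) / ((p:ℝ) - 1)) with hQ2
  set S0 := (Ioc N (2*N)).filter (fun n => n % W = 1 % W) with hS0
  set F := fun n => (Lam P k l R H n) ^ 2 with hF
  set X := (N:ℝ) / W * Q1 with hX
  set K := (1 + (k:ℝ)) ^ (2*l) with hK
  have hV1 : 1 ≤ V := V_pos hc ht.hWM hR1.le
  have hVQ : T ^ (2*l) * V ≤ K * Q1 := by
    rw [hQ1, Q1_eq P k l (by omega) R (fun p hp => by have := hPp p hp; omega)]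
    exact hc.pow_le ht.hWM hR1.le k (2*l)
  have hK0 : 0 < K := by positivity
  have hQ1p : 0 < Q1 := by
    have : 0 < T ^ (2*l) * V := by positivity
    exact pos_of_mul_pos_right (lt_of_lt_of_le this hVQ) hK0.le
  have hNW : 0 < (N:ℝ) / W := by positivity
  have hX0 : 0 < X := by positivity
  have hlM : 0 ≤ Real.log M := Real.log_natCast_nonneg M
  have hEa : 1 + a * Real.log M ≤ y := by
    have h0 : 0 ≤ 1 + a * Real.log M := by positivity
    have h1 : 1 ≤ (2*(l:ℝ)+1) * k := by
      have : (0:ℝ) ≤ l := Nat.cast_nonneg l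
      have h5 : (1:ℝ) ≤ 2 * (l:ℝ) + 1 := by linarith
      exact one_le_mul_of_one_le_of_one_le h5 hk1
    have h2 : δ * (τ * y) ≤ y := by
      rw [← hlR]
      exact (mul_le_of_le_one_left hT0.le hδ1.le).trans hTy
    exact (le_mul_of_one_le_left h0 h1).trans (hE.trans h2)
  have hVu : V ≤ (4 * y) ^ k := by
    refine (hc.V_upper ht.hWM ht.hM hR1.le hδ).trans ?_
    refine pow_le_pow_left₀ (by positivity) ?_ k
    calc (1 + δ) * (T + (1 + a * Real.log M)) ≤ 2 * (y + y) := by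
          refine mul_le_mul (by linarith) (add_le_add hTy hEa) (by positivity) (by norm_num)
      _ = _ := by ring
  set Y := (4 * y) ^ k with hY
  have hY0 : 0 < Y := by positivity
  -- (T^l V)^2
  have hTV : (T ^ l * V) ^ 2 ≤ K * Q1 * Y := by
    calc (T ^ l * V) ^ 2 = T ^ (2*l) * V * V := by rw [mul_pow, ← pow_mul, mul_comm l 2]; ring
      _ ≤ K * Q1 * Y := mul_le_mul hVQ hVu (by linarith) (by positivity)
  -- Err
  have hErr0 := Err_nonneg (k := k) (l := l) (M := M) hR1.le
  have hErr : Err k l M R ≤ K * Q1 * Y * (R^2 * (1 + 2 * y) ^ (9*k)) := by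
    unfold Err
    have : Real.log (R^2) = 2 * T := by rw [Real.log_pow, ← hT]; norm_num
    rw [this]
    refine mul_le_mul hTV ?_ (by positivity) (by positivity)
    refine mul_le_mul_of_nonneg_left ?_ (by positivity)
    exact pow_le_pow_left₀ (by positivity) (by linarith) _
  -- the pieces
  have h1 := split_sum N (by omega) H S0 W z (fun n hn => (mem_Ioc.1 (mem_filter.1 hn).1).2) hHN F (fun n => sq_nonneg _)
  rw [ht.card] at h1
  have h3 := (abs_le.1 (S1_main (l := l) hc ht (by omega) hR1.le N)).2
  have h4 := bad_le (l := l) hc ht (by omega) hl hR1.le hz1.le hzR N (S0.filter (fun n => Two H n ∧ ¬ Rough W z H n)) (filter_subset _ _)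
    (fun n hn => (mem_filter.1 hn).2.2)
  set e2 := (k:ℝ) * ((T ^ l * V) ^ 2 * (2 * (N / y ^ k))) with he2d
  have h2 : (1 + 4 * ρ) * y * X - e2 ≤ ∑ h ∈ H, ∑ n ∈ S0, theta (n + h) * F n := by
    have hh : ∀ h ∈ H, (N:ℝ) / (Nat.totient W) * Q2 - (T ^ l * V) ^ 2 * (2 * (N / y ^ k)) ≤ ∑ n ∈ S0, theta (n + h) * F n := by
      intro h hh
      have := (abs_le.1 (S2_asym P k l (by omega) R hR1.le (fun p hp => ⟨(hPp p hp).1, by have := hPp p hp; omega⟩) H ht.card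
        (fun p hp => ht.dist p (hPp p hp).1 (hPp p hp).2.1) N W hc.hW (fun p hp => ⟨(hPp p hp).2.2.1, by
          have := (hPp p hp).2.2.2.2.trans hRN
          exact_mod_cast this⟩) ht.hWH h hh)).1
      have e : ∑ Q ∈ DD P (R^2), ((9 * k : ℕ):ℝ) ^ Q.card * (Est (2*N+h) (W * pr Q) + Est (N+h) (W * pr Q)) ≤ 2 * (N / y ^ k) := by
        simp_rw [mul_add]
        rw [sum_add_distrib]
        have hhN := hHN h hh
        have u1 := hEst (2*N+h) (by omega) (by omega) P (fun p hp => ⟨(hPp p hp).1, (hPp p hp).2.2.1⟩)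
        have u2 := hEst (N+h) (by omega) (by omega) P (fun p hp => ⟨(hPp p hp).1, (hPp p hp).2.2.1⟩)
        linarith
      have := mul_le_mul_of_nonneg_left e (sq_nonneg (T ^ l * V))
      linarith
    have hs := sum_le_sum hh
    rw [sum_const, ht.card, nsmul_eq_mul] at hs
    refine le_trans ?_ hs
    have hrat := hc.ratio (l := l) ht.hWM ht.hM hk hl hδ hR1 (by rw [← hT, hlR]; exact hE)
    have hom := om_tame (M := M) hc.hW
    have hoW := om_pos W
    have hoM : om W * (1 - δ) ≤ om M := le_trans (mul_le_mul_of_nonneg_left (by linarith) hoW.le) hom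
    rw [totient_om]
    set g := (1 + δ)^2 * ((l:ℝ)+1)^2 with hg
    have hg0 : 0 < g := by positivity
    have c1 : om W * (1 - δ) * T * Q1 ≤ g * Q2 := by
      refine le_trans ?_ hrat
      refine mul_le_mul_of_nonneg_right ?_ hQ1p.le
      exact mul_le_mul_of_nonneg_right hoM hT0.le
    have c2 : (1 + 4 * ρ) * y * Q1 ≤ k * (Q2 / om W) := by
      have : (1 + 4 * ρ) * g * (y * Q1) * om W ≤ k * (g * Q2) := by
        calc (1 + 4 * ρ) * g * (y * Q1) * om W ≤ (k * τ * (1 - δ)) * (y * Q1) * om W := by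
              refine mul_le_mul_of_nonneg_right (mul_le_mul_of_nonneg_right hmain (by positivity)) hoW.le
          _ = k * (om W * (1 - δ) * (τ * y) * Q1) := by ring
          _ ≤ _ := by rw [← hlR]; exact mul_le_mul_of_nonneg_left c1 (by linarith)
      rw [← mul_div_assoc, le_div_iff₀ hoW]
      refine le_of_mul_le_mul_left ?_ hg0
      linarith
    have c3 := mul_le_mul_of_nonneg_left c2 hNW.le
    have c4 : (N:ℝ) / (W * om W) * Q2 = (N:ℝ) / W * (Q2 / om W) := by
      rw [div_mul_div_comm, div_mul_eq_mul_div]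
    rw [c4, he2d, hX]
    linarith
  have h4' : ∑ n ∈ S0.filter (fun n => Two H n ∧ ¬ Rough W z H n), F n ≤ ρ / (4 * k) * X + z * k * Err k l M R := by
    refine h4.trans ?_
    refine add_le_add ?_ le_rfl
    have d1 : (l:ℝ)^2 * T ^ (2*(l-1)) * (Real.log z)^2 * V ≤ (l:ℝ)^2 * δ₁^2 * K * Q1 := by
      have : T ^ (2*(l-1)) * T ^ 2 = T ^ (2*l) := by rw [← pow_add]; congr 1; omega
      have hlz' : Real.log z = δ₁ * T := by rw [hlz, hlR]; ring
      calc (l:ℝ)^2 * T ^ (2*(l-1)) * (Real.log z)^2 * V = (l:ℝ)^2 * δ₁^2 * ((T ^ (2*(l-1)) * T^2) * V) := by rw [hlz']; ring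
        _ ≤ (l:ℝ)^2 * δ₁^2 * (K * Q1) := by
            rw [this]; exact mul_le_mul_of_nonneg_left hVQ (by positivity)
        _ = _ := by ring
    have d2 : extra W M * Q1 ≤ δ * Q1 := mul_le_mul_of_nonneg_right hex hQ1p.le
    have d3 : (k:ℝ) * (extra W M * Q1 + (l:ℝ)^2 * T ^ (2*(l-1)) * (Real.log z)^2 * V) ≤ ρ / (4 * k) * Q1 := by
      calc _ ≤ (k:ℝ) * (δ * Q1 + (l:ℝ)^2 * δ₁^2 * K * Q1) := mul_le_mul_of_nonneg_left (add_le_add d2 d1) (by linarith)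
        _ = (k * δ) * Q1 + (k * ((l:ℝ)^2 * δ₁^2 * K)) * Q1 := by ring
        _ ≤ ρ / (8 * k) * Q1 + ρ / (8 * k) * Q1 := add_le_add (mul_le_mul_of_nonneg_right hb1 hQ1p.le) (mul_le_mul_of_nonneg_right hb2 hQ1p.le)
        _ = _ := by field_simp; ring
    calc _ ≤ (N:ℝ) / W * (ρ / (4 * k) * Q1) := mul_le_mul_of_nonneg_left d3 hNW.le
      _ = _ := by rw [hX]; ring
  have h5 : e2 ≤ ρ / 2 * y * X := by
    rw [he2d]
    have hyk : (4 * y) ^ k = 4 ^ k * y ^ k := mul_pow _ _ _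
    calc (k:ℝ) * ((T ^ l * V) ^ 2 * (2 * (N / y ^ k))) ≤ (k:ℝ) * (K * Q1 * Y * (2 * (N / y ^ k))) := by
          refine mul_le_mul_of_nonneg_left ?_ (by linarith)
          exact mul_le_mul_of_nonneg_right hTV (by positivity)
      _ = (4 * W * k * (K * 4 ^ k)) * ((1/2) * ((N:ℝ) / W * Q1)) := by
          rw [hY, hyk]
          field_simp
          ring
      _ ≤ (ρ * y) * ((1/2) * ((N:ℝ) / W * Q1)) := mul_le_mul_of_nonneg_right he2 (by positivity)
      _ = _ := by rw [hX]; ring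
  have h6 : (2 + 2 * (k:ℝ) ^ 2 * z) * Err k l M R ≤ ρ / 2 * X := by
    calc _ ≤ (2 + 2 * (k:ℝ) ^ 2 * z) * (K * Q1 * Y * (R^2 * (1 + 2 * y) ^ (9*k))) := mul_le_mul_of_nonneg_left hErr (by positivity)
      _ = ((2 + 2 * (k:ℝ)^2 * z) * (K * Y * (R^2 * (1 + 2 * y)^(9*k)))) * Q1 := by ring
      _ ≤ (ρ / 2 * (N / W)) * Q1 := mul_le_mul_of_nonneg_right he1 hQ1p.le
      _ = _ := by rw [hX]; ring
  have hfin := good_alg k X y (Real.log (3 * N)) (∑ n ∈ S0.filter (fun n => Two H n ∧ Rough W z H n), F n) _ _ _ (Err k l M R) e2 z ρ hk1 hX0.le hy0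
    (sum_nonneg fun n _ => sq_nonneg _) hErr0 (by linarith) (Real.log_nonneg (by linarith)) hρ hρ1 h1 h2 (by linarith) h4' h5 h6 hL3
  have hup : ∑ n ∈ S0.filter (fun n => Two H n ∧ Rough W z H n), F n ≤ (GoodS W z N H).card * (9 ^ B * (K * Q1 * Y)) := by
    have : S0.filter (fun n => Two H n ∧ Rough W z H n) = GoodS W z N H := by
      unfold GoodS; rw [hS0]
    rw [this, ← nsmul_eq_mul]
    refine sum_le_card_nsmul _ _ _ fun n hn => ?_
    rw [← this, mem_filter, hS0, mem_filter, mem_Ioc] at hn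
    have := Lam_rough (l := l) hc ht (by omega) hR1.le hz1 N n (by omega) (fun h hh => by have := hHN h hh; omega) hn.2.2 B (by rw [hlz]; exact hB)
    refine this.trans (mul_le_mul_of_nonneg_left hTV (by positivity))
  have hf2 : ρ * (N / W) * Q1 ≤ 2 * k * (9 ^ B * (K * Y)) * (GoodS W z N H).card * Q1 := by
    calc ρ * (N / W) * Q1 = ρ * X := by rw [hX]; ring
      _ ≤ _ := hfin
      _ ≤ 2 * k * ((GoodS W z N H).card * (9 ^ B * (K * Q1 * Y))) := mul_le_mul_of_nonneg_left hup (by linarith)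
      _ = _ := by ring
  exact le_of_mul_le_mul_right hf2 hQ1p

end GPY

namespace GPY

theorem pow_log_small (C : ℝ) (m : ℕ) (s : ℝ) (hs : 0 < s) : ∃ N₀ : ℕ, ∀ N : ℕ, N₀ ≤ N → C * (Real.log N) ^ m ≤ (N:ℝ) ^ s := by
  have h1 := isLittleO_log_rpow_rpow_atTop (m:ℝ) hs
  have h2 := (h1.const_mul_left C).bound (c := 1) one_pos
  have h3 := tendsto_natCast_atTop_atTop.eventually h2
  obtain ⟨N₀, h⟩ := Filter.eventually_atTop.1 h3
  refine ⟨N₀, fun N hN => ?_⟩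
  have := h N hN
  rw [one_mul, Real.rpow_natCast] at this
  refine (le_abs_self _).trans (this.trans ?_)
  rw [Real.norm_eq_abs, abs_of_nonneg (Real.rpow_nonneg (Nat.cast_nonneg N) _)]

theorem params (ϑ : ℝ) (hϑ : 1/2 < ϑ) : ∃ (τ ρ δ δ₁ : ℝ) (l k : ℕ), k = (2*l+1)^2 ∧ 1 ≤ l ∧ 0 < τ ∧ 2 * τ < ϑ ∧ 2 * τ ≤ 3/4 ∧
    0 < δ ∧ δ < 1 ∧ 0 < δ₁ ∧ δ₁ ≤ 1/4 ∧ 0 < ρ ∧ ρ ≤ 1/2 ∧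
    (1 + 4 * ρ) * ((1 + δ)^2 * ((l:ℝ)+1)^2) ≤ k * τ * (1 - δ) ∧
    k * δ ≤ ρ / (8 * k) ∧ k * ((l:ℝ)^2 * δ₁^2 * (1 + k)^(2*l)) ≤ ρ / (8 * k) := by
  set σ := min (ϑ - 1/2) (1/2) with hσ
  have hσ0 : 0 < σ := lt_min (by linarith) (by norm_num)
  have hσ1 : σ ≤ 1/2 := min_le_right _ _
  have hσ2 : σ ≤ ϑ - 1/2 := min_le_left _ _
  obtain ⟨l, hl⟩ := exists_nat_ge (4 / σ)
  have hl4 : 4 ≤ l * σ := by rwa [div_le_iff₀ hσ0] at hl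
  have hl1 : 1 ≤ l := by
    rcases Nat.eq_zero_or_pos l with h | h
    · subst h; norm_num at hl4
    · exact h
  have hlr : (1:ℝ) ≤ l := by exact_mod_cast hl1
  set k := (2*l+1)^2 with hk
  have hkr : (k:ℝ) = (2*(l:ℝ)+1)^2 := by rw [hk]; push_cast; ring
  have hk1 : (1:ℝ) ≤ k := by rw [hkr]; nlinarith
  set ρ := σ / 12 with hρ
  have hρ0 : 0 < ρ := by positivity
  set δ := ρ / (16 * k^2) with hδ
  set Z := (l:ℝ)^2 * (1 + (k:ℝ))^(2*l) with hZ
  have hZ1 : 1 ≤ Z := one_le_mul_of_one_le_of_one_le (one_le_pow₀ hlr) (one_le_pow₀ (by linarith))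
  set δ₁ := ρ / (8 * k^2 * Z) with hδ₁
  have hk2 : (1:ℝ) ≤ k^2 := one_le_pow₀ hk1
  have hδ0 : 0 < δ := by positivity
  have hδ10 : 0 < δ₁ := by positivity
  have hδρ : δ ≤ ρ / 16 := by
    rw [hδ]; exact div_le_div_of_nonneg_left hρ0.le (by norm_num) (by linarith)
  have hδ1ρ : δ₁ ≤ ρ / 8 := by
    rw [hδ₁]; refine div_le_div_of_nonneg_left hρ0.le (by norm_num) ?_
    nlinarith
  refine ⟨1/4 + σ/4, ρ, δ, δ₁, l, k, rfl, hl1, by linarith, by linarith, by linarith, hδ0, by linarith, hδ10, by linarith, hρ0, by linarith, ?_, ?_, ?_⟩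
  · have h1 : (1 + 6 * ρ) * ((l:ℝ)+1)^2 ≤ k * (1/4 + σ/4) := by
      rw [hkr, hρ]
      nlinarith
    have h2 : (1 + 4 * ρ) * (1 + δ)^2 ≤ (1 + 6 * ρ) * (1 - δ) := by
      have hr : ρ ≤ 1/24 := by linarith
      nlinarith [mul_nonneg hδ0.le hδ0.le, mul_nonneg hδ0.le hρ0.le, mul_nonneg (mul_nonneg hδ0.le hδ0.le) hρ0.le, mul_le_mul hδρ hδρ hδ0.le (by linarith : 0 ≤ ρ/16)]
    have h3 : 0 ≤ 1 - δ := by linarith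
    calc (1 + 4 * ρ) * ((1 + δ)^2 * ((l:ℝ)+1)^2) = ((1 + 4 * ρ) * (1 + δ)^2) * ((l:ℝ)+1)^2 := by ring
      _ ≤ ((1 + 6 * ρ) * (1 - δ)) * ((l:ℝ)+1)^2 := mul_le_mul_of_nonneg_right h2 (by positivity)
      _ = ((1 + 6 * ρ) * ((l:ℝ)+1)^2) * (1 - δ) := by ring
      _ ≤ _ := mul_le_mul_of_nonneg_right h1 h3
  · rw [hδ, show (k:ℝ) * (ρ / (16 * k^2)) = ρ / (8 * k) / 2 by field_simp; ring]
    have : 0 < ρ / (8 * k) := by positivity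
    linarith
  · have hd : δ₁^2 ≤ δ₁ := by nlinarith
    calc (k:ℝ) * ((l:ℝ)^2 * δ₁^2 * (1 + k)^(2*l)) = k * Z * δ₁^2 := by rw [hZ]; ring
      _ ≤ k * Z * δ₁ := mul_le_mul_of_nonneg_left hd (by positivity)
      _ = ρ / (8 * k) := by rw [hδ₁]; field_simp

set_option maxHeartbeats 4000000 in
theorem good_lower (ϑ : ℝ) (hϑ : 1/2 < ϑ) (hLD : HasLevelOfDistribution ϑ) :
    ∃ (k : ℕ) (δ μ : ℝ), 2 ≤ k ∧ 0 < δ ∧ δ < 1 ∧ 0 < μ ∧ μ ≤ 1/8 ∧ ∀ B : ℕ, ∃ D a : ℕ, B ≤ D ∧ Ctx k δ D.factorial a ∧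
      ∃ (c s : ℝ) (N₀ : ℕ), 0 < c ∧ 0 < s ∧ ∀ N : ℕ, N₀ ≤ N → ∀ (M : ℕ) (H : Finset ℕ), Tup k D.factorial M H →
        extra D.factorial M ≤ δ → Real.log M ≤ s * Real.log N → (∀ h ∈ H, h ≤ N) →
        c * (N / (Real.log N) ^ k) ≤ (GoodS D.factorial ((N:ℝ)^μ) N H).card := by
  obtain ⟨τ, ρ, δ, δ₁, l, k, hk, hl, hτ, hτϑ, hτ1, hδ, hδ1, hδ₁, hδ₁1, hρ, hρ1, hmain, hb1, hb2⟩ := params ϑ hϑ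
  have hkn : 9 ≤ k := by rw [hk]; nlinarith
  have hk1 : (1:ℝ) ≤ k := by exact_mod_cast (by omega : 1 ≤ k)
  have hμ8 : δ₁ * τ ≤ 1/8 := by nlinarith
  have hμ0 : 0 < δ₁ * τ := by positivity
  refine ⟨k, δ, δ₁ * τ, by omega, hδ, hδ1, hμ0, hμ8, fun B => ?_⟩
  obtain ⟨D, a, hBD, hc⟩ := exists_ctx k δ hδ B
  refine ⟨D, a, hBD, hc, ?_⟩
  set W := D.factorial with hW
  have hW0 : (0:ℝ) < W := by exact_mod_cast hc.hW
  set K := (1 + (k:ℝ)) ^ (2*l) with hK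
  have hK0 : 0 < K := by positivity
  obtain ⟨B', hB'⟩ := exists_nat_ge (2 * k / (δ₁ * τ))
  have hB2 : 2 * (k:ℝ) ≤ B' * (δ₁ * τ) := by rwa [div_le_iff₀ hμ0] at hB'
  set q := (2*(l:ℝ)+1) * k with hq
  have hq0 : 0 < q := by positivity
  set s := δ * τ / (2 * (a + 1) * q) with hs
  have hs0 : 0 < s := by positivity
  obtain ⟨N1, hN1⟩ := lod_err ϑ τ W (9 * k) hc.hW hLD hτ hτϑ (by linarith) k
  obtain ⟨N2, hN23, hN2⟩ := log_ge_eventually (max (max 1 (2 * q / (δ * τ))) (max (2 / ρ) (4 * W * k * (K * 4 ^ k) / ρ)))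
  obtain ⟨N3, hN3⟩ := pow_log_small (8 * W / ρ * (k^2 * K * 4^(10*k))) (10*k) (1/8) (by norm_num)
  refine ⟨ρ / W / (2 * k * (9 ^ B' * (K * 4 ^ k))), s, max N1 (max N2 N3), by positivity, hs0, ?_⟩
  intro N hN M H ht hex hM hHN
  have g1 : N1 ≤ N := le_trans (le_max_left _ _) hN
  have g2 : N2 ≤ N := le_trans ((le_max_left _ _).trans (le_max_right _ _)) hN
  have g3 : N3 ≤ N := le_trans ((le_max_right _ _).trans (le_max_right _ _)) hN
  have hbig := hN2 N g2
  have y1 : 1 ≤ Real.log N := le_trans ((le_max_left _ _).trans (le_max_left _ _)) hbig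
  have y2 : 2 * q / (δ * τ) ≤ Real.log N := le_trans ((le_max_right _ _).trans (le_max_left _ _)) hbig
  have y3 : 2 / ρ ≤ Real.log N := le_trans ((le_max_left _ _).trans (le_max_right _ _)) hbig
  have y4 : 4 * W * k * (K * 4 ^ k) / ρ ≤ Real.log N := le_trans ((le_max_right _ _).trans (le_max_right _ _)) hbig
  have hlod := hN1 N g1
  have hsm := hN3 N g3
  have hNge : 3 ≤ N := by omega
  have hN0 : (0:ℝ) < N := by exact_mod_cast (by omega : 0 < N)
  have hN1' : (1:ℝ) ≤ N := by exact_mod_cast (by omega : 1 ≤ N)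
  set y := Real.log N with hy
  have hl3 : Real.log 3 ≤ 2 := by
    have := Real.log_le_sub_one_of_pos (show (0:ℝ) < 3 by norm_num); linarith
  have hl3N : Real.log (3 * N) = Real.log 3 + y := Real.log_mul (by norm_num) hN0.ne'
  have hρy : 2 ≤ ρ * y := by rw [div_le_iff₀ hρ] at y3; linarith
  have hL3 : Real.log (3 * N) ≤ (1 + ρ) * y := by rw [hl3N]; linarith
  have hE : (2*(l:ℝ)+1) * k * (1 + a * Real.log M) ≤ δ * (τ * y) := by
    have hδτ : 0 < δ * τ := by positivity
    have e1 : 2 * q ≤ δ * τ * y := by rw [div_le_iff₀ hδτ] at y2; linarith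
    have e2 : q * (a * Real.log M) ≤ δ * τ * y / 2 := by
      have hlM : 0 ≤ Real.log M := Real.log_natCast_nonneg M
      calc q * (a * Real.log M) ≤ q * ((a + 1) * (s * y)) := by
            refine mul_le_mul_of_nonneg_left ?_ hq0.le
            exact mul_le_mul (by linarith) hM hlM (by positivity)
        _ = _ := by rw [hs]; field_simp
    rw [← hq]
    linarith
  have he2 : 4 * W * k * (K * 4 ^ k) ≤ ρ * y := by rw [div_le_iff₀ hρ] at y4; linarith
  have hB3 : k * Real.log (3 * N) ≤ B' * (δ₁ * τ * y) := by
    have : Real.log (3 * N) ≤ 2 * y := by nlinarith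
    calc k * Real.log (3 * N) ≤ k * (2 * y) := mul_le_mul_of_nonneg_left this (by linarith)
      _ = 2 * k * y := by ring
      _ ≤ B' * (δ₁ * τ) * y := mul_le_mul_of_nonneg_right hB2 (by linarith)
      _ = _ := by ring
  have he1 : (2 + 2 * (k:ℝ)^2 * (N:ℝ)^(δ₁*τ)) * (K * (4 * y) ^ k * (((N:ℝ)^τ)^2 * (1 + 2 * y)^(9*k)))
      ≤ ρ / 2 * (N / W) := by
    have hz1 : 1 ≤ (N:ℝ)^(δ₁*τ) := Real.one_le_rpow hN1' hμ0.le
    have f1 : 2 + 2 * (k:ℝ)^2 * (N:ℝ)^(δ₁*τ) ≤ 4 * k^2 * (N:ℝ)^(δ₁*τ) := by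
      have : 1 ≤ (k:ℝ)^2 * (N:ℝ)^(δ₁*τ) := one_le_mul_of_one_le_of_one_le (one_le_pow₀ hk1) hz1
      linarith
    have f2 : (1 + 2 * y)^(9*k) ≤ (4 * y)^(9*k) := pow_le_pow_left₀ (by linarith) (by linarith) _
    have f3 : (N:ℝ)^(δ₁*τ) * ((N:ℝ)^τ)^2 ≤ (N:ℝ)^((7:ℝ)/8) := by
      rw [← Real.rpow_natCast, ← Real.rpow_mul hN0.le, ← Real.rpow_add hN0]
      refine Real.rpow_le_rpow_of_exponent_le hN1' ?_
      push_cast; linarith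
    have f4 : (N:ℝ)^((7:ℝ)/8) * (N:ℝ)^((1:ℝ)/8) = N := by
      rw [← Real.rpow_add hN0]; norm_num
    calc _ ≤ (4 * k^2 * (N:ℝ)^(δ₁*τ)) * (K * (4 * y) ^ k * (((N:ℝ)^τ)^2 * (4 * y)^(9*k))) := by
          refine mul_le_mul f1 ?_ (by positivity) (by positivity)
          refine mul_le_mul_of_nonneg_left ?_ (by positivity)
          exact mul_le_mul_of_nonneg_left f2 (by positivity)
      _ = (4 * k^2 * K * (4*y)^(10*k)) * ((N:ℝ)^(δ₁*τ) * ((N:ℝ)^τ)^2) := by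
          rw [show 10 * k = k + 9 * k by ring, pow_add]; ring
      _ ≤ (4 * k^2 * K * (4*y)^(10*k)) * (N:ℝ)^((7:ℝ)/8) := mul_le_mul_of_nonneg_left f3 (by positivity)
      _ = (ρ / 2 / W) * ((N:ℝ)^((7:ℝ)/8) * (8 * W / ρ * (k^2 * K * 4^(10*k)) * y ^ (10*k))) := by
          rw [mul_pow 4 y (10*k)]; field_simp; ring
      _ ≤ (ρ / 2 / W) * ((N:ℝ)^((7:ℝ)/8) * (N:ℝ)^((1:ℝ)/8)) := by
          refine mul_le_mul_of_nonneg_left ?_ (by positivity)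
          exact mul_le_mul_of_nonneg_left hsm (by positivity)
      _ = _ := by rw [f4]; ring
  have hfin := good_det (l := l) hc ht hk hl hδ hδ1 N hNge τ δ₁ ρ hτ (by linarith) hδ₁ (by linarith) hρ hρ1 hmain hb1 hb2 hex hHN hE hL3
    hlod he2 he1 B' hB3
  rw [div_mul_eq_mul_div, div_le_iff₀ (by positivity)]
  have hyk : (4 * y) ^ k = 4 ^ k * y ^ k := mul_pow _ _ _
  have hyk0 : 0 < y ^ k := by positivity
  rw [← mul_div_assoc, div_le_iff₀ hyk0]
  rw [← hy, hyk] at hfin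
  calc ρ / W * N = ρ * (N / W) := by ring
    _ ≤ _ := hfin
    _ = _ := by ring

end GPY

namespace GPY

open Classical in
noncomputable def RoughS (W : ℕ) (z : ℝ) (N : ℕ) (H : Finset ℕ) : Finset ℕ :=
  ((Ioc N (2*N)).filter (fun n => n % W = 1 % W)).filter (fun n => Rough W z H n)

theorem rough_det {k W a M : ℕ} {δ z : ℝ} {H : Finset ℕ} (hc : Ctx k δ W a) (hcard : H.card = k + 1) (hM : M ≠ 0) (hWM : W ∣ M)
    (dist : ∀ p : ℕ, p.Prime → ¬ p ∣ M → ∀ h ∈ H, ∀ h' ∈ H, h % p = h' % p → h = h') (N : ℕ) (hz : 1 < z) :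
    ((RoughS W z N H).card : ℝ) ≤ (N:ℝ) / W / (om M * (Real.log z / ((k + 1 : ℕ):ℝ))) ^ (k+1) + z^2 * (1 + Real.log (z^2)) ^ (9 * (k + 1)) := by
  classical
  set K := k + 1 with hK
  set P := Pset M z with hP
  have hPp := hc.P (R := z) hWM
  set V := TT P K K 0 z with hV
  have hPk : ∀ p ∈ P, p.Prime ∧ 2 * K < p := fun p hp => ⟨(hPp p hp).1, (hPp p hp).2.2.2.1⟩
  have h := S1_asym P K 0 (by omega) z hz.le hPk H hcard
    (fun p hp => dist p (hPp p hp).1 (hPp p hp).2.1) N W 1 hc.hW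
    (fun p hp hd => absurd hd (hPp p hp).2.2.1)
  rw [QQ_congr _ _ _ _ (kapm K W) (kap K) (by
    intro p hp
    rw [kapm, if_neg (hPp p hp).2.2.1, kap]), Q1_eq P K 0 (by omega) z (fun p hp => by have := hPk p hp; omega)] at h
  simp only [mul_zero, pow_zero, one_mul] at h
  rw [← hV] at h
  have hK0 : (0:ℝ) < K := by exact_mod_cast (by omega : 0 < K)
  have hlz : 0 < Real.log z := Real.log_pos hz
  set U := (om M * (Real.log z / ((K : ℕ):ℝ))) ^ K with hU
  have hU0 : 0 < U := by
    have := om_pos M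
    positivity
  have hVU : U ≤ V := by
    set x := z ^ (1 / (K:ℝ)) with hx
    have hx1 : 1 ≤ x := Real.one_le_rpow hz.le (by positivity)
    have hxK : x ^ K = z := by
      rw [hx, ← Real.rpow_natCast, ← Real.rpow_mul (by linarith)]
      rw [one_div_mul_cancel hK0.ne', Real.rpow_one]
    have hlx : Real.log x = Real.log z / K := by rw [hx, Real.log_rpow (by linarith)]; ring
    have hxz : x ≤ z := by
      calc x ≤ x ^ K := le_self_pow₀ hx1 (by omega)
        _ = z := hxK
    have := U_lower P M hM x hx1 K (fun p hp hpM hpx => mem_Pset.2 ⟨hp, hpM, hpx.trans hxz⟩)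
      (fun p hp => ⟨(hPk p hp).1, by have := hPk p hp; omega⟩) K le_rfl
    rw [hxK, hlx] at this
    rw [hU, hV, TT]
    simpa using this
  have hV0 : 0 < V := lt_of_lt_of_le hU0 hVU
  have hlow : (RoughS W z N H).card * V ^ 2 ≤ ∑ n ∈ (Ioc N (2*N)).filter (fun n => n % W = 1 % W), (Lam P K 0 z H n) ^ 2 := by
    have : ∀ n ∈ RoughS W z N H, (Lam P K 0 z H n) ^ 2 = V ^ 2 := by
      intro n hn
      unfold RoughS at hn
      have hr := (mem_filter.1 hn).2
      congr 1
      unfold Lam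
      have e : (DD P z).filter (fun D => ∀ p ∈ D, p ∣ tuplePoly H n) = {∅} := by
        ext D
        rw [mem_filter, mem_singleton, mem_DD]
        constructor
        · rintro ⟨⟨h1, h2⟩, h3⟩
          by_contra hne
          obtain ⟨p, hp⟩ := nonempty_iff_ne_empty.2 hne
          have := hPp p (h1 hp)
          exact hr p this.1 this.2.2.1 this.2.2.2.2 (h3 p hp)
        · rintro rfl
          exact ⟨mem_DD.1 (empty_mem_DD hz.le), by simp⟩
      rw [e, sum_singleton, lamb_empty]
    calc ((RoughS W z N H).card : ℝ) * V ^ 2 = ∑ n ∈ RoughS W z N H, V ^ 2 := by rw [sum_const, nsmul_eq_mul]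
      _ = ∑ n ∈ RoughS W z N H, (Lam P K 0 z H n) ^ 2 := (sum_congr rfl this).symm
      _ ≤ _ := by
          unfold RoughS
          exact sum_le_sum_of_subset_of_nonneg (filter_subset _ _) fun _ _ _ => sq_nonneg _
  have h2 := (abs_le.1 h).2
  have h3 : ((RoughS W z N H).card : ℝ) * V ^ 2 ≤ ((N:ℝ) / W / V + z^2 * (1 + Real.log (z^2)) ^ (9 * K)) * V ^ 2 := by
    have : ((N:ℝ) / W / V + z^2 * (1 + Real.log (z^2)) ^ (9 * K)) * V ^ 2 = (N:ℝ) / W * V + V^2 * (z^2 * (1 + Real.log (z^2)) ^ (9 * K)) := by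
      field_simp
    rw [this]
    linarith
  have h4 := le_of_mul_le_mul_right h3 (by positivity)
  refine h4.trans (add_le_add ?_ le_rfl)
  exact div_le_div_of_nonneg_left (by positivity) hU0 hVU

theorem rough_upper {k W a : ℕ} {δ μ : ℝ} (hc : Ctx k δ W a) (hμ : 0 < μ) (hμ8 : μ ≤ 1/8) : ∃ (C : ℝ) (N₀ : ℕ), 0 < C ∧ ∀ N : ℕ, N₀ ≤ N →
    ∀ (M : ℕ) (H : Finset ℕ), H.card = k + 1 → M ≠ 0 → W ∣ M → 
    (∀ p : ℕ, p.Prime → ¬ p ∣ M → ∀ h ∈ H, ∀ h' ∈ H, h % p = h' % p → h = h') →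
    ((RoughS W ((N:ℝ)^μ) N H).card : ℝ) ≤ C * (N / (Real.log N) ^ (k+1)) * (1 / om M) ^ (k + 1) := by
  set K := k + 1 with hK
  have hK0 : (0:ℝ) < K := by exact_mod_cast (by omega : 0 < K)
  obtain ⟨N1, hN13, hN1⟩ := log_ge_eventually 1
  obtain ⟨N2, hN2⟩ := pow_log_small (4 ^ (9 * K)) (10 * K) (1/2) (by norm_num)
  have hW0 : (0:ℝ) < W := by exact_mod_cast hc.hW
  refine ⟨1 / W / (μ / K) ^ K + 1, max N1 N2, by positivity, ?_⟩
  intro N hN M H hcard hM hWM dist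
  have y1 := hN1 N ((le_max_left _ _).trans hN)
  have hsm := hN2 N ((le_max_right _ _).trans hN)
  have hN3 : 3 ≤ N := by have := (le_max_left _ _).trans hN; omega
  have hN1' : (1:ℝ) < N := by exact_mod_cast (by omega : 1 < N)
  have hN0 : (0:ℝ) < N := by linarith
  set y := Real.log N with hy
  set z := (N:ℝ)^μ with hz
  have hz1 : 1 < z := Real.one_lt_rpow hN1' hμ
  have hlz : Real.log z = μ * y := Real.log_rpow hN0 _
  have h := rough_det hc hcard hM hWM dist N hz1
  refine h.trans ?_
  rw [← hK]
  have hoM := om_pos M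
  have hoM1 := om_le_one M
  have hy0 : 0 < y := by linarith
  have t1 : (N:ℝ) / W / (om M * (Real.log z / (K:ℝ))) ^ K = 1 / W / (μ / K) ^ K * (N / y ^ K) * (1 / om M) ^ K := by
    rw [hlz, show om M * (μ * y / (K:ℝ)) = om M * (μ / K) * y by ring, mul_pow, mul_pow, one_div_pow]
    field_simp
  have t2 : z^2 * (1 + Real.log (z^2)) ^ (9 * K) ≤ N / y ^ K := by
    rw [le_div_iff₀ (by positivity)]
    have a1 : Real.log (z^2) ≤ y := by rw [Real.log_pow, hlz]; push_cast; nlinarith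
    have a0 : 0 ≤ Real.log (z^2) := Real.log_nonneg (by nlinarith)
    have a2 : z^2 ≤ (N:ℝ)^((1:ℝ)/2) := by
      rw [hz, ← Real.rpow_natCast, ← Real.rpow_mul hN0.le]
      refine Real.rpow_le_rpow_of_exponent_le hN1'.le ?_
      push_cast; linarith
    have a3 : (1 + Real.log (z^2)) ^ (9 * K) ≤ (4 * y) ^ (9 * K) := pow_le_pow_left₀ (by linarith) (by linarith) _
    have a4 : (N:ℝ)^((1:ℝ)/2) * (N:ℝ)^((1:ℝ)/2) = N := by rw [← Real.rpow_add hN0]; norm_num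
    calc z^2 * (1 + Real.log (z^2)) ^ (9 * K) * y ^ K ≤ (N:ℝ)^((1:ℝ)/2) * (4 * y) ^ (9 * K) * y ^ K := by
          refine mul_le_mul_of_nonneg_right ?_ (by positivity)
          exact mul_le_mul a2 a3 (by positivity) (by positivity)
      _ = (N:ℝ)^((1:ℝ)/2) * (4 ^ (9 * K) * y ^ (10 * K)) := by
          rw [mul_pow, show 10 * K = 9 * K + K by ring, pow_add]; ring
      _ ≤ (N:ℝ)^((1:ℝ)/2) * (N:ℝ)^((1:ℝ)/2) := mul_le_mul_of_nonneg_left hsm (by positivity)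
      _ = N := a4
  have t3 : 1 ≤ (1 / om M) ^ K := one_le_pow₀ ((one_le_div hoM).2 hoM1)
  have t4 : 0 ≤ (N:ℝ) / y ^ K := by positivity
  rw [t1, add_mul, add_mul, one_mul]
  refine add_le_add le_rfl (t2.trans ?_)
  exact le_mul_of_one_le_right t4 t3

end GPY

namespace GPY

def ad (i j : ℕ) : ℕ := (i - j) + (j - i)

theorem ad_pos {i j : ℕ} (h : i ≠ j) : 0 < ad i j := by unfold ad; omega

theorem ad_comm (i j : ℕ) : ad i j = ad j i := by unfold ad; omega

theorem sum_ad_le (Y i : ℕ) (hi : i < Y) (f : ℕ → ℝ) (hf : ∀ e, 0 ≤ f e) :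
    ∑ j ∈ (range Y).erase i, f (ad i j) ≤ 2 * ∑ e ∈ Icc 1 Y, f e := by
  rw [← sum_filter_add_sum_filter_not _ (fun j => j < i), two_mul]
  have key : ∀ s : Finset ℕ, (∀ j ∈ s, ad i j ∈ Icc 1 Y) → Set.InjOn (ad i) s → ∑ j ∈ s, f (ad i j) ≤ ∑ e ∈ Icc 1 Y, f e := by
    intro s hs hinj
    rw [← sum_image (f := f) hinj]
    refine sum_le_sum_of_subset_of_nonneg ?_ fun _ _ _ => hf _
    intro e he
    obtain ⟨j, hj, rfl⟩ := mem_image.1 he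
    exact hs j hj
  refine add_le_add (key _ ?_ ?_) (key _ ?_ ?_)
  · intro j hj
    simp only [mem_filter, mem_erase, mem_range] at hj
    rw [mem_Icc]; unfold ad; omega
  · intro j hj j' hj'
    simp only [mem_filter, mem_erase, mem_range, coe_filter, Set.mem_ofPred_eq] at hj hj'
    unfold ad; omega
  · intro j hj
    simp only [mem_filter, mem_erase, mem_range] at hj
    rw [mem_Icc]; unfold ad; omega
  · intro j hj j' hj'
    simp only [mem_filter, mem_erase, mem_range, coe_filter, Set.mem_ofPred_eq] at hj hj'
    unfold ad; omega

theorem extra_nonneg (W e : ℕ) : 0 ≤ extra W e := sum_nonneg fun _ _ => by positivity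

theorem extra_self (W : ℕ) : extra W W = 0 := by
  unfold extra
  rw [filter_false_of_mem]
  · simp
  · intro p hp
    simpa using Nat.dvd_of_mem_primeFactors hp

theorem extra_mul (W a b : ℕ) (ha : a ≠ 0) (hb : b ≠ 0) : extra W (a * b) ≤ extra W a + extra W b := by
  unfold extra
  rw [Nat.primeFactors_mul ha hb, filter_union]
  have := sum_union_inter (s₁ := a.primeFactors.filter (fun p => ¬ p ∣ W)) (s₂ := b.primeFactors.filter (fun p => ¬ p ∣ W)) (f := fun p : ℕ => 1 / (p:ℝ))
  have h0 : 0 ≤ ∑ p ∈ a.primeFactors.filter (fun p => ¬ p ∣ W) ∩ b.primeFactors.filter (fun p => ¬ p ∣ W), 1 / (p:ℝ) :=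
    sum_nonneg fun _ _ => by positivity
  linarith

theorem extra_prod {ι : Type*} [DecidableEq ι] (W : ℕ) (s : Finset ι) (f : ι → ℕ) (hf : ∀ i ∈ s, f i ≠ 0) : extra W (∏ i ∈ s, f i) ≤ ∑ i ∈ s, extra W (f i) := by
  induction s using Finset.induction_on with
  | empty => simp [extra]
  | insert i s his ih =>
    rw [prod_insert his, sum_insert his]
    refine (extra_mul W _ _ (hf i (mem_insert_self _ _)) (prod_ne_zero_iff.2 fun j hj => hf j (mem_insert_of_mem hj))).trans ?_
    exact add_le_add le_rfl (ih fun j hj => hf j (mem_insert_of_mem hj))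

theorem om_mul (a b : ℕ) (ha : a ≠ 0) (hb : b ≠ 0) : om a * om b ≤ om (a * b) := by
  unfold om
  rw [Nat.primeFactors_mul ha hb, ← prod_union_inter]
  have h1 : ∏ p ∈ a.primeFactors ∩ b.primeFactors, (1 - 1 / (p:ℝ)) ≤ 1 := by
    refine prod_le_one (fun p hp => ?_) fun p hp => one_sub_inv_le
    exact (one_sub_inv_pos (Nat.prime_of_mem_primeFactors (mem_inter.1 hp).1)).le
  refine mul_le_of_le_one_right (prod_nonneg fun p hp => ?_) h1
  refine (one_sub_inv_pos ?_).le
  rcases mem_union.1 hp with h | h <;> exact Nat.prime_of_mem_primeFactors h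

theorem om_prod {ι : Type*} [DecidableEq ι] (s : Finset ι) (f : ι → ℕ) (hf : ∀ i ∈ s, f i ≠ 0) : ∏ i ∈ s, om (f i) ≤ om (∏ i ∈ s, f i) := by
  induction s using Finset.induction_on with
  | empty => simp [om]
  | insert i s his ih =>
    rw [prod_insert his, prod_insert his]
    refine le_trans ?_ (om_mul _ _ (hf i (mem_insert_self _ _)) (prod_ne_zero_iff.2 fun j hj => hf j (mem_insert_of_mem hj)))
    exact mul_le_mul_of_nonneg_left (ih fun j hj => hf j (mem_insert_of_mem hj)) (om_pos _).le

theorem card_mult (Y d : ℕ) : (((Icc 1 Y).filter (fun e => d ∣ e)).card : ℝ) ≤ (Y:ℝ) / d := by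
  have : ((Icc 1 Y).filter (fun e => d ∣ e)).card = Y / d := by
    have := Nat.Ioc_filter_dvd_card_eq_div Y d
    rw [← this]; rfl
  rw [this]
  exact Nat.cast_div_le

theorem sum_extra_le (W D Y : ℕ) (hD : 1 ≤ D) (hW : ∀ p : ℕ, p.Prime → ¬ p ∣ W → D < p) :
    ∑ e ∈ Icc 1 Y, extra W e ≤ Y / D := by
  have h1 : ∀ e ∈ Icc 1 Y, extra W e = ∑ p ∈ Pset W (Y:ℝ), if p ∣ e then 1 / (p:ℝ) else 0 := by
    intro e he
    rw [mem_Icc] at he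
    unfold extra
    rw [← sum_filter]
    refine sum_congr ?_ fun _ _ => rfl
    ext p
    rw [mem_filter, mem_filter, mem_Pset, Nat.mem_primeFactors]
    constructor
    · rintro ⟨⟨h1, h2, h3⟩, h4⟩
      refine ⟨⟨h1, h4, ?_⟩, h2⟩
      exact_mod_cast (Nat.le_of_dvd (by omega) h2).trans he.2
    · rintro ⟨⟨h1, h2, h3⟩, h4⟩
      exact ⟨⟨h1, h4, by omega⟩, h2⟩
  rw [sum_congr rfl h1, sum_comm]
  calc _ ≤ ∑ p ∈ Pset W (Y:ℝ), (Y:ℝ) * (1 / (p:ℝ)^2) := by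
        refine sum_le_sum fun p hp => ?_
        rw [← sum_filter, sum_const, nsmul_eq_mul]
        calc _ ≤ (Y:ℝ) / p * (1 / p) := mul_le_mul_of_nonneg_right (card_mult Y p) (by positivity)
          _ = _ := by ring
    _ = (Y:ℝ) * ∑ p ∈ Pset W (Y:ℝ), 1 / (p:ℝ)^2 := by rw [mul_sum]
    _ ≤ (Y:ℝ) * (1 / D) := by
        refine mul_le_mul_of_nonneg_left ?_ (Nat.cast_nonneg _)
        refine sum_inv_sq_le D hD _ fun p hp => ?_
        rw [mem_Pset] at hp
        exact hW p hp.1 hp.2.1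
    _ = _ := by ring

theorem one_add_pow_le' (x : ℝ) (hx : 0 ≤ x) (hx1 : x ≤ 1) (m : ℕ) : (1 + x) ^ m ≤ 1 + (2 ^ m - 1) * x := by
  induction m with
  | zero => simp
  | succ m ih =>
    have h2 : (1:ℝ) ≤ 2 ^ m := one_le_pow₀ (by norm_num)
    rw [pow_succ]
    calc (1 + x) ^ m * (1 + x) ≤ (1 + (2 ^ m - 1) * x) * (1 + x) := mul_le_mul_of_nonneg_right ih (by linarith)
      _ ≤ _ := by rw [pow_succ]; nlinarith [mul_nonneg (sub_nonneg.2 h2) (mul_nonneg hx (sub_nonneg.2 hx1))]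

theorem om_sum (m : ℕ) : ∃ C : ℝ, 0 < C ∧ ∀ Y : ℕ, ∑ e ∈ Icc 1 Y, (1 / om e) ^ m ≤ C * Y := by
  set c : ℝ := 2 ^ (m+1) with hc
  have hc0 : 0 < c := by positivity
  refine ⟨Real.exp c, Real.exp_pos _, fun Y => ?_⟩
  set Q := Pset 1 (Y:ℝ) with hQ
  have hQp : ∀ p ∈ Q, p.Prime := fun p hp => (mem_Pset.1 hp).1
  have h1 : ∀ e ∈ Icc 1 Y, (1 / om e) ^ m ≤ ∑ S ∈ Q.powerset, if pr S ∣ e then ∏ p ∈ S, (c / (p:ℝ)) else 0 := by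
    intro e he
    rw [mem_Icc] at he
    calc (1 / om e) ^ m = ∏ p ∈ e.primeFactors, (1 / (1 - 1 / (p:ℝ))) ^ m := by
          unfold om
          rw [prod_pow, prod_div_distrib, prod_const_one]
      _ ≤ ∏ p ∈ e.primeFactors, (1 + c / p) := by
          refine prod_le_prod (fun p hp => ?_) fun p hp => ?_
          · have := one_sub_inv_pos (Nat.prime_of_mem_primeFactors hp)
            positivity
          · have hp2 : (2:ℝ) ≤ p := by exact_mod_cast (Nat.prime_of_mem_primeFactors hp).two_le
            have hp1 : (0:ℝ) < p - 1 := by linarith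
            have e1 : 1 / (1 - 1 / (p:ℝ)) = 1 + 1 / ((p:ℝ) - 1) := by field_simp; ring
            rw [e1]
            refine (one_add_pow_le' _ (by positivity) (by rw [div_le_one hp1]; linarith) m).trans ?_
            have e2 : 1 / ((p:ℝ) - 1) ≤ 2 / p := by rw [div_le_div_iff₀ hp1 (by linarith)]; linarith
            have e3 : (0:ℝ) ≤ 2 ^ m - 1 := by linarith [one_le_pow₀ (n := m) (show (1:ℝ) ≤ 2 by norm_num)]
            have e4 := mul_le_mul_of_nonneg_left e2 e3
            have e5 : (2 ^ m - 1) * (2 / (p:ℝ)) ≤ c / p := by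
              rw [hc, pow_succ, mul_div_assoc']
              refine div_le_div_of_nonneg_right ?_ (by linarith)
              linarith
            linarith
      _ = ∑ S ∈ e.primeFactors.powerset, ∏ p ∈ S, (c / (p:ℝ)) := by rw [prod_one_add]
      _ ≤ ∑ S ∈ Q.powerset.filter (fun S => pr S ∣ e), ∏ p ∈ S, (c / (p:ℝ)) := by
          refine sum_le_sum_of_subset_of_nonneg ?_ fun _ _ _ => prod_nonneg fun _ _ => by positivity
          intro S hS
          rw [mem_powerset] at hS
          rw [mem_filter, mem_powerset]
          refine ⟨fun p hp => ?_, pr_dvd fun p hp => hS hp⟩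
          have := Nat.mem_primeFactors.1 (hS hp)
          rw [hQ, mem_Pset]
          refine ⟨this.1, this.1.not_dvd_one, ?_⟩
          exact_mod_cast (Nat.le_of_dvd (by omega) this.2.1).trans he.2
      _ = _ := by rw [sum_filter]
  refine (sum_le_sum h1).trans ?_
  rw [sum_comm]
  calc _ ≤ ∑ S ∈ Q.powerset, (Y:ℝ) * ∏ p ∈ S, (c / (p:ℝ)^2) := by
        refine sum_le_sum fun S hS => ?_
        rw [← sum_filter, sum_const, nsmul_eq_mul]
        calc _ ≤ (Y:ℝ) / (pr S : ℕ) * ∏ p ∈ S, (c / (p:ℝ)) := mul_le_mul_of_nonneg_right (card_mult Y _) (prod_nonneg fun _ _ => by positivity)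
          _ = Y * ∏ p ∈ S, (c / (p:ℝ)^2) := by
              unfold pr
              push_cast
              rw [div_mul_eq_mul_div, mul_div_assoc, ← prod_div_distrib]
              congr 1
              refine prod_congr rfl fun p _ => ?_
              rw [div_div, sq]
    _ = Y * ∏ p ∈ Q, (1 + c / (p:ℝ)^2) := by rw [← mul_sum, prod_one_add]
    _ ≤ Y * Real.exp c := by
        refine mul_le_mul_of_nonneg_left ?_ (Nat.cast_nonneg _)
        calc ∏ p ∈ Q, (1 + c / (p:ℝ)^2) ≤ ∏ p ∈ Q, Real.exp (c / (p:ℝ)^2) := by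
              refine prod_le_prod (fun _ _ => by positivity) fun p _ => ?_
              have := Real.add_one_le_exp (c / (p:ℝ)^2)
              linarith
          _ = Real.exp (c * ∑ p ∈ Q, 1 / (p:ℝ)^2) := by
              rw [← Real.exp_sum, mul_sum]
              congr 1
              refine sum_congr rfl fun p _ => by ring
          _ ≤ Real.exp c := by
              rw [Real.exp_le_exp]
              have := sum_inv_sq_le 1 le_rfl Q fun p hp => (hQp p hp).one_lt
              norm_num at this
              have h2 : ∑ p ∈ Q, 1 / (p:ℝ)^2 ≤ 1 := by simpa using this
              nlinarith
    _ = _ := by ring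

theorem prod_le_sum_pow (k : ℕ) (s : Finset ℕ) (hs : s.card = k) (hk : 1 ≤ k) (x : ℕ → ℝ) (hx : ∀ i ∈ s, 0 ≤ x i) :
    ∏ i ∈ s, x i ≤ ∑ i ∈ s, (x i) ^ k := by
  have hne : s.Nonempty := card_pos.1 (by omega)
  obtain ⟨m, hm, hmax⟩ := exists_max_image s x hne
  calc ∏ i ∈ s, x i ≤ ∏ i ∈ s, x m := prod_le_prod hx hmax
    _ = x m ^ k := by rw [prod_const, hs]
    _ ≤ _ := single_le_sum (f := fun i => (x i) ^ k) (fun i hi => pow_nonneg (hx i hi) _) hm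

end GPY

namespace GPY

def Tame (W : ℕ) (t : ℝ) (I : Finset ℕ) : Prop := ∀ i ∈ I, ∀ j ∈ I, i ≠ j → extra W (ad i j) ≤ t

open Classical in
noncomputable def TS (W : ℕ) (t : ℝ) (Y j : ℕ) : Finset (Finset ℕ) := ((range Y).powersetCard j).filter (Tame W t)

theorem mem_TS {W : ℕ} {t : ℝ} {Y j : ℕ} {I : Finset ℕ} : I ∈ TS W t Y j ↔ (I ⊆ range Y ∧ I.card = j) ∧ Tame W t I := by
  classical
  unfold TS
  rw [mem_filter, mem_powersetCard]

open Classical in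
noncomputable def badN (W : ℕ) (t : ℝ) (Y i : ℕ) : Finset ℕ := (range Y).filter (fun j => j = i ∨ t < extra W (ad i j))

open Classical in
theorem badN_card (W D Y i : ℕ) (t : ℝ) (ht : 0 < t) (hi : i < Y) (hD : 1 ≤ D) (hW : ∀ p : ℕ, p.Prime → ¬ p ∣ W → D < p) :
    ((badN W t Y i).card : ℝ) ≤ 1 + 2 * (Y / D) / t := by
  have h1 : badN W t Y i ⊆ insert i (((range Y).erase i).filter (fun j => t < extra W (ad i j))) := by
    intro j hj
    unfold badN at hj
    rw [mem_filter] at hj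
    rw [mem_insert, mem_filter, mem_erase]
    by_cases h : j = i
    · exact Or.inl h
    · exact Or.inr ⟨⟨h, hj.1⟩, hj.2.resolve_left h⟩
  have h2 : ((((range Y).erase i).filter (fun j => t < extra W (ad i j))).card : ℝ) * t ≤ 2 * (Y / D) := by
    calc _ = ∑ j ∈ ((range Y).erase i).filter (fun j => t < extra W (ad i j)), t := by rw [sum_const, nsmul_eq_mul]
      _ ≤ ∑ j ∈ ((range Y).erase i).filter (fun j => t < extra W (ad i j)), extra W (ad i j) :=
          sum_le_sum fun j hj => (mem_filter.1 hj).2.le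
      _ ≤ ∑ j ∈ (range Y).erase i, extra W (ad i j) := sum_le_sum_of_subset_of_nonneg (filter_subset _ _) fun _ _ _ => extra_nonneg _ _
      _ ≤ 2 * ∑ e ∈ Icc 1 Y, extra W e := sum_ad_le Y i hi _ fun e => extra_nonneg _ _
      _ ≤ 2 * (Y / D) := mul_le_mul_of_nonneg_left (sum_extra_le W D Y hD hW) (by norm_num)
  rw [← le_div_iff₀ ht] at h2
  have h3 : (badN W t Y i).card ≤ (((range Y).erase i).filter (fun j => t < extra W (ad i j))).card + 1 :=
    (card_le_card h1).trans (card_insert_le _ _)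
  have h4 : ((badN W t Y i).card : ℝ) ≤ (((range Y).erase i).filter (fun j => t < extra W (ad i j))).card + 1 := by exact_mod_cast h3
  linarith

theorem TS_step (W Y b j : ℕ) (t : ℝ) (hb : ∀ i < Y, (badN W t Y i).card ≤ b) :
    (TS W t Y j).card * (Y - j * b) ≤ (TS W t Y (j+1)).card * (j+1) := by
  classical
  refine card_mul_le_card_mul (fun I J => I ⊆ J) ?_ ?_
  · intro I hI
    rw [mem_TS] at hI
    set C := (range Y) \ I.biUnion (badN W t Y) with hC
    have hCc : Y - j * b ≤ C.card := by
      have h1 : (I.biUnion (badN W t Y)).card ≤ j * b := by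
        rw [← hI.1.2]
        exact card_biUnion_le_card_mul _ _ _ fun i hi => hb i (mem_range.1 (hI.1.1 hi))
      have h2 := le_card_sdiff (I.biUnion (badN W t Y)) (range Y)
      rw [card_range] at h2
      exact (Nat.sub_le_sub_left h1 Y).trans h2
    have hnot : ∀ c ∈ C, ∀ i ∈ I, c ≠ i ∧ extra W (ad i c) ≤ t := by
      intro c hc i hi
      rw [hC, mem_sdiff, mem_biUnion] at hc
      have : c ∉ badN W t Y i := fun h => hc.2 ⟨i, hi, h⟩
      unfold badN at this
      rw [mem_filter] at this
      push Not at this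
      exact this hc.1
    have hnI : ∀ c ∈ C, c ∉ I := fun c hc hcI => (hnot c hc c hcI).1 rfl
    refine hCc.trans ?_
    refine card_le_card_of_injOn (fun c => insert c I) ?_ ?_
    · intro c hc
      have hc' := mem_coe.1 hc
      rw [mem_coe, mem_bipartiteAbove, mem_TS]
      have hcI := hnI c hc'
      refine ⟨⟨⟨?_, ?_⟩, ?_⟩, subset_insert _ _⟩
      · refine insert_subset ?_ hI.1.1
        exact (mem_sdiff.1 hc').1
      · rw [card_insert_of_notMem hcI, hI.1.2]
      · intro x hx y hy hxy
        rw [mem_insert] at hx hy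
        rcases hx with rfl | hx <;> rcases hy with rfl | hy
        · exact absurd rfl hxy
        · rw [ad_comm]; exact (hnot _ hc' _ hy).2
        · exact (hnot _ hc' _ hx).2
        · exact hI.2 x hx y hy hxy
    · intro c hc c' hc' he
      have h1 := hnI c (mem_coe.1 hc)
      have : c ∈ insert c' I := by
        have := mem_insert_self c I
        simp only at he
        rwa [he] at this
      rw [mem_insert] at this
      exact this.resolve_right h1
  · intro J hJ
    rw [mem_TS] at hJ
    calc _ ≤ (J.powersetCard j).card := by
          refine card_le_card ?_
          intro I hI
          rw [mem_bipartiteBelow, mem_TS] at hI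
          rw [mem_powersetCard]
          exact ⟨hI.2, hI.1.1.2⟩
      _ = j + 1 := by rw [card_powersetCard, hJ.1.2, Nat.choose_succ_self_right]

theorem TS_card (W Y b k : ℕ) (t : ℝ) (hk : 1 ≤ k) (hb : ∀ i < Y, (badN W t Y i).card ≤ b) (hbY : 2 * (k * b) ≤ Y) (j : ℕ) (hj : j ≤ k) :
    ((Y:ℝ) / (2 * k)) ^ j ≤ (TS W t Y j).card := by
  have hk0 : (0:ℝ) < k := by exact_mod_cast hk
  induction j with
  | zero =>
    rw [pow_zero]
    have : (∅ : Finset ℕ) ∈ TS W t Y 0 := by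
      rw [mem_TS]; refine ⟨⟨empty_subset _, rfl⟩, ?_⟩
      intro i hi; simp at hi
    exact_mod_cast card_pos.2 ⟨_, this⟩
  | succ j ih =>
    have h1 := TS_step W Y b j t hb
    have ih := ih (by omega)
    have h2 : Y ≤ 2 * (Y - j * b) := by
      have : j * b ≤ k * b := Nat.mul_le_mul_right _ (by omega)
      omega
    have h3 : (Y:ℝ) ≤ 2 * ((Y - j * b : ℕ) : ℝ) := by exact_mod_cast h2
    have h4 : ((TS W t Y j).card : ℝ) * ((Y - j * b : ℕ) : ℝ) ≤ (TS W t Y (j+1)).card * ((j+1 : ℕ):ℝ) := by exact_mod_cast h1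
    have h5 : ((j+1 : ℕ):ℝ) ≤ k := by exact_mod_cast hj
    rw [pow_succ, ← mul_div_assoc, div_le_iff₀ (by positivity)]
    have h0 : (0:ℝ) ≤ (TS W t Y (j+1)).card := Nat.cast_nonneg _
    calc ((Y:ℝ) / (2 * k)) ^ j * Y ≤ (TS W t Y j).card * (2 * ((Y - j * b : ℕ) : ℝ)) := mul_le_mul ih h3 (Nat.cast_nonneg _) (Nat.cast_nonneg _)
      _ ≤ 2 * ((TS W t Y (j+1)).card * ((j+1 : ℕ):ℝ)) := by linarith
      _ ≤ 2 * ((TS W t Y (j+1)).card * k) := by nlinarith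
      _ = _ := by ring

def MM (W : ℕ) (I : Finset ℕ) : ℕ := W * ∏ x ∈ I.offDiag, ad x.1 x.2

theorem dvd_ad {W i j p : ℕ} (h : (W * i) % p = (W * j) % p) : p ∣ W * ad i j := by
  rcases le_total i j with hij | hij
  · have h1 := (Nat.modEq_iff_dvd' (Nat.mul_le_mul_left W hij)).1 h
    rw [← Nat.mul_sub] at h1
    have : ad i j = j - i := by unfold ad; omega
    rwa [this]
  · have h1 := (Nat.modEq_iff_dvd' (Nat.mul_le_mul_left W hij)).1 h.symm
    rw [← Nat.mul_sub] at h1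
    have : ad i j = i - j := by unfold ad; omega
    rwa [this]

theorem ad_dvd_MM {W i j : ℕ} {I : Finset ℕ} (hi : i ∈ I) (hj : j ∈ I) (hij : i ≠ j) : W * ad i j ∣ MM W I := by
  unfold MM
  exact Nat.mul_dvd_mul_left W (dvd_prod_of_mem (fun x : ℕ × ℕ => ad x.1 x.2) (mem_offDiag.2 ⟨hi, hj, hij⟩ : (i, j) ∈ I.offDiag))

theorem prod_ad_ne (I : Finset ℕ) : ∏ x ∈ I.offDiag, ad x.1 x.2 ≠ 0 :=
  prod_ne_zero_iff.2 fun x hx => (ad_pos (mem_offDiag.1 hx).2.2).ne'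

theorem MM_ne {W : ℕ} (hW : 0 < W) (I : Finset ℕ) : MM W I ≠ 0 := Nat.mul_ne_zero hW.ne' (prod_ad_ne I)

theorem MM_tup {W k : ℕ} (hW : 0 < W) (I : Finset ℕ) (hI : I.card = k) : Tup k W (MM W I) (I.image (fun i => W * i)) := by
  refine ⟨?_, MM_ne hW I, dvd_mul_right _ _, ?_, ?_⟩
  · rw [card_image_of_injective _ (fun i j h => Nat.eq_of_mul_eq_mul_left hW h), hI]
  · intro h hh
    obtain ⟨i, _, rfl⟩ := mem_image.1 hh
    exact dvd_mul_right _ _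
  · intro p hp hpM h hh h' hh' he
    obtain ⟨i, hi, rfl⟩ := mem_image.1 hh
    obtain ⟨j, hj, rfl⟩ := mem_image.1 hh'
    by_contra hne
    have hij : i ≠ j := fun h => hne (by rw [h])
    exact hpM ((dvd_ad he).trans (ad_dvd_MM hi hj hij))

theorem MM_extra {W k : ℕ} {δ : ℝ} (hW : 0 < W) (hk : 1 ≤ k) (hδ : 0 < δ) (I : Finset ℕ) (hI : I.card = k) (ht : Tame W (δ / k^2) I) :
    extra W (MM W I) ≤ δ := by
  have hk0 : (0:ℝ) < k := by exact_mod_cast hk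
  unfold MM
  refine (extra_mul W _ _ hW.ne' (prod_ad_ne I)).trans ?_
  rw [extra_self, zero_add]
  refine (extra_prod W _ _ fun x hx => (ad_pos (mem_offDiag.1 hx).2.2).ne').trans ?_
  calc _ ≤ ∑ x ∈ I.offDiag, δ / (k:ℝ)^2 := sum_le_sum fun x hx => by
        have := mem_offDiag.1 hx
        exact ht _ this.1 _ this.2.1 this.2.2
    _ = (I.offDiag.card : ℝ) * (δ / (k:ℝ)^2) := by rw [sum_const, nsmul_eq_mul]
    _ ≤ ((k:ℝ)^2) * (δ / (k:ℝ)^2) := by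
        refine mul_le_mul_of_nonneg_right ?_ (by positivity)
        have : I.offDiag.card ≤ k ^ 2 := by rw [offDiag_card, hI, sq]; omega
        exact_mod_cast this
    _ = δ := by field_simp

theorem MM_le {W k Y : ℕ} (hW : 0 < W) (hY : 1 ≤ Y) (I : Finset ℕ) (hI : I.card = k) (hIY : I ⊆ range Y) : MM W I ≤ W * Y ^ (k^2) := by
  unfold MM
  refine Nat.mul_le_mul_left W ?_
  calc ∏ x ∈ I.offDiag, ad x.1 x.2 ≤ ∏ x ∈ I.offDiag, Y := by
        refine prod_le_prod' fun x hx => ?_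
        have := mem_offDiag.1 hx
        have h1 := mem_range.1 (hIY this.1)
        have h2 := mem_range.1 (hIY this.2.1)
        unfold ad; omega
    _ = Y ^ I.offDiag.card := by rw [prod_const]
    _ ≤ Y ^ (k^2) := by
        refine Nat.pow_le_pow_right hY ?_
        rw [offDiag_card, hI, sq]; omega

end GPY

namespace GPY

def IW (W : ℕ) (I : Finset ℕ) : Finset ℕ := I.image (fun i => W * i)

theorem ins_props {W i0 : ℕ} {I : Finset ℕ} (hW : 0 < W) (hi0 : i0 ∉ I) :
    MM W I * ∏ i ∈ I, ad i i0 ≠ 0 ∧ W ∣ MM W I * ∏ i ∈ I, ad i i0 ∧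
    (∀ p : ℕ, p.Prime → ¬ p ∣ MM W I * ∏ i ∈ I, ad i i0 → ∀ h ∈ IW W (insert i0 I), ∀ h' ∈ IW W (insert i0 I), h % p = h' % p → h = h') := by
  have hne : ∀ i ∈ I, i ≠ i0 := fun i hi h => hi0 (h ▸ hi)
  refine ⟨Nat.mul_ne_zero (MM_ne hW I) (prod_ne_zero_iff.2 fun i hi => (ad_pos (hne i hi)).ne'), Dvd.dvd.mul_right (dvd_mul_right _ _) _, ?_⟩
  intro p hp hpM h hh h' hh' he
  have key : ∀ i ∈ I, W * ad i i0 ∣ MM W I * ∏ i ∈ I, ad i i0 := fun i hi =>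
    Nat.mul_dvd_mul (dvd_mul_right _ _) (dvd_prod_of_mem (fun i => ad i i0) hi)
  obtain ⟨i, hi, rfl⟩ := mem_image.1 hh
  obtain ⟨j, hj, rfl⟩ := mem_image.1 hh'
  by_contra hcon
  have hij : i ≠ j := fun h => hcon (by rw [h])
  have hd := dvd_ad he
  rw [mem_insert] at hi hj
  rcases hi with rfl | hi <;> rcases hj with rfl | hj
  · exact hij rfl
  · rw [ad_comm] at hd; exact hpM (hd.trans (key _ hj))
  · exact hpM (hd.trans (key _ hi))
  · exact hpM (hd.trans ((ad_dvd_MM hi hj hij).trans (dvd_mul_right _ _)))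

theorem ext_sum {k W a : ℕ} {δ μ : ℝ} (hc : Ctx k δ W a) (hk : 1 ≤ k) (hδ : 0 < δ) (hδ1 : δ < 1) (hμ : 0 < μ) (hμ1 : μ ≤ 1/8) :
    ∃ (C3 : ℝ) (N₀ : ℕ), 0 < C3 ∧ ∀ N ≥ N₀, ∀ Y : ℕ, ∀ I ∈ TS W (δ / k^2) Y k,
      ∑ i0 ∈ range Y \ I, ((RoughS W ((N:ℝ)^μ) N (IW W (insert i0 I))).card : ℝ) ≤ C3 * (N / (Real.log N)^(k+1)) * Y := by
  obtain ⟨C, N₀, hC, hR⟩ := rough_upper hc hμ hμ1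
  obtain ⟨C', hC', hO⟩ := om_sum ((k+1)*k)
  have hW := hc.hW
  set g := (1 / (om W * (1 - δ))) ^ (k+1) with hg
  have hom : 0 < om W * (1 - δ) := mul_pos (om_pos W) (by linarith)
  have hg0 : 0 < g := by positivity
  have hk0 : (0:ℝ) < k := by exact_mod_cast hk
  refine ⟨C * (g * (k * (2 * C'))), N₀, by positivity, ?_⟩
  intro N hN Y I hI
  rw [mem_TS] at hI
  obtain ⟨⟨hIY, hIc⟩, hIt⟩ := hI
  set L := C * (N / (Real.log N)^(k+1)) with hL
  have hL0 : 0 ≤ L := by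
    have : 0 ≤ Real.log N := Real.log_natCast_nonneg N
    positivity
  have hMM : om W * (1 - δ) ≤ om (MM W I) := by
    refine le_trans ?_ (om_tame (M := MM W I) hW)
    exact mul_le_mul_of_nonneg_left (by linarith [MM_extra hW hk hδ I hIc hIt]) (om_pos W).le
  have h1 : ∀ i0 ∈ range Y \ I, ((RoughS W ((N:ℝ)^μ) N (IW W (insert i0 I))).card : ℝ) ≤ L * (g * ∑ i ∈ I, (1 / om (ad i i0)) ^ ((k+1)*k)) := by
    intro i0 h0
    rw [mem_sdiff] at h0
    obtain ⟨ha, hb, hd⟩ := ins_props hW h0.2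
    have hcard : (IW W (insert i0 I)).card = k + 1 := by
      unfold IW
      rw [card_image_of_injective _ (fun i j h => Nat.eq_of_mul_eq_mul_left hW h), card_insert_of_notMem h0.2, hIc]
    refine (hR N hN _ _ hcard ha hb hd).trans ?_
    refine mul_le_mul_of_nonneg_left ?_ hL0
    have hne : ∀ i ∈ I, ad i i0 ≠ 0 := fun i hi => (ad_pos (i := i) (j := i0) (fun h => h0.2 (h ▸ hi))).ne'
    have h2 : (om W * (1 - δ)) * ∏ i ∈ I, om (ad i i0) ≤ om (MM W I * ∏ i ∈ I, ad i i0) := by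
      refine le_trans ?_ (om_mul _ _ (MM_ne hW I) (prod_ne_zero_iff.2 hne))
      exact mul_le_mul hMM (om_prod I _ hne) (prod_nonneg fun i _ => (om_pos _).le) (om_pos _).le
    have hP : 0 < ∏ i ∈ I, om (ad i i0) := prod_pos fun i _ => om_pos _
    calc (1 / om (MM W I * ∏ i ∈ I, ad i i0)) ^ (k+1) ≤ (1 / ((om W * (1 - δ)) * ∏ i ∈ I, om (ad i i0))) ^ (k+1) := by
          refine pow_le_pow_left₀ (one_div_pos.2 (om_pos _)).le ?_ _
          exact one_div_le_one_div_of_le (mul_pos hom hP) h2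
      _ = g * ∏ i ∈ I, (1 / om (ad i i0)) ^ (k+1) := by
          rw [hg, prod_pow, ← mul_pow]
          congr 1
          rw [prod_div_distrib, prod_const_one]
          field_simp
      _ ≤ g * ∑ i ∈ I, ((1 / om (ad i i0)) ^ (k+1)) ^ k := by
          refine mul_le_mul_of_nonneg_left ?_ hg0.le
          exact prod_le_sum_pow k I hIc hk _ fun i _ => pow_nonneg (one_div_pos.2 (om_pos _)).le _
      _ = _ := by simp_rw [← pow_mul]
  refine (sum_le_sum h1).trans ?_
  rw [← mul_sum, ← mul_sum, sum_comm]
  have h3 : ∑ i ∈ I, ∑ i0 ∈ range Y \ I, (1 / om (ad i i0)) ^ ((k+1)*k) ≤ ∑ i ∈ I, 2 * (C' * Y) := by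
    refine sum_le_sum fun i hi => ?_
    have hnn : ∀ e, 0 ≤ (1 / om e) ^ ((k+1)*k) := fun e => pow_nonneg (one_div_pos.2 (om_pos _)).le _
    calc _ ≤ ∑ i0 ∈ (range Y).erase i, (1 / om (ad i i0)) ^ ((k+1)*k) := by
          refine sum_le_sum_of_subset_of_nonneg ?_ fun _ _ _ => hnn _
          intro j hj
          rw [mem_sdiff] at hj
          exact mem_erase.2 ⟨fun h => hj.2 (h ▸ hi), hj.1⟩
      _ ≤ 2 * ∑ e ∈ Icc 1 Y, (1 / om e) ^ ((k+1)*k) := sum_ad_le Y i (mem_range.1 (hIY hi)) (fun e => (1 / om e) ^ ((k+1)*k)) hnn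
      _ ≤ _ := mul_le_mul_of_nonneg_left (hO Y) (by norm_num)
  rw [sum_const, nsmul_eq_mul, hIc] at h3
  calc _ ≤ L * (g * (k * (2 * (C' * Y)))) := mul_le_mul_of_nonneg_left (mul_le_mul_of_nonneg_left h3 hg0.le) hL0
    _ = _ := by rw [hL]; ring

open Classical in
noncomputable def EX (W : ℕ) (z : ℝ) (N Y : ℕ) (I : Finset ℕ) : Finset ℕ :=
  GoodS W z N (IW W I) \ (range Y \ I).biUnion (fun i0 => RoughS W z N (IW W (insert i0 I)))

theorem EX_card (W : ℕ) (z : ℝ) (N Y : ℕ) (I : Finset ℕ) :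
    ((GoodS W z N (IW W I)).card : ℝ) ≤ (EX W z N Y I).card + ∑ i0 ∈ range Y \ I, ((RoughS W z N (IW W (insert i0 I))).card : ℝ) := by
  classical
  have h1 := le_card_sdiff ((range Y \ I).biUnion (fun i0 => RoughS W z N (IW W (insert i0 I)))) (GoodS W z N (IW W I))
  have h2 : ((range Y \ I).biUnion (fun i0 => RoughS W z N (IW W (insert i0 I)))).card ≤ ∑ i0 ∈ range Y \ I, (RoughS W z N (IW W (insert i0 I))).card := card_biUnion_le
  have h3 : (GoodS W z N (IW W I)).card ≤ (EX W z N Y I).card + ∑ i0 ∈ range Y \ I, (RoughS W z N (IW W (insert i0 I))).card := by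
    have : (GoodS W z N (IW W I)).card ≤ (EX W z N Y I).card + ((range Y \ I).biUnion (fun i0 => RoughS W z N (IW W (insert i0 I)))).card := by
      unfold EX
      exact Nat.sub_le_iff_le_add.1 (by convert h1)
    exact this.trans (Nat.add_le_add_left h2 _)
  exact_mod_cast h3

theorem mem_GoodS {W : ℕ} {z : ℝ} {N : ℕ} {H : Finset ℕ} {n : ℕ} : n ∈ GoodS W z N H ↔ (n ∈ Ioc N (2*N) ∧ n % W = 1 % W) ∧ Two H n ∧ Rough W z H n := by
  classical
  unfold GoodS
  rw [mem_filter, mem_filter]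

theorem EX_sub {W : ℕ} {z : ℝ} {N Y n : ℕ} {I : Finset ℕ} (h : n ∈ EX W z N Y I) : n ∈ GoodS W z N (IW W I) := by
  classical
  unfold EX at h
  exact (mem_sdiff.1 h).1

theorem EX_disj {W : ℕ} {z : ℝ} {N Y : ℕ} {I J : Finset ℕ} (hW : 0 < W) (hJ : J ⊆ range Y) (hc : I.card = J.card) (hne : I ≠ J) :
    Disjoint (EX W z N Y I) (EX W z N Y J) := by
  classical
  rw [disjoint_left]
  intro n hn hn'
  have hG := mem_GoodS.1 (EX_sub hn)
  have hG' := mem_GoodS.1 (EX_sub hn')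
  have : ¬ J ⊆ I := fun h => hne (eq_of_subset_of_card_le h hc.le).symm
  obtain ⟨i0, h0, h0'⟩ := not_subset.1 this
  unfold EX at hn
  refine (mem_sdiff.1 hn).2 (mem_biUnion.2 ⟨i0, mem_sdiff.2 ⟨hJ h0, h0'⟩, ?_⟩)
  unfold RoughS
  rw [mem_filter, mem_filter]
  refine ⟨hG.1, ?_⟩
  intro q hq hqW hqz hqd
  unfold tuplePoly IW at hqd
  rw [image_insert, prod_insert (by
    intro h
    obtain ⟨i, hi, he⟩ := mem_image.1 h
    exact h0' (Nat.eq_of_mul_eq_mul_left hW he ▸ hi))] at hqd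
  rcases (hq.dvd_mul).1 hqd with h | h
  · refine hG'.2.2 q hq hqW hqz (h.trans ?_)
    unfold tuplePoly
    exact dvd_prod_of_mem (fun h => n + h) (mem_image_of_mem _ h0)
  · exact hG.2.2 q hq hqW hqz h

end GPY

namespace GPY

theorem gap_count (N m : ℕ) (X : ℝ) (hmX : (m:ℝ) ≤ X) (S : Finset ℕ) (hS : ∀ n ∈ S, n ∈ Ioc N (2*N) ∧ ∃ h h', h < h' ∧ h' ≤ m ∧ (n + h).Prime ∧ (n + h').Prime) :
    S.card ≤ (m+1) * (gapCount N X + 1) := by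
  classical
  choose! u v huv using fun n hn => (hS n hn).2
  rw [← card_filter_add_card_filter_not (s := S) (fun n => n + m ≤ 2 * N)]
  have h2 : (S.filter (fun n => ¬ n + m ≤ 2 * N)).card ≤ m := by
    calc _ ≤ (Ioc (2*N - m) (2*N)).card := by
          refine card_le_card fun n hn => ?_
          rw [mem_filter] at hn
          have := mem_Ioc.1 (hS n hn.1).1
          rw [mem_Ioc]; omega
      _ ≤ m := by rw [Nat.card_Ioc]; omega
  have h1 : (S.filter (fun n => n + m ≤ 2 * N)).card ≤ (m+1) * gapCount N X := by
    unfold gapCount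
    refine card_le_mul_card_image_of_maps_to (f := fun n => Nat.count Nat.Prime (n + u n)) ?_ _ ?_
    · intro n hn
      rw [mem_filter] at hn
      obtain ⟨ha, hb, hp, hp'⟩ := huv n hn.1
      have hI := mem_Ioc.1 (hS n hn.1).1
      have hnth : nthPrime (Nat.count Nat.Prime (n + u n)) = n + u n := Nat.nth_count hp
      have hnth' : nthPrime (Nat.count Nat.Prime (n + u n) + 1) ≤ n + v n := by
        have : nthPrime (Nat.count Nat.Prime (n + v n)) = n + v n := Nat.nth_count hp'
        rw [← this]
        exact Nat.nth_monotone Nat.infinite_setOfPred_prime (Nat.count_strict_mono hp (by omega))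
      have hle : Nat.count Nat.Prime (n + u n) ≤ n + u n := Nat.count_le _
      rw [mem_filter, mem_range, hnth]
      refine ⟨by omega, by omega, by omega, ?_⟩
      have h3 : nthPrime (Nat.count Nat.Prime (n + u n) + 1) ≤ (n + u n) + m := by omega
      have h4 : (nthPrime (Nat.count Nat.Prime (n + u n) + 1) : ℝ) ≤ ((n + u n : ℕ) : ℝ) + m := by exact_mod_cast h3
      linarith
    · intro j _
      calc _ ≤ (Icc (nthPrime j - m) (nthPrime j)).card := by
            refine card_le_card fun n hn => ?_
            rw [mem_filter, mem_filter] at hn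
            obtain ⟨ha, hb, hp, hp'⟩ := huv n hn.1.1
            have hnth : nthPrime (Nat.count Nat.Prime (n + u n)) = n + u n := Nat.nth_count hp
            have hj : Nat.count Nat.Prime (n + u n) = j := hn.2
            rw [hj] at hnth
            rw [mem_Icc]; omega
        _ ≤ m + 1 := by rw [Nat.card_Icc]; omega
  nlinarith

theorem union_count (ϑ : ℝ) (hϑ : 1/2 < ϑ) (hLD : HasLevelOfDistribution ϑ) :
    ∃ (k : ℕ) (c1 η₁ : ℝ), 2 ≤ k ∧ 0 < c1 ∧ 0 < η₁ ∧ ∀ η, 0 < η → η < η₁ → ∃ N₀ : ℕ, ∀ N ≥ N₀, ∃ S : Finset ℕ,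
      c1 * η^k * N ≤ S.card ∧ ∀ n ∈ S, n ∈ Ioc N (2*N) ∧ ∃ h h', h < h' ∧ h' ≤ ⌊η * Real.log N⌋₊ ∧ (n + h).Prime ∧ (n + h').Prime := by
  classical
  obtain ⟨k, δ, μ, hk, hδ, hδ1, hμ, hμ1, hgood⟩ := good_lower ϑ hϑ hLD
  have hk1 : 1 ≤ k := by omega
  have hk0 : (0:ℝ) < k := by exact_mod_cast hk1
  obtain ⟨D, a, hBD, hc, c, s, N1, hc0, hs0, hG⟩ := hgood (⌈16 * (k:ℝ)^3 / δ⌉₊ + 1)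
  have hD : 16 * (k:ℝ)^3 ≤ D * δ := by
    rw [← div_le_iff₀ hδ]
    refine (Nat.le_ceil _).trans ?_
    exact_mod_cast (by omega : ⌈16 * (k:ℝ)^3 / δ⌉₊ ≤ D)
  have hD1 : 1 ≤ D := by omega
  obtain ⟨C3, N2, hC3, hE⟩ := ext_sum hc hk1 hδ hδ1 hμ hμ1
  have hWp : ∀ p : ℕ, p.Prime → ¬ p ∣ D.factorial → D < p := fun p hp h => by
    by_contra hh
    exact h (hp.dvd_factorial.2 (by omega))
  have hW := hc.hW
  generalize D.factorial = W at *
  have hW0 : (0:ℝ) < W := by exact_mod_cast hW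
  refine ⟨k, (1 / (4 * k * W)) ^ k * (c / 2), min 1 (c * W / (2 * C3)), hk, by positivity, by positivity, ?_⟩
  intro η hη hη1
  have hηa : η ≤ 1 := (hη1.trans_le (min_le_left _ _)).le
  have hηb : η * (2 * C3) ≤ c * W := by
    rw [← le_div_iff₀ (by positivity)]; exact (hη1.trans_le (min_le_right _ _)).le
  obtain ⟨N3, hN3⟩ := pow_log_small W (k^2) s hs0
  have hlog : Filter.Tendsto (fun N : ℕ => Real.log N) Filter.atTop Filter.atTop := Real.tendsto_log_atTop.comp tendsto_natCast_atTop_atTop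
  obtain ⟨N4, hN4⟩ := Filter.eventually_atTop.1 (hlog.eventually_ge_atTop (max 1 ((4 * k + 1) * W / η)))
  refine ⟨max (max N1 N2) (max N3 N4), ?_⟩
  intro N hN
  have hl := hN4 N (by omega)
  set L := Real.log N with hLdef
  have hL1 : 1 ≤ L := (le_max_left _ _).trans hl
  have hL2 : (4 * k + 1) ≤ η * L / W := by
    have := (le_max_right _ _).trans hl
    rw [div_le_iff₀ hη] at this
    rw [le_div_iff₀ hW0]; linarith
  have hL0 : 0 < L := by linarith
  have hNpos : 0 < N := by
    rcases Nat.eq_zero_or_pos N with h | h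
    · rw [h] at hLdef; simp at hLdef; linarith
    · exact h
  have hN0 : (0:ℝ) < N := by exact_mod_cast hNpos
  set Y := ⌊η * L / W⌋₊ with hY
  have hYle : (Y:ℝ) ≤ η * L / W := Nat.floor_le (by positivity)
  have hYgt : η * L / W < Y + 1 := Nat.lt_floor_add_one _
  have hY4 : (4:ℝ) * k ≤ Y := by linarith
  have hk2 : (2:ℝ) ≤ k := by exact_mod_cast hk
  have hYh : η * L / W / 2 ≤ Y := by linarith
  have hY1 : 1 ≤ Y := by
    have : (1:ℝ) ≤ Y := by linarith
    exact_mod_cast this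
  have hWY : (W:ℝ) * Y ≤ η * L := by
    rw [le_div_iff₀ hW0] at hYle; linarith
  have hηL : η * L ≤ L := by nlinarith
  have hLN : L ≤ N := (Real.log_le_sub_one_of_pos hN0).trans (by linarith)
  have hYL : (Y:ℝ) ≤ L := by
    have : (1:ℝ) ≤ W := by exact_mod_cast hW
    nlinarith
  set t := δ / (k:ℝ)^2 with ht
  have ht0 : 0 < t := by positivity
  set b := ⌊1 + 2 * ((Y:ℝ) / D) / t⌋₊ with hb
  have hD0 : (0:ℝ) < D := by exact_mod_cast hD1
  have hTS := TS_card W Y b k t hk1 (fun i hi => Nat.le_floor (badN_card W D Y i t ht0 hi hD1 hWp)) (by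
    have h1 : (b:ℝ) ≤ 1 + 2 * ((Y:ℝ) / D) / t := Nat.floor_le (by positivity)
    have h2 : 2 * ((Y:ℝ) / D) / t * (8 * k) ≤ Y := by
      rw [ht]
      have : 2 * ((Y:ℝ) / D) / (δ / (k:ℝ)^2) * (8 * k) = Y * (16 * (k:ℝ)^3 / (D * δ)) := by field_simp; ring
      rw [this]
      refine mul_le_of_le_one_right (Nat.cast_nonneg _) ?_
      exact (div_le_one (by positivity)).2 hD
    have h3 : (2:ℝ) * (k * b) ≤ Y := by nlinarith
    exact_mod_cast h3) k le_rfl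
  set z := (N:ℝ)^μ with hz
  have hEX : ∀ I ∈ TS W t Y k, c / 2 * (N / L^k) ≤ (EX W z N Y I).card := by
    intro I hI
    have hI' := mem_TS.1 hI
    obtain ⟨⟨hIY, hIc⟩, hIt⟩ := hI'
    have hMpos : 0 < MM W I := Nat.pos_of_ne_zero (MM_ne hW I)
    have h1 := hG N (by omega) (MM W I) (IW W I) (MM_tup hW I hIc) (MM_extra hW hk1 hδ I hIc hIt) (by
      rw [← Real.log_rpow hN0]
      refine Real.log_le_log (by exact_mod_cast hMpos) ?_
      have h2 : ((MM W I : ℕ):ℝ) ≤ W * (Y:ℝ) ^ (k^2) := by exact_mod_cast MM_le hW hY1 I hIc hIY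
      refine h2.trans (le_trans ?_ (hN3 N (by omega)))
      exact mul_le_mul_of_nonneg_left (pow_le_pow_left₀ (Nat.cast_nonneg _) hYL _) hW0.le) (by
      intro h hh
      obtain ⟨i, hi, rfl⟩ := mem_image.1 hh
      have h3 : W * i ≤ W * Y := Nat.mul_le_mul_left _ (mem_range.1 (hIY hi)).le
      have h4 : ((W * Y : ℕ):ℝ) ≤ N := by push_cast; linarith
      have h5 : W * Y ≤ N := by exact_mod_cast h4
      exact h3.trans h5)
    have h2 := EX_card W z N Y I
    have h3 := hE N (by omega) Y I hI
    have h4 : C3 * (N / L^(k+1)) * Y ≤ c / 2 * (N / L^k) := by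
      calc C3 * (N / L^(k+1)) * Y ≤ C3 * (N / L^(k+1)) * (η * L / W) := mul_le_mul_of_nonneg_left hYle (by positivity)
        _ = (η * (2 * C3)) * (N / L^k) / (2 * W) := by rw [pow_succ]; field_simp
        _ ≤ (c * W) * (N / L^k) / (2 * W) := by gcongr
        _ = _ := by field_simp
    linarith
  refine ⟨(TS W t Y k).biUnion (EX W z N Y), ?_, ?_⟩
  · rw [card_biUnion (by
      intro I hI J hJ hne
      have hI := mem_TS.1 hI
      have hJ := mem_TS.1 hJ
      exact EX_disj hW hJ.1.1 (hI.1.2.trans hJ.1.2.symm) hne)]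
    push_cast
    calc (1 / (4 * k * W)) ^ k * (c / 2) * η^k * N = (η * L / W / 2 / (2 * k)) ^ k * (c / 2 * (N / L^k)) := by
          have : (η * L / W / 2 / (2 * k)) = (1 / (4 * k * W)) * η * L := by field_simp; ring
          rw [this, mul_pow, mul_pow]
          field_simp
      _ ≤ (TS W t Y k).card * (c / 2 * (N / L^k)) := by
          refine mul_le_mul_of_nonneg_right (le_trans ?_ hTS) (by positivity)
          refine pow_le_pow_left₀ (by positivity) ?_ _
          gcongr
      _ = ∑ I ∈ TS W t Y k, (c / 2 * (N / L^k)) := by rw [sum_const, nsmul_eq_mul]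
      _ ≤ _ := sum_le_sum hEX
  · intro n hn
    obtain ⟨I, hI, hnI⟩ := mem_biUnion.1 hn
    have hI := mem_TS.1 hI
    have hg := mem_GoodS.1 (EX_sub hnI)
    refine ⟨hg.1.1, ?_⟩
    have hbd : ∀ h ∈ IW W I, h ≤ ⌊η * L⌋₊ := by
      intro h hh
      obtain ⟨i, hi, rfl⟩ := mem_image.1 hh
      refine (Nat.mul_le_mul_left W (mem_range.1 (hI.1.1 hi)).le).trans (Nat.le_floor ?_)
      push_cast; exact hWY
    have htwo : 1 < ((IW W I).filter (fun h => (n + h).Prime)).card := hg.2.1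
    obtain ⟨x, hx, y, hy, hxy⟩ := one_lt_card.1 htwo
    rw [mem_filter] at hx hy
    rcases lt_or_gt_of_ne hxy with h | h
    · exact ⟨x, y, h, hbd y hy.1, hx.2, hy.2⟩
    · exact ⟨y, x, h, hbd x hx.1, hy.2, hx.2⟩

theorem final (ϑ : ℝ) (hϑ : 1/2 < ϑ) (hLD : HasLevelOfDistribution ϑ) :
    ∃ k : ℕ, ∃ c₅ : ℝ, 0 < c₅ ∧ ∃ η₀ : ℝ, 0 < η₀ ∧ ∀ η : ℝ, 0 < η → η < η₀ → ∀ ε : ℝ, 0 < ε →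
      ∃ N₀ : ℕ, ∀ N : ℕ, N₀ ≤ N → (1 - ε) * (c₅ * η ^ (k - 1) * (N:ℝ) / Real.log N) ≤ (gapCount N (η * Real.log N) : ℝ) := by
  obtain ⟨k, c1, η₁, hk, hc1, hη₁, hU⟩ := union_count ϑ hϑ hLD
  refine ⟨k, c1 / 4, by positivity, η₁, hη₁, ?_⟩
  intro η hη hη1 ε hε
  obtain ⟨N1, hN1⟩ := hU η hη hη1
  set g := c1 / 4 * η^(k-1) with hg
  have hg0 : 0 < g := by positivity
  obtain ⟨N2, hN2⟩ := pow_log_small ⌈1 / g⌉₊ 1 1 one_pos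
  have hlog : Filter.Tendsto (fun N : ℕ => Real.log N) Filter.atTop Filter.atTop := Real.tendsto_log_atTop.comp tendsto_natCast_atTop_atTop
  obtain ⟨N3, hN3⟩ := Filter.eventually_atTop.1 (hlog.eventually_ge_atTop (max 1 (1 / η)))
  refine ⟨max N1 (max N2 N3), ?_⟩
  intro N hN
  have hl := hN3 N (by omega)
  have h2 := hN2 N (by omega)
  obtain ⟨S, hS1, hS2⟩ := hN1 N (by omega)
  set L := Real.log N with hLdef
  have hL1 : 1 ≤ L := (le_max_left _ _).trans hl
  have hL0 : 0 < L := by linarith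
  have hX : 1 ≤ η * L := by
    have := (le_max_right _ _).trans hl
    rw [div_le_iff₀ hη] at this; linarith
  have hX0 : 0 < η * L := by linarith
  have hfl : ((⌊η * L⌋₊ : ℕ):ℝ) ≤ η * L := Nat.floor_le hX0.le
  have h3 := gap_count N ⌊η * L⌋₊ (η * L) hfl S hS2
  set G := gapCount N (η * L) with hG
  have h4 : (S.card : ℝ) ≤ (((⌊η * L⌋₊ : ℕ):ℝ) + 1) * ((G:ℝ) + 1) := by exact_mod_cast h3
  have h5 : c1 * η^k * N ≤ (2 * (η * L)) * ((G:ℝ) + 1) := by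
    refine hS1.trans (h4.trans ?_)
    refine mul_le_mul_of_nonneg_right (by linarith) (by positivity)
  have hpow : η^k = η^(k-1) * η := by rw [← pow_succ]; congr 1; omega
  have h6 : 2 * (g * N / L) ≤ G + 1 := by
    rw [← mul_div_assoc, div_le_iff₀ hL0]
    have : 2 * η * (2 * (g * N)) ≤ 2 * η * (((G:ℝ) + 1) * L) := by
      rw [hpow] at h5
      rw [hg]
      linarith
    exact le_of_mul_le_mul_left this (by positivity)
  have h7 : 1 ≤ g * N / L := by
    rw [le_div_iff₀ hL0, one_mul]
    rw [pow_one, Real.rpow_one] at h2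
    have h8 : 1 / g ≤ (⌈1 / g⌉₊ : ℕ) := Nat.le_ceil _
    have h9 : 1 / g * L ≤ N := (mul_le_mul_of_nonneg_right h8 hL0.le).trans h2
    rw [one_div, ← div_eq_inv_mul, div_le_iff₀ hg0] at h9
    linarith
  have h10 : (1 - ε) * (g * N / L) ≤ g * N / L := by nlinarith
  linarith

end GPY

/-- **Theorem 4 (GPY IV).** Assume the primes have level of distribution `ϑ` for some fixed
`ϑ > 1/2`. Then there exist an integer `k(ϑ)` and a constant `c₅(ϑ) > 0` such that for every
sufficiently small fixed `η > 0`, as `N → ∞`,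
`#{j : N < p_j ≤ 2N, p_{j+1} - p_j ≤ η log N} ≥ (1-o(1)) c₅(ϑ) η^{k(ϑ)-1} N / log N`. -/
theorem small_gaps_level_of_distribution (ϑ : ℝ) (hϑ : 1/2 < ϑ)
    (hLD : HasLevelOfDistribution ϑ) :
    ∃ k : ℕ, ∃ c₅ : ℝ, 0 < c₅ ∧ ∃ η₀ : ℝ, 0 < η₀ ∧ ∀ η : ℝ, 0 < η → η < η₀ →
      ∀ ε : ℝ, 0 < ε → ∃ N₀ : ℕ, ∀ N : ℕ, N₀ ≤ N →
        (1 - ε) * (c₅ * η ^ (k - 1) * N / Real.log N) ≤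
          (gapCount N (η * Real.log N) : ℝ) := by
  exact GPY.final ϑ hϑ hLD
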